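/- (Cubic large sieve without squarefreeness.) Let ε > 0 and A, B ≥ 1/2. For any complex coefficients (λ_b) indexed by b ∈ ℤ[ω]: ∑_{a ∈ ℤ[ω], a ≡ 1 (mod 3), N(a) ≤ A} μ(a)² · | ∑_{b ∈ ℤ[ω], N(b) ≤ B} λ_b χ_a(b) |² ≪_ε (AB)^ε ( A B^{1/3} + B + (AB)^{2/3} ) · ∑_{b ∈ ℤ[ω], N(b) ≤ B} |λ_b|². -/

import Mathlib

noncomputable section

open Complex

namespace CubicPaper

/-- `ω = e^{2πi/3}`. -/
def ωc : ℂ := Complex.exp (2 * Real.pi * Complex.I / 3)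

/-- The ring of Eisenstein integers `ℤ[ω]`, realized as a subring of `ℂ`. -/
def Eis : Subring ℂ := Subring.closure {ωc}

/-- `ω` as an Eisenstein integer. -/
def ωE : Eis := ⟨ωc, Subring.subset_closure (Set.mem_singleton _)⟩

/-- The ramified prime `λ = 1 + 2ω`. -/
def lam : Eis := 1 + 2 * ωE

/-- The norm `N(x) = |x|²`. -/
def Nm (x : Eis) : ℝ := Complex.normSq (x : ℂ)

/-- The norm as a natural number. -/
def NmN (x : Eis) : ℕ := ⌊Nm x⌋₊

/-- `Rep x` : `x` is the canonical generator `λ^k c`, `c ≡ 1 (mod 3)`, of a nonzero ideal;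
nonzero ideals of `ℤ[ω]` are in bijection with elements satisfying `Rep`. -/
def Rep (x : Eis) : Prop := ∃ (k : ℕ) (c : Eis), (3 : Eis) ∣ (c - 1) ∧ x = lam ^ k * c

/-- `ě(z) = e^{2πi(z + z̄)}`. -/
def eE (z : ℂ) : ℂ := Complex.exp (2 * Real.pi * Complex.I * (z + (starRingEnd ℂ) z))

/-- Characterizing axioms of the cubic residue symbol; `χ b a` denotes `(a/b)₃`
(the lower entry `b ≡ 1 (mod 3)` comes first). -/
structure IsCubicSymbol (χ : Eis → Eis → Eis) : Prop where
  one_bot : ∀ a, χ 1 a = 1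
  mul_bot : ∀ b₁ b₂ a, (3 : Eis) ∣ (b₁ - 1) → (3 : Eis) ∣ (b₂ - 1) →
    χ (b₁ * b₂) a = χ b₁ a * χ b₂ a
  prime_vals : ∀ π a, Prime π → (3 : Eis) ∣ (π - 1) →
    χ π a = 0 ∨ χ π a = 1 ∨ χ π a = ωE ∨ χ π a = ωE ^ 2
  prime_congr : ∀ π a, Prime π → (3 : Eis) ∣ (π - 1) →
    π ∣ (a ^ ((NmN π - 1) / 3) - χ π a)
  prime_eq_zero : ∀ π a, Prime π → (3 : Eis) ∣ (π - 1) → (χ π a = 0 ↔ π ∣ a)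

/-- Characterizing axioms of the Möbius function on `ℤ[ω]`. -/
structure IsMoebius (μ : Eis → ℤ) : Prop where
  isUnit : ∀ u : Eis, IsUnit u → μ u = 1
  prime_mul : ∀ p x, Prime p → ¬ p ∣ x → μ (p * x) = - μ x
  eq_zero : ∀ x : Eis, ¬ Squarefree x → μ x = 0

/-- The cubic Gauss sum `g₃(m, c) = ∑_{d mod c} χ_c(d) ě(md/c)`. -/
def g₃ (χ : Eis → Eis → Eis) (m c : Eis) : ℂ :=
  ∑ᶠ d : Eis ⧸ Ideal.span {c}, ((χ c d.out : Eis) : ℂ) * eE (((m * d.out : Eis) : ℂ) / (c : ℂ))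

/-- The normalized cubic Gauss sum `g̃₃(m, c) = N(c)^{-1/2} g₃(m, c)`. -/
def g₃n (χ : Eis → Eis → Eis) (m c : Eis) : ℂ :=
  ((Real.sqrt (Nm c) : ℂ))⁻¹ * g₃ χ m c

/-- Euler's totient on `ℤ[ω]`. -/
def phiE (b : Eis) : ℕ := Nat.card {x : Eis ⧸ Ideal.span {b} // IsUnit x}

/-- The kernel `Φ_j(y) = (1/2πi)∫_{(2)} (2π)^{-jw} y^{-w} (Γ(1/2+w)/Γ(1/2))^j dw/w`. -/
def Φ (j : ℕ) (y : ℝ) : ℂ :=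
  (1 / (2 * Real.pi)) * ∫ t : ℝ,
    (2 * Real.pi : ℂ) ^ (-((j : ℂ) * (2 + t * Complex.I))) *
    (y : ℂ) ^ (-(2 + t * Complex.I)) *
    (Complex.Gamma (1 / 2 + (2 + t * Complex.I)) / Complex.Gamma (1 / 2)) ^ j /
    (2 + t * Complex.I)

/-- `A₁(q)`, the sum appearing in the approximate functional equation for `L(1/2, χ_q)`. -/
def A₁ (χ : Eis → Eis → Eis) (q : Eis) : ℂ :=
  ∑' n : {x : Eis // Rep x},
    ((χ q n.1 : Eis) : ℂ) * (Nm n.1 : ℂ) ^ (-(1/2 : ℂ)) *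
      Φ 1 (Nm n.1 / Real.sqrt (3 * Nm q))

/-- `A₂(q)`, the double sum appearing in the approximate functional equation for
`|L(1/2, χ_q)|²`. -/
def A₂ (χ : Eis → Eis → Eis) (q : Eis) : ℂ :=
  ∑' p : {x : Eis // Rep x} × {x : Eis // Rep x},
    ((χ q p.1.1 : Eis) : ℂ) * (starRingEnd ℂ) ((χ q p.2.1 : Eis) : ℂ) *
      ((Nm p.1.1 * Nm p.2.1 : ℝ) : ℂ) ^ (-(1/2 : ℂ)) *
      Φ 2 (Nm p.1.1 * Nm p.2.1 / (3 * Nm q))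

/-- `M_Y(q) = ∑_{𝔩² ∣ q, N(𝔩) ≤ Y} μ(𝔩)` (sum over nonzero ideals `𝔩`, i.e. over
canonical generators). -/
def MY (μ : Eis → ℤ) (Y : ℝ) (q : Eis) : ℤ :=
  ∑ᶠ l ∈ {l : Eis | Rep l ∧ l ^ 2 ∣ q ∧ Nm l ≤ Y}, μ l

/-- `R_Y(q) = ∑_{𝔩² ∣ q, N(𝔩) > Y} μ(𝔩)`. -/
def RY (μ : Eis → ℤ) (Y : ℝ) (q : Eis) : ℤ :=
  ∑ᶠ l ∈ {l : Eis | Rep l ∧ l ^ 2 ∣ q ∧ Y < Nm l}, μ l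

/-- The mollifier `𝓜(q) = ∑_𝔟 λ(𝔟) √N(𝔟) χ_q(𝔟)` attached to coefficients `lm`
(supported on canonical generators of squarefree ideals coprime to 3). -/
def Moll (χ : Eis → Eis → Eis) (lm : Eis → ℂ) (q : Eis) : ℂ :=
  ∑ᶠ b : Eis, lm b * (Real.sqrt (Nm b) : ℂ) * ((χ q b : Eis) : ℂ)

/-- `𝒮_M(β; F) = ∑_{q ≡ 1 (9)} M_Y(q) β_q F(N(q)/X)`. -/
def SM (μ : Eis → ℤ) (Y X : ℝ) (F : ℝ → ℝ) (β : Eis → ℂ) : ℂ :=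
  ∑ᶠ q ∈ {q : Eis | (9 : Eis) ∣ (q - 1)}, (MY μ Y q : ℂ) * β q * (F (Nm q / X) : ℂ)

/-- `𝒮_R(|β|; F) = ∑_{q ≡ 1 (9)} |R_Y(q)| ‖β_q‖ F(N(q)/X)`. -/
def SR (μ : Eis → ℤ) (Y X : ℝ) (F : ℝ → ℝ) (β : Eis → ℂ) : ℝ :=
  ∑ᶠ q ∈ {q : Eis | (9 : Eis) ∣ (q - 1)}, |(RY μ Y q : ℝ)| * ‖β q‖ * F (Nm q / X)

/-- A test function: Schwartz (here: smooth), compactly supported in `(1,2)`,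
with `0 ≤ F ≤ 1`. -/
structure IsTestFn (F : ℝ → ℝ) : Prop where
  smooth : ContDiff ℝ (⊤ : ℕ∞) F
  supp : ∀ t, F t ≠ 0 → 1 < t ∧ t < 2
  nonneg : ∀ t, 0 ≤ F t
  le_one : ∀ t, F t ≤ 1

/-- `F̌(0) = ∫₀^∞ F(t) dt`. -/
def Fcheck0 (F : ℝ → ℝ) : ℝ := ∫ t in Set.Ioi (0:ℝ), F t

/-- `F̌'(0) = ∫₀^∞ F(t) log t dt`. -/
def Fcheck'0 (F : ℝ → ℝ) : ℝ := ∫ t in Set.Ioi (0:ℝ), F t * Real.log t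

/-- The Dedekind zeta function of `ℚ(ω)` (at real `s > 1`). -/
def zetaK (s : ℝ) : ℝ := ∑' n : {x : Eis // Rep x}, (Nm n.1) ^ (-s)

/-- Product of `f(N(𝔭))` over the prime ideals `𝔭 ∤ 3` of `ℤ[ω]`, i.e. over primes
`π ≡ 1 (mod 3)` (one in each associate class). -/
def primeProd (f : ℝ → ℝ) : ℝ :=
  ∏' π : {p : Eis // Prime p ∧ (3 : Eis) ∣ (p - 1)}, f (Nm π.1)

/-- Product of `f(N(𝔭))` over the prime ideals `𝔭 ∤ 3` dividing `x` (a finite product). -/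
def primeDivProd (f : ℝ → ℝ) (x : Eis) : ℝ :=
  ∏ᶠ π ∈ {p : Eis | Prime p ∧ (3 : Eis) ∣ (p - 1) ∧ p ∣ x}, f (Nm π)

/-- The Hecke `L`-series `∑_𝔫 χ_q(𝔫) N(𝔫)^{-s}` (convergent for `Re(s) > 1`). -/
def heckeSeries (χ : Eis → Eis → Eis) (q : Eis) (s : ℂ) : ℂ :=
  ∑' n : {x : Eis // Rep x}, ((χ q n.1 : Eis) : ℂ) * (Nm n.1 : ℂ) ^ (-s)

/-- `L` is the (unique) entire continuation of the Hecke `L`-series of `χ_q`. -/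
def IsHeckeL (χ : Eis → Eis → Eis) (q : Eis) (L : ℂ → ℂ) : Prop :=
  Differentiable ℂ L ∧ ∀ s : ℂ, 1 < s.re → L s = heckeSeries χ q s

/-- Membership in the family `F₃` of conductors of primitive cubic Hecke characters
congruent to `1 (mod 9)`. -/
def memF₃ (q : Eis) : Prop :=
  ∃ q₁ q₂ : Eis, (3 : Eis) ∣ (q₁ - 1) ∧ (3 : Eis) ∣ (q₂ - 1) ∧ Squarefree (q₁ * q₂) ∧
    NmN (q₁ * q₂ ^ 2) % 9 = 1 ∧ q = q₁ * q₂ ^ 2 ∧ (9 : Eis) ∣ (q - 1) ∧ q ≠ 1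

/-- `ψ_α(r, s) = ∑_{c ≡ 1 (3), (c, α) = 1} g₃(r, c) N(c)^{-s}`. -/
def ψa (χ : Eis → Eis → Eis) (α r : Eis) (s : ℂ) : ℂ :=
  ∑' c : {c : Eis // (3 : Eis) ∣ (c - 1) ∧ IsCoprime c α},
    g₃ χ r c.1 * (Nm c.1 : ℂ) ^ (-s)

/-- `ψ(r, s) = ∑_{c ≡ 1 (3)} g₃(r, c) N(c)^{-s}`. -/
def ψ₀ (χ : Eis → Eis → Eis) (r : Eis) (s : ℂ) : ℂ :=
  ∑' c : {c : Eis // (3 : Eis) ∣ (c - 1)}, g₃ χ r c.1 * (Nm c.1 : ℂ) ^ (-s)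

/-- `Δ_α(s) = ∏_{π ≡ 1 (3) prime, π ∣ α} (1 - N(π)^{2-3s})`. -/
def Δprod (α : Eis) (s : ℂ) : ℂ :=
  ∏ᶠ π ∈ {p : Eis | Prime p ∧ (3 : Eis) ∣ (p - 1) ∧ p ∣ α},
    (1 - (Nm π : ℂ) ^ ((2 : ℂ) - 3 * s))

/-- `Ψ` is the (unique) continuation of `ψ(r, ·)` to the strip `1 < Re(s) < 2`,
holomorphic away from `s = 4/3`. -/
def IsPsiContinuation (χ : Eis → Eis → Eis) (r : Eis) (Ψ : ℂ → ℂ) : Prop :=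
  (∀ s : ℂ, 1 < s.re → s.re < 2 → s ≠ 4/3 → DifferentiableAt ℂ Ψ s) ∧
  (∀ s : ℂ, 3/2 < s.re → s.re < 2 → Ψ s = ψ₀ χ r s)


section
lemma ωc_eq : ωc = ⟨-1/2, Real.sqrt 3 / 2⟩ := by
  unfold ωc
  have h : (2 * Real.pi * Complex.I / 3 : ℂ) = ((Real.pi - Real.pi / 3 : ℝ) : ℂ) * Complex.I := by
    push_cast; ring
  rw [h]
  apply Complex.ext
  · rw [Complex.exp_ofReal_mul_I_re, Real.cos_pi_sub, Real.cos_pi_div_three]; norm_num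
  · rw [Complex.exp_ofReal_mul_I_im, Real.sin_pi_sub, Real.sin_pi_div_three]

lemma ωc_sq : ωc ^ 2 = -1 - ωc := by
  have h3 : Real.sqrt 3 * Real.sqrt 3 = 3 := Real.mul_self_sqrt (by norm_num)
  rw [ωc_eq, sq]
  apply Complex.ext
  · simp; nlinarith
  · simp; ring

lemma ωE_sq : ωE ^ 2 = -1 - ωE := by
  apply Subtype.ext
  push_cast
  exact ωc_sq

/-- coordinates -/
def mkE (a b : ℤ) : Eis := (a : Eis) + (b : Eis) * ωE

lemma mkE_coe (a b : ℤ) : ((mkE a b : Eis) : ℂ) = a + b * ωc := by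
  unfold mkE; push_cast; rfl

lemma mkE_add (a b c d : ℤ) : mkE a b + mkE c d = mkE (a + c) (b + d) := by
  unfold mkE; push_cast; ring

lemma mkE_mul (a b c d : ℤ) : mkE a b * mkE c d = mkE (a * c - b * d) (a * d + b * c - b * d) := by
  unfold mkE; push_cast
  linear_combination ((b : Eis) * d) * ωE_sq

lemma mkE_neg (a b : ℤ) : - mkE a b = mkE (-a) (-b) := by
  unfold mkE; push_cast; ring

lemma mkE_surj (x : Eis) : ∃ a b : ℤ, x = mkE a b := by
  obtain ⟨x, hx⟩ := x
  suffices h : ∃ a b : ℤ, x = a + b * ωc by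
    obtain ⟨a, b, h⟩ := h
    exact ⟨a, b, Subtype.ext (by rw [mkE_coe]; exact h)⟩
  unfold Eis at hx
  induction hx using Subring.closure_induction with
  | mem x hx => exact ⟨0, 1, by simpa using hx⟩
  | zero => exact ⟨0, 0, by simp⟩
  | one => exact ⟨1, 0, by simp⟩
  | add x y _ _ hx hy =>
    obtain ⟨a, b, rfl⟩ := hx
    obtain ⟨c, d, rfl⟩ := hy
    exact ⟨a + c, b + d, by push_cast; ring⟩
  | neg x _ hx =>
    obtain ⟨a, b, rfl⟩ := hx
    exact ⟨-a, -b, by push_cast; ring⟩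
  | mul x y _ _ hx hy =>
    obtain ⟨a, b, rfl⟩ := hx
    obtain ⟨c, d, rfl⟩ := hy
    refine ⟨a * c - b * d, a * d + b * c - b * d, ?_⟩
    push_cast
    linear_combination ((b : ℂ) * d) * ωc_sq

lemma normSq_lin (a b : ℝ) : Complex.normSq ((a : ℂ) + b * ωc) = a ^ 2 - a * b + b ^ 2 := by
  have h3 : Real.sqrt 3 * Real.sqrt 3 = 3 := Real.mul_self_sqrt (by norm_num)
  rw [ωc_eq, Complex.normSq_apply]
  simp
  nlinarith

lemma im_lin (a b : ℝ) : ((a : ℂ) + b * ωc).im = b * (Real.sqrt 3 / 2) := by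
  rw [ωc_eq]; simp

lemma Nm_mkE (a b : ℤ) : Nm (mkE a b) = ((a ^ 2 - a * b + b ^ 2 : ℤ) : ℝ) := by
  unfold Nm
  rw [mkE_coe]
  have := normSq_lin a b
  push_cast at this ⊢
  exact this

lemma mkE_inj {a b c d : ℤ} (h : mkE a b = mkE c d) : a = c ∧ b = d := by
  have h2 : mkE (a - c) (b - d) = 0 := by
    rw [show a - c = a + -c by ring, show b - d = b + -d by ring, ← mkE_add, ← mkE_neg, h, add_neg_cancel]
  have h3 : Nm (mkE (a - c) (b - d)) = 0 := by rw [h2]; simp [Nm]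
  rw [Nm_mkE] at h3
  have h4 : (a - c) ^ 2 - (a - c) * (b - d) + (b - d) ^ 2 = 0 := by exact_mod_cast h3
  have h5 : (b - d) = 0 := by nlinarith [sq_nonneg (2 * (a - c) - (b - d)), sq_nonneg (b - d)]
  have h6 : (a - c) = 0 := by nlinarith [sq_nonneg (2 * (b - d) - (a - c)), sq_nonneg (a - c)]
  constructor <;> linarith

/-- additive equivalence with `ℤ × ℤ` -/
def eqv : (ℤ × ℤ) ≃ Eis := Equiv.ofBijective (fun p => mkE p.1 p.2)
  ⟨fun p q h => Prod.ext (mkE_inj h).1 (mkE_inj h).2, fun x => by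
    obtain ⟨a, b, rfl⟩ := mkE_surj x; exact ⟨(a, b), rfl⟩⟩

@[simp] lemma eqv_apply (p : ℤ × ℤ) : eqv p = mkE p.1 p.2 := rfl

lemma Nm_mul (x y : Eis) : Nm (x * y) = Nm x * Nm y := by
  unfold Nm; push_cast; exact map_mul _ _ _

@[simp] lemma Nm_zero : Nm 0 = 0 := by simp [Nm]
@[simp] lemma Nm_one : Nm 1 = 1 := by simp [Nm]

lemma Nm_pow (x : Eis) (n : ℕ) : Nm (x ^ n) = Nm x ^ n := by
  unfold Nm; push_cast; exact map_pow _ _ _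

lemma Nm_neg (x : Eis) : Nm (-x) = Nm x := by
  unfold Nm; push_cast; exact Complex.normSq_neg _

lemma Nm_nonneg (x : Eis) : 0 ≤ Nm x := Complex.normSq_nonneg _

lemma Nm_eq_zero {x : Eis} : Nm x = 0 ↔ x = 0 := by
  unfold Nm; rw [Complex.normSq_eq_zero]; simp

lemma Nm_int (x : Eis) : ∃ n : ℕ, Nm x = n := by
  obtain ⟨a, b, rfl⟩ := mkE_surj x
  have h : 0 ≤ a ^ 2 - a * b + b ^ 2 := by nlinarith [sq_nonneg (a - b), sq_nonneg a, sq_nonneg b]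
  refine ⟨(a ^ 2 - a * b + b ^ 2).toNat, ?_⟩
  rw [Nm_mkE]
  have h2 := Int.toNat_of_nonneg h
  exact_mod_cast congrArg (Int.cast : ℤ → ℝ) h2.symm

lemma NmN_cast (x : Eis) : (NmN x : ℝ) = Nm x := by
  obtain ⟨n, hn⟩ := Nm_int x
  unfold NmN; rw [hn]; simp

lemma NmN_mul (x y : Eis) : NmN (x * y) = NmN x * NmN y := by
  have : (NmN (x * y) : ℝ) = NmN x * NmN y := by simp only [NmN_cast, Nm_mul]
  exact_mod_cast this

lemma NmN_eq_zero {x : Eis} : NmN x = 0 ↔ x = 0 := by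
  rw [← Nm_eq_zero, ← NmN_cast]; simp

lemma NmN_mkE (a b : ℤ) : (NmN (mkE a b) : ℤ) = a ^ 2 - a * b + b ^ 2 := by
  have := Nm_mkE a b
  rw [← NmN_cast] at this
  exact_mod_cast this

lemma one_le_Nm {x : Eis} (hx : x ≠ 0) : 1 ≤ Nm x := by
  rw [← NmN_cast]
  have : NmN x ≠ 0 := fun h => hx (NmN_eq_zero.1 h)
  exact_mod_cast Nat.one_le_iff_ne_zero.2 this

lemma Nm_pos {x : Eis} (hx : x ≠ 0) : 0 < Nm x := lt_of_lt_of_le one_pos (one_le_Nm hx)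

lemma exists_near (z : ℂ) : ∃ q : Eis, Complex.normSq (z - q) < 1 := by
  have h3 : 0 < Real.sqrt 3 := Real.sqrt_pos.2 (by norm_num)
  obtain ⟨u, v, hz⟩ : ∃ u v : ℝ, z = u + v * ωc := by
    refine ⟨z.re + z.im / Real.sqrt 3, 2 * z.im / Real.sqrt 3, ?_⟩
    rw [ωc_eq]
    apply Complex.ext
    · simp; ring
    · simp; field_simp
  refine ⟨mkE (round u) (round v), ?_⟩
  have hu := abs_sub_round u
  have hv := abs_sub_round v
  have : z - (mkE (round u) (round v) : Eis) = ((u - round u : ℝ) : ℂ) + ((v - round v : ℝ) : ℂ) * ωc := by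
    rw [hz, mkE_coe]; push_cast; ring
  rw [this, normSq_lin]
  rw [abs_le] at hu hv
  set s := u - round u
  set t := v - round v
  nlinarith [mul_nonneg (sub_nonneg.2 hu.1) (sub_nonneg.2 hv.1), mul_nonneg (sub_nonneg.2 hu.2) (sub_nonneg.2 hv.2),
   mul_nonneg (sub_nonneg.2 hu.1) (sub_nonneg.2 hv.2), mul_nonneg (sub_nonneg.2 hu.2) (sub_nonneg.2 hv.1), mul_nonneg (sub_nonneg.2 hu.1) (sub_nonneg.2 hu.2), mul_nonneg (sub_nonneg.2 hv.1) (sub_nonneg.2 hv.2)]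

/-- Euclidean quotient -/
def quo (x y : Eis) : Eis := if y = 0 then 0 else (exists_near ((x : ℂ) / y)).choose

lemma quo_spec (x : Eis) {y : Eis} (hy : y ≠ 0) : Nm (x - y * quo x y) < Nm y := by
  have hy' : (y : ℂ) ≠ 0 := by simpa using hy
  have h : Complex.normSq ((x : ℂ) / y - (quo x y : Eis)) < 1 := by
    unfold quo; rw [if_neg hy]; exact (exists_near ((x : ℂ) / y)).choose_spec
  have h2 : ((x - y * quo x y : Eis) : ℂ) = y * ((x : ℂ) / y - (quo x y : Eis)) := by
    push_cast; field_simp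
  unfold Nm
  rw [h2, map_mul]
  have : 0 < Complex.normSq (y : ℂ) := Complex.normSq_pos.2 hy'
  nlinarith

instance : EuclideanDomain Eis :=
  { (inferInstance : CommRing Eis), (inferInstance : Nontrivial Eis) with
    quotient := quo
    quotient_zero := fun x => by simp [quo]
    remainder := fun x y => x - y * quo x y
    quotient_mul_add_remainder_eq := fun x y => by ring
    r := fun x y => NmN x < NmN y
    r_wellFounded := (measure NmN).wf
    remainder_lt := fun x y hy => by
      have := quo_spec x hy
      rw [← NmN_cast, ← NmN_cast] at this
      exact_mod_cast this
    mul_left_not_lt := fun x y hy => by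
      rw [NmN_mul, not_lt]
      exact Nat.le_mul_of_pos_right _ (Nat.pos_of_ne_zero fun h => hy (NmN_eq_zero.1 h)) }


lemma ball_finite (B : ℝ) : {b : Eis | Nm b ≤ B}.Finite := by
  have : {b : Eis | Nm b ≤ B} ⊆ (fun p : ℤ × ℤ => mkE p.1 p.2) ''
      (Set.Icc (-⌈2 * |B| + 1⌉) ⌈2 * |B| + 1⌉ ×ˢ Set.Icc (-⌈2 * |B| + 1⌉) ⌈2 * |B| + 1⌉) := by
    intro b hb
    obtain ⟨x, y, rfl⟩ := mkE_surj b
    rw [Set.mem_setOf_eq, Nm_mkE] at hb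
    push_cast at hb
    have hB := le_abs_self B
    have hB0 := abs_nonneg B
    have hc : 2 * |B| + 1 ≤ ⌈2 * |B| + 1⌉ := Int.le_ceil _
    have key : ∀ u v : ℝ, u ^ 2 - u * v + v ^ 2 ≤ B → |u| ≤ 2 * |B| + 1 := by
      intro u v h
      apply abs_le_of_sq_le_sq _ (by linarith)
      nlinarith [sq_nonneg (u - 2 * v), sq_nonneg u, sq_nonneg |B|]
    have hx := (key x y hb).trans hc
    have hy := (key y x (by linarith)).trans hc
    rw [abs_le] at hx hy
    refine ⟨(x, y), ⟨⟨?_, ?_⟩, ⟨?_, ?_⟩⟩, rfl⟩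
    · exact_mod_cast hx.1
    · exact_mod_cast hx.2
    · exact_mod_cast hy.1
    · exact_mod_cast hy.2
  exact Set.Finite.subset (Set.Finite.image _ (Set.Finite.prod (Set.finite_Icc _ _) (Set.finite_Icc _ _))) this

/-- ball -/
def Ball (B : ℝ) : Finset Eis := (ball_finite B).toFinset

@[simp] lemma mem_Ball {B : ℝ} {b : Eis} : b ∈ Ball B ↔ Nm b ≤ B := by simp [Ball]

lemma card_Ball {B : ℝ} (hB : 1 ≤ B) : ((Ball B).card : ℝ) ≤ 16 * B := by
  set m := ⌊Real.sqrt (2 * B)⌋ with hm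
  have hm0 : 0 ≤ m := Int.floor_nonneg.2 (Real.sqrt_nonneg _)
  have hsub : Ball B ⊆ (Finset.Icc (-m) m ×ˢ Finset.Icc (-m) m).image (fun p : ℤ × ℤ => mkE p.1 p.2) := by
    intro b hb
    rw [mem_Ball] at hb
    obtain ⟨x, y, rfl⟩ := mkE_surj b
    rw [Nm_mkE] at hb
    push_cast at hb
    have key : ∀ u v : ℤ, (u : ℝ) ^ 2 - u * v + v ^ 2 ≤ B → -m ≤ u ∧ u ≤ m := by
      intro u v h
      have h1 : |(u : ℝ)| ≤ Real.sqrt (2 * B) := by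
        apply Real.abs_le_sqrt
        nlinarith [sq_nonneg ((u : ℝ) - 2 * v), sq_nonneg (u : ℝ), sq_nonneg ((u : ℝ) - v), sq_nonneg (v : ℝ)]
      have h2 : ((|u| : ℤ) : ℝ) ≤ Real.sqrt (2 * B) := by push_cast; exact h1
      have h3 : |u| ≤ m := Int.le_floor.2 h2
      exact abs_le.1 h3
    have hx := key x y hb
    have hy := key y x (by linarith)
    simp only [Finset.mem_image, Finset.mem_product, Finset.mem_Icc]
    exact ⟨(x, y), ⟨hx, hy⟩, rfl⟩
  have h1 := (Finset.card_le_card hsub).trans Finset.card_image_le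
  rw [Finset.card_product, Int.card_Icc] at h1
  have h2 : ((m + 1 - -m).toNat : ℝ) = 2 * m + 1 := by
    have : ((m + 1 - -m).toNat : ℤ) = 2 * m + 1 := by rw [Int.toNat_of_nonneg (by linarith)]; ring
    exact_mod_cast congrArg (Int.cast : ℤ → ℝ) this
  have h3 : ((Ball B).card : ℝ) ≤ (2 * m + 1) * (2 * m + 1) := by
    rw [← h2]; exact_mod_cast h1
  have h4 : (m : ℝ) ≤ Real.sqrt (2 * B) := Int.floor_le _
  have h5 : Real.sqrt (2 * B) ^ 2 = 2 * B := Real.sq_sqrt (by linarith)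
  have h6 : 0 ≤ Real.sqrt (2 * B) := Real.sqrt_nonneg _
  have h7 : (0 : ℝ) ≤ m := by exact_mod_cast hm0
  have h8 : Real.sqrt (2 * B) ≤ 3/2 * B := by
    apply Real.sqrt_le_iff.2 ⟨by linarith, by nlinarith⟩
  nlinarith

end

section
def linE : (Fin 2 → ℤ) ≃ₗ[ℤ] Eis := LinearEquiv.ofBijective
  { toFun := fun v => mkE (v 0) (v 1)
    map_add' := fun v w => by simp [mkE_add]
    map_smul' := fun m v => by simp [mkE]; ring }
  ⟨fun v w h => by
      have := mkE_inj h
      funext i; fin_cases i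
      · exact this.1
      · exact this.2, fun x => by
      obtain ⟨a, b, rfl⟩ := mkE_surj x
      exact ⟨![a, b], rfl⟩⟩

def basE : Module.Basis (Fin 2) ℤ Eis := Module.Basis.ofEquivFun linE.symm

lemma basE_repr (a b : ℤ) : basE.equivFun (mkE a b) = ![a, b] := by
  simp only [basE, Module.Basis.equivFun_ofEquivFun]
  rw [LinearEquiv.symm_apply_eq]; rfl

lemma linE_apply (v : Fin 2 → ℤ) : linE v = mkE (v 0) (v 1) := rfl

lemma basE_0 : basE 0 = mkE 1 0 := by
  simp only [basE, Module.Basis.coe_ofEquivFun, LinearEquiv.symm_symm]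
  simp [linE_apply]
lemma basE_1 : basE 1 = mkE 0 1 := by
  simp only [basE, Module.Basis.coe_ofEquivFun, LinearEquiv.symm_symm]
  simp [linE_apply]

instance : Module.Free ℤ Eis := Module.Free.of_basis basE
instance : Module.Finite ℤ Eis := Module.Finite.of_basis basE

lemma norm_eq (q : Eis) : Algebra.norm ℤ q = NmN q := by
  obtain ⟨a, b, rfl⟩ := mkE_surj q
  rw [Algebra.norm_eq_matrix_det basE, Matrix.det_fin_two]
  simp only [Algebra.leftMulMatrix_eq_repr_mul, ← Module.Basis.equivFun_apply, basE_0, basE_1, mkE_mul, basE_repr]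
  simp [NmN_mkE]; ring

lemma card_quot (q : Eis) : Nat.card (Eis ⧸ Ideal.span {q}) = NmN q := by
  have h := Ideal.absNorm_span_singleton q
  rw [norm_eq] at h
  have h2 : Nat.card (Eis ⧸ Ideal.span {q}) = Ideal.absNorm (Ideal.span {q}) := rfl
  rw [h2, h]; simp

instance instFinQuot (q : Eis) [NeZero q] : Finite (Eis ⧸ Ideal.span {q}) := by
  apply Nat.finite_of_card_ne_zero
  rw [card_quot]
  exact fun h => NeZero.ne q (NmN_eq_zero.1 h)

instance instFintypeQuot (q : Eis) [NeZero q] : Fintype (Eis ⧸ Ideal.span {q}) := Fintype.ofFinite _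

lemma lam_sq : lam ^ 2 = -3 := by
  unfold lam; linear_combination 4 * ωE_sq

lemma dvd3_iff (a b : ℤ) : (3 : Eis) ∣ mkE a b ↔ 3 ∣ a ∧ 3 ∣ b := by
  constructor
  · rintro ⟨y, hy⟩
    obtain ⟨c, d, rfl⟩ := mkE_surj y
    have : (3 : Eis) * mkE c d = mkE (3 * c) (3 * d) := by unfold mkE; push_cast; ring
    rw [this] at hy
    have := mkE_inj hy
    exact ⟨⟨c, this.1⟩, ⟨d, this.2⟩⟩
  · rintro ⟨⟨c, rfl⟩, ⟨d, rfl⟩⟩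
    exact ⟨mkE c d, by unfold mkE; push_cast; ring⟩

lemma mkE_sub_one (a b : ℤ) : mkE a b - 1 = mkE (a - 1) b := by
  unfold mkE; push_cast; ring

lemma lam_dvd_iff (a b : ℤ) : lam ∣ mkE a b ↔ 3 ∣ a + b := by
  have hl : lam = mkE 1 2 := by unfold lam mkE; push_cast; ring
  rw [hl]
  constructor
  · rintro ⟨y, hy⟩
    obtain ⟨c, d, rfl⟩ := mkE_surj y
    rw [mkE_mul] at hy
    have := mkE_inj hy
    omega
  · rintro ⟨k, hk⟩
    refine ⟨mkE (b - k) (b - 2 * k), ?_⟩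
    rw [mkE_mul]
    have : a = 3 * k - b := by omega
    subst this
    congr 1 <;> ring

lemma exists_primary {x : Eis} (hx : ¬ lam ∣ x) : ∃ u : Eisˣ, (3 : Eis) ∣ u * x - 1 := by
  obtain ⟨a, b, rfl⟩ := mkE_surj x
  rw [lam_dvd_iff] at hx
  have hw : ωE * (ωE ^ 2) = 1 := by linear_combination (ωE - 1) * ωE_sq
  let w : Eisˣ := ⟨ωE, ωE ^ 2, hw, by rw [mul_comm]; exact hw⟩
  have hwm : ((w : Eisˣ) : Eis) = mkE 0 1 := by simp [w, mkE]
  have h : (a % 3 = 1 ∧ b % 3 = 0) ∨ (a % 3 = 2 ∧ b % 3 = 0) ∨ (a % 3 = 0 ∧ b % 3 = 1) ∨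
    (a % 3 = 0 ∧ b % 3 = 2) ∨ (a % 3 = 1 ∧ b % 3 = 1) ∨ (a % 3 = 2 ∧ b % 3 = 2) := by omega
  rcases h with h | h | h | h | h | h
  · refine ⟨1, ?_⟩
    rw [Units.val_one, one_mul, mkE_sub_one, dvd3_iff]; omega
  · refine ⟨-1, ?_⟩
    rw [Units.val_neg, Units.val_one, neg_one_mul, mkE_neg, mkE_sub_one, dvd3_iff]; omega
  · refine ⟨w ^ 2, ?_⟩
    rw [Units.val_pow_eq_pow_val, hwm, sq, mkE_mul, mkE_mul, mkE_sub_one, dvd3_iff]; omega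
  · refine ⟨- w ^ 2, ?_⟩
    rw [Units.val_neg, Units.val_pow_eq_pow_val, hwm, sq, mkE_mul, neg_mul, mkE_mul, mkE_neg, mkE_sub_one, dvd3_iff]; omega
  · refine ⟨-w, ?_⟩
    simp only [Units.val_neg, hwm, mkE_mul, mkE_sub_one, dvd3_iff, neg_mul, mkE_neg]; omega
  · refine ⟨w, ?_⟩
    simp only [hwm, mkE_mul, mkE_sub_one, dvd3_iff]; omega

lemma Nm_unit {u : Eis} (h : IsUnit u) : Nm u = 1 := by
  obtain ⟨v, hv⟩ := h.exists_right_inv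
  have h1 : NmN u * NmN v = 1 := by
    rw [← NmN_mul, hv]
    have : (NmN (1 : Eis) : ℝ) = 1 := by rw [NmN_cast, Nm_one]
    exact_mod_cast this
  rw [← NmN_cast, Nat.eq_one_of_mul_eq_one_right h1]; simp

lemma unit_primary {u : Eis} (h : IsUnit u) (h3 : (3 : Eis) ∣ u - 1) : u = 1 := by
  have h1 := Nm_unit h
  obtain ⟨a, b, rfl⟩ := mkE_surj u
  rw [Nm_mkE] at h1
  rw [mkE_sub_one, dvd3_iff] at h3
  have h2 : a ^ 2 - a * b + b ^ 2 = 1 := by exact_mod_cast h1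
  have hb : b = 0 := by
    have : 3 * b ^ 2 ≤ 4 := by nlinarith [sq_nonneg (2 * a - b)]
    have : -2 < b := by nlinarith
    have : b < 2 := by nlinarith
    omega
  subst hb
  have : (a - 1) * (a + 1) = 0 := by linarith
  rcases mul_eq_zero.1 this with h | h
  · have : a = 1 := by omega
    subst this; unfold mkE; simp
  · omega

/-- primary primes -/
abbrev PP := {p : Eis // Prime p ∧ (3 : Eis) ∣ p - 1}

instance (p : PP) : NeZero p.1 := ⟨p.2.1.ne_zero⟩

lemma PP.not_dvd_three (p : PP) : ¬ p.1 ∣ 3 := fun h =>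
  p.2.1.not_isUnit (isUnit_of_dvd_one (by
    have h2 := h.trans p.2.2
    have := dvd_sub (dvd_refl p.1) h2
    simpa using this))

lemma primary_mul {a b : Eis} (ha : (3 : Eis) ∣ a - 1) (hb : (3 : Eis) ∣ b - 1) : (3 : Eis) ∣ a * b - 1 := by
  have : a * b - 1 = (a - 1) * b + (b - 1) := by ring
  rw [this]; exact dvd_add (ha.mul_right _) hb

lemma primary_prod {ι : Type*} (S : Finset ι) (f : ι → Eis) (h : ∀ i ∈ S, (3 : Eis) ∣ f i - 1) : (3 : Eis) ∣ (∏ i ∈ S, f i) - 1 := by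
  classical
  induction S using Finset.induction_on with
  | empty => simp
  | insert a s ha ih =>
    rw [Finset.prod_insert ha]
    exact primary_mul (h a (by simp)) (ih fun i hi => h i (by simp [hi]))

lemma primary_not_lam {a : Eis} (h : (3 : Eis) ∣ a - 1) : ¬ lam ∣ a := by
  intro hl
  have h3 : lam ∣ 3 := ⟨-lam, by linear_combination lam_sq⟩
  have h1 : lam ∣ 1 := by
    have := dvd_sub hl (h3.trans h); simpa using this
  have hl : lam = mkE 1 2 := by unfold lam mkE; push_cast; ring
  have := Nm_unit (isUnit_of_dvd_one h1)
  rw [hl, Nm_mkE] at this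
  norm_num at this

lemma PP.eq_of_dvd {p q : PP} (h : p.1 ∣ q.1) : p = q := by
  have hassoc := (p.2.1.dvd_prime_iff_associated q.2.1).1 h
  obtain ⟨u, hu⟩ := hassoc
  have h3 : (3 : Eis) ∣ (u : Eis) - 1 := by
    have : (u : Eis) - 1 = (p.1 * u - 1) - u * (p.1 - 1) := by ring
    rw [this, hu]
    exact dvd_sub q.2.2 (p.2.2.mul_left _)
  have := unit_primary u.isUnit h3
  rw [this, mul_one] at hu
  exact Subtype.ext hu

lemma PP.isCoprime {p q : PP} (h : p ≠ q) : IsCoprime p.1 q.1 := by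
  rw [(p.2.1.irreducible).coprime_iff_not_dvd]
  exact fun hd => h (PP.eq_of_dvd hd)

/-- product -/
def PS (S : Finset PP) : Eis := ∏ p ∈ S, p.1

lemma PS_primary (S : Finset PP) : (3 : Eis) ∣ PS S - 1 := primary_prod S _ fun p _ => p.2.2

lemma PS_ne_zero (S : Finset PP) : PS S ≠ 0 := Finset.prod_ne_zero_iff.2 fun p _ => p.2.1.ne_zero

instance (S : Finset PP) : NeZero (PS S) := ⟨PS_ne_zero S⟩

@[simp] lemma PS_empty : PS ∅ = 1 := by simp [PS]

lemma PS_dvd_of_forall {S : Finset PP} {b : Eis} (h : ∀ p ∈ S, p.1 ∣ b) : PS S ∣ b := by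
  apply Finset.prod_dvd_of_coprime
  · intro p _ q _ hpq
    exact PP.isCoprime hpq
  · exact h

lemma dvd_PS_iff {p : PP} {S : Finset PP} : p.1 ∣ PS S ↔ p ∈ S := by
  constructor
  · intro h
    obtain ⟨q, hq, hd⟩ := (p.2.1.dvd_finsetProd_iff _).1 h
    rwa [PP.eq_of_dvd hd]
  · intro h; exact Finset.dvd_prod_of_mem _ h

lemma PS_inj {S T : Finset PP} (h : PS S = PS T) : S = T := by
  ext p; rw [← dvd_PS_iff, ← dvd_PS_iff, h]

lemma PS_union {S T : Finset PP} [DecidableEq PP] (h : Disjoint S T) : PS (S ∪ T) = PS S * PS T := by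
  unfold PS; rw [Finset.prod_union h]

lemma PS_coprime {S T : Finset PP} (h : Disjoint S T) : IsCoprime (PS S) (PS T) := by
  apply IsCoprime.prod_left
  intro p hp
  apply IsCoprime.prod_right
  intro q hq
  exact PP.isCoprime fun e => Finset.disjoint_left.1 h hp (e ▸ hq)

lemma PS_squarefree (S : Finset PP) : Squarefree (PS S) := by
  classical
  induction S using Finset.induction_on with
  | empty => simp
  | insert a s ha ih =>
    rw [Finset.insert_eq, PS_union (by simpa using ha)]
    rw [squarefree_mul_iff]
    refine ⟨(PS_coprime (by simpa using ha)).isRelPrime, ?_, ih⟩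
    simp only [PS, Finset.prod_singleton]
    exact a.2.1.irreducible.squarefree

lemma exists_PS {a : Eis} (h3 : (3 : Eis) ∣ a - 1) (hs : Squarefree a) : ∃ S, a = PS S := by
  classical
  suffices H : ∀ a : Eis, a ≠ 0 → ¬ lam ∣ a → Squarefree a → ∃ S, Associated a (PS S) by
    have ha0 : a ≠ 0 := hs.ne_zero
    obtain ⟨S, u, hu⟩ := H a ha0 (primary_not_lam h3) hs
    refine ⟨S, ?_⟩
    have h4 : (3 : Eis) ∣ (u : Eis) - 1 := by
      have : (u : Eis) - 1 = (a * u - 1) - u * (a - 1) := by ring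
      rw [this, hu]
      exact dvd_sub (PS_primary S) (h3.mul_left _)
    rw [unit_primary u.isUnit h4, mul_one] at hu
    exact hu
  intro a
  induction a using UniqueFactorizationMonoid.induction_on_prime with
  | h₁ => intro h; exact absurd rfl h
  | h₂ x hx => intro _ _ _; exact ⟨∅, by simpa using associated_one_iff_isUnit.2 hx⟩
  | h₃ a p ha hp ih =>
    intro h0 hl hsq
    obtain ⟨S, hS⟩ := ih ha (fun h => hl (h.mul_left _)) (hsq.of_mul_right)
    obtain ⟨u, hu⟩ := exists_primary (x := p) fun h => hl (h.mul_right _)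
    let q : PP := ⟨u * p, (Associated.prime_iff (associated_unit_mul_right p u u.isUnit)).1 hp, hu⟩
    have hq : q ∉ S := by
      intro hq
      have h1 : q.1 ∣ a := (dvd_PS_iff.2 hq).trans hS.symm.dvd
      have h2 : p ∣ a := (Dvd.intro_left _ rfl : p ∣ u * p).trans h1
      have := hsq p (mul_dvd_mul_left p h2)
      exact hp.not_isUnit this
    refine ⟨insert q S, ?_⟩
    rw [Finset.insert_eq, PS_union (by simpa using hq)]
    refine Associated.mul_mul ?_ hS
    simp only [PS, Finset.prod_singleton]
    exact associated_unit_mul_right p u u.isUnit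

lemma NmN_mod_three {a : Eis} (h : (3 : Eis) ∣ a - 1) : NmN a % 3 = 1 := by
  obtain ⟨x, y, rfl⟩ := mkE_surj a
  rw [mkE_sub_one, dvd3_iff] at h
  have h2 := NmN_mkE x y
  obtain ⟨⟨c, hc⟩, ⟨d, hd⟩⟩ := h
  have : x = 3 * c + 1 := by omega
  subst this; subst hd
  have : (NmN (mkE (3 * c + 1) (3 * d)) : ℤ) = 3 * (3 * c ^ 2 + 2 * c - (3 * c + 1) * d + 3 * d ^ 2) + 1 := by rw [h2]; ring
  omega

end

section
lemma ωE_cube : ωE ^ 3 = 1 := by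
  linear_combination (ωE - 1) * ωE_sq

lemma ωE_ne_one : ωE ≠ 1 := by
  have h := @mkE_inj 0 1 1 0
  intro h'
  have := h (by simp [mkE, h'])
  omega

lemma ωE_prim : IsPrimitiveRoot ωE 3 := by
  rw [IsPrimitiveRoot.iff_orderOf]
  exact orderOf_eq_prime ωE_cube ωE_ne_one

/-- the value set of the cubic symbol -/
def V3 : Set Eis := {v | v = 0 ∨ v = 1 ∨ v = ωE ∨ v = ωE ^ 2}

lemma V3_mul {v w : Eis} (hv : v ∈ V3) (hw : w ∈ V3) : v * w ∈ V3 := by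
  have h3 := ωE_cube
  have h4 : ωE * ωE = ωE ^ 2 := by ring
  have h5 : ωE * ωE ^ 2 = 1 := by rw [← h3]; ring
  have h6 : ωE ^ 2 * ωE = 1 := by rw [← h3]; ring
  have h7 : ωE ^ 2 * ωE ^ 2 = ωE := by linear_combination ωE * h3
  simp only [V3, Set.mem_setOf_eq] at *
  rcases hv with rfl | rfl | rfl | rfl <;> rcases hw with rfl | rfl | rfl | rfl <;> simp [h4, h5, h6, h7]

lemma V3_cube {v : Eis} (hv : v ∈ V3) (h0 : v ≠ 0) : v ^ 3 = 1 := by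
  have h3 := ωE_cube
  simp only [V3, Set.mem_setOf_eq] at *
  rcases hv with rfl | rfl | rfl | rfl
  · exact absurd rfl h0
  · simp
  · exact h3
  · rw [← pow_mul, mul_comm, pow_mul, h3, one_pow]

lemma V3_dist {p : PP} {v w : Eis} (hv : v ∈ V3) (hw : w ∈ V3) (h : p.1 ∣ v - w) : v = w := by
  have h3 := p.not_dvd_three
  have hu : ¬ p.1 ∣ 1 := fun h => p.2.1.not_unit (isUnit_of_dvd_one h)
  have a1 : ¬ p.1 ∣ ωE := fun h => hu (h.trans ⟨ωE ^ 2, by rw [← ωE_cube]; ring⟩)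
  have a2 : ¬ p.1 ∣ ωE ^ 2 := fun h => hu (h.trans ⟨ωE, by rw [← ωE_cube]; ring⟩)
  have a3 : ¬ p.1 ∣ ωE - 1 := fun h => h3 (h.trans ⟨(ωE - 1) * (-ωE^2), by linear_combination ωE^2 * ωE_sq - 3 * ωE_cube⟩)
  have a4 : ¬ p.1 ∣ ωE ^ 2 - ωE := fun h => (p.2.1.dvd_or_dvd (show p.1 ∣ ωE * (ωE - 1) by convert h using 1; ring)).elim a1 a3
  have a5 : ¬ p.1 ∣ ωE ^ 2 - 1 := fun h => (p.2.1.dvd_or_dvd (show p.1 ∣ (ωE - 1) * (-ωE^2) by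
      convert h using 1; linear_combination (- 1) * ωE_cube )).elim a3 (fun h => a2 (by simpa using h))
  have key : ∀ x y : Eis, ¬ p.1 ∣ x - y → ¬ p.1 ∣ y - x := fun x y h h' => h (by rw [← neg_sub]; exact h'.neg_right)
  have n1 := key _ _ a3
  have n2 := key _ _ a4
  have n3 := key _ _ a5
  simp only [V3, Set.mem_setOf_eq] at hv hw
  rcases hv with rfl | rfl | rfl | rfl <;> rcases hw with rfl | rfl | rfl | rfl <;>
    first
    | rfl
    | exact absurd h (by assumption)
    | (simp only [zero_sub, sub_zero, dvd_neg] at h; exact absurd h (by assumption))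

abbrev KK (p : PP) := Eis ⧸ Ideal.span {p.1}

instance (p : PP) : (Ideal.span {p.1}).IsMaximal :=
  PrincipalIdealRing.isMaximal_of_irreducible p.2.1.irreducible

instance instFieldKK (p : PP) : Field (KK p) := Ideal.Quotient.field _

lemma KK_card (p : PP) : Fintype.card (KK p) = NmN p.1 := by
  rw [← Nat.card_eq_fintype_card, card_quot]

abbrev toK (p : PP) : Eis →+* KK p := Ideal.Quotient.mk _

lemma toK_eq_iff {p : PP} {x y : Eis} : toK p x = toK p y ↔ p.1 ∣ x - y := by
  rw [Ideal.Quotient.eq, Ideal.mem_span_singleton]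

lemma toK_eq_zero {p : PP} {x : Eis} : toK p x = 0 ↔ p.1 ∣ x := by
  rw [Ideal.Quotient.eq_zero_iff_dvd]


lemma toK_out (p : PP) (r : KK p) : toK p r.out = r := Quotient.out_eq' r

variable {χ : Eis → Eis → Eis} 

lemma IsCubicSymbol.mem (hχ : IsCubicSymbol χ) (p : PP) (a : Eis) : χ p.1 a ∈ V3 := hχ.prime_vals _ a p.2.1 p.2.2

lemma IsCubicSymbol.congr' (hχ : IsCubicSymbol χ) (p : PP) (a : Eis) :
    toK p (χ p.1 a) = toK p a ^ ((NmN p.1 - 1) / 3) := by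
  rw [← map_pow, eq_comm, toK_eq_iff]
  exact hχ.prime_congr _ a p.2.1 p.2.2

lemma toK_V3 {p : PP} {v w : Eis} (hv : v ∈ V3) (hw : w ∈ V3) (h : toK p v = toK p w) : v = w :=
  V3_dist hv hw (toK_eq_iff.1 h)

lemma IsCubicSymbol.periodic (hχ : IsCubicSymbol χ) (p : PP) {a b : Eis} (h : toK p a = toK p b) :
    χ p.1 a = χ p.1 b := by
  apply toK_V3 (hχ.mem p a) (hχ.mem p b)
  rw [hχ.congr', hχ.congr', h]

lemma IsCubicSymbol.map_mul (hχ : IsCubicSymbol χ) (p : PP) (a b : Eis) :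
    χ p.1 (a * b) = χ p.1 a * χ p.1 b := by
  apply toK_V3 (hχ.mem p _) (V3_mul (hχ.mem p a) (hχ.mem p b))
  rw [_root_.map_mul, hχ.congr', hχ.congr', hχ.congr', _root_.map_mul, mul_pow]

lemma IsCubicSymbol.map_one (hχ : IsCubicSymbol χ) (p : PP) :
    χ p.1 1 = 1 := by
  apply toK_V3 (hχ.mem p _) (by simp [V3]) (p := p)
  rw [hχ.congr', _root_.map_one, one_pow]

lemma IsCubicSymbol.zero_iff (hχ : IsCubicSymbol χ) (p : PP) (a : Eis) : χ p.1 a = 0 ↔ p.1 ∣ a :=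
  hχ.prime_eq_zero _ a p.2.1 p.2.2

/-- The cubic residue character as a multiplicative character. -/
def cm (hχ : IsCubicSymbol χ) (p : PP) : MulChar (KK p) Eis where
  toFun r := χ p.1 r.out
  map_one' := by
    exact (hχ.periodic p (by rw [toK_out, _root_.map_one])).trans (hχ.map_one p)
  map_mul' a b := by
    rw [← hχ.map_mul p]
    exact hχ.periodic p (by rw [toK_out, _root_.map_mul, toK_out, toK_out])
  map_nonunit' a ha := by
    rw [hχ.zero_iff, ← toK_eq_zero, toK_out]
    by_contra h
    exact ha (isUnit_iff_ne_zero.2 h)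

lemma cm_toK (hχ : IsCubicSymbol χ) (p : PP) (a : Eis) : cm hχ p (toK p a) = χ p.1 a :=
  hχ.periodic p (by rw [toK_out])

lemma cm_mem (hχ : IsCubicSymbol χ) (p : PP) (r : KK p) : cm hχ p r ∈ V3 := hχ.mem p _

lemma toK_cm (hχ : IsCubicSymbol χ) (p : PP) (r : KK p) : toK p (cm hχ p r) = r ^ ((NmN p.1 - 1) / 3) := by
  obtain ⟨a, rfl⟩ := Ideal.Quotient.mk_surjective r
  rw [cm_toK, hχ.congr']

lemma cm_ne_zero (hχ : IsCubicSymbol χ) (p : PP) {r : KK p} (h : r ≠ 0) : cm hχ p r ≠ 0 := 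
  ((isUnit_iff_ne_zero.2 h).map (cm hχ p)).ne_zero

lemma cm_cube (hχ : IsCubicSymbol χ) (p : PP) : cm hχ p ^ 3 = 1 := by
  refine MulChar.ext fun r => ?_
  rw [MulChar.pow_apply_coe, MulChar.one_apply_coe]
  exact V3_cube (cm_mem hχ p _) (cm_ne_zero hχ p r.ne_zero)

lemma NmN_PP_gt (p : PP) : 3 < NmN p.1 := by
  have h1 := NmN_mod_three p.2.2
  have h2 : 1 < NmN p.1 := by
    rw [← KK_card]; exact Fintype.one_lt_card
  omega

lemma cm_ne_one (hχ : IsCubicSymbol χ) (p : PP) : cm hχ p ≠ 1 := by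
  intro h
  obtain ⟨g, hg⟩ := IsCyclic.exists_generator (α := (KK p)ˣ)
  have h1 : orderOf g = NmN p.1 - 1 := by
    rw [orderOf_eq_card_of_forall_mem_zpowers hg, Nat.card_units, card_quot]
  have h2 : g ^ ((NmN p.1 - 1) / 3) = 1 := by
    ext
    rw [Units.val_pow_eq_pow_val, ← toK_cm hχ, h, MulChar.one_apply_coe, _root_.map_one, Units.val_one]
  have h3 := orderOf_dvd_of_pow_eq_one h2
  rw [h1] at h3
  have h4 := NmN_PP_gt p
  have h5 := NmN_mod_three p.2.2
  have := Nat.le_of_dvd (by omega) h3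
  omega

lemma cm_neg_one (hχ : IsCubicSymbol χ) (p : PP) : cm hχ p (-1) = 1 := by
  have h1 : cm hχ p (-1) ^ 2 = 1 := by
    rw [← map_pow, neg_one_sq, _root_.map_one]
  have h2 := V3_cube (cm_mem hχ p (-1)) (cm_ne_zero hχ p (by simp))
  calc cm hχ p (-1) = cm hχ p (-1) ^ 3 := by rw [pow_succ, h1, one_mul]
    _ = 1 := h2

end

section
variable {χ : Eis → Eis → Eis} 

lemma PP_dvd_card (p : PP) : ∃ z, (NmN p.1 : Eis) = p.1 * z := by
  have : toK p (NmN p.1 : Eis) = 0 := by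
    rw [map_natCast, ← KK_card]; exact FiniteField.cast_card_eq_zero _
  rwa [toK_eq_zero] at this

/-- Jacobi sum -/
def Jc (hχ : IsCubicSymbol χ) (p : PP) : Eis := jacobiSum (cm hχ p) (cm hχ p)

lemma three_dvd_card (p : PP) : 3 ∣ NmN p.1 - 1 := by
  have := NmN_mod_three p.2.2
  omega

lemma Jc_mod_three (hχ : IsCubicSymbol χ) (p : PP) : (3 : Eis) ∣ - Jc hχ p - 1 := by
  obtain ⟨z, -, hz⟩ := exists_jacobiSum_eq_neg_one_add (n := 3) (by norm_num) (cm_cube hχ p) (cm_cube hχ p)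
    (by rw [KK_card]; exact three_dvd_card p) ωE_prim
  rw [Jc, hz]
  exact ⟨z * ωE, by linear_combination -z * ωE_sq⟩

lemma dvd_Jc (hχ : IsCubicSymbol χ) (p : PP) : p.1 ∣ Jc hχ p := by
  rw [← toK_eq_zero, Jc, jacobiSum, map_sum]
  simp_rw [_root_.map_mul, toK_cm]
  have h4 := NmN_PP_gt p
  set m := (NmN p.1 - 1) / 3 with hm
  have h := FiniteField.sum_pow_lt_card_sub_one (K := KK p)
  have key : ∀ r : KK p, r ^ m * (1 - r) ^ m = ∑ k ∈ Finset.range (m + 1), ((-1 : KK p) ^ k * (m.choose k : KK p)) * r ^ (m + k) := by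
    intro r
    have : (1 - r) = -r + 1 := by ring
    rw [this, add_pow, Finset.mul_sum]
    refine Finset.sum_congr rfl fun k _ => ?_
    rw [neg_pow r]; ring
  simp_rw [key]
  rw [Finset.sum_comm]
  refine Finset.sum_eq_zero fun k hk => ?_
  rw [← Finset.mul_sum, h, mul_zero]
  rw [KK_card]
  have := Finset.mem_range.1 hk
  omega

lemma conj_V3 {v : Eis} (hv : v ∈ V3) : (starRingEnd ℂ) (v : ℂ) = ((v ^ 2 : Eis) : ℂ) := by
  have h : (starRingEnd ℂ) ωc = ωc ^ 2 := by
    rw [ωc_sq, ωc_eq]; apply Complex.ext <;> simp <;> ring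
  have h3 : ωc ^ 3 = 1 := by
    have := congrArg (Subtype.val) ωE_cube
    simpa [ωE] using this
  rcases hv with rfl | rfl | rfl | rfl
  · simp
  · simp
  · simpa [ωE] using h
  · simp [ωE, h]

/-- complex version -/
def cmC (hχ : IsCubicSymbol χ) (p : PP) : MulChar (KK p) ℂ := (cm hχ p).ringHomComp Eis.subtype

lemma cmC_ne_one (hχ : IsCubicSymbol χ) (p : PP) : cmC hχ p ≠ 1 := by
  rw [cmC, MulChar.ringHomComp_ne_one_iff Subtype.val_injective]
  exact cm_ne_one hχ p

lemma cmC_apply (hχ : IsCubicSymbol χ) (p : PP) (r : KK p) : cmC hχ p r = ((cm hχ p r : Eis) : ℂ) := rfl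

lemma cmC_cube (hχ : IsCubicSymbol χ) (p : PP) : cmC hχ p ^ 3 = 1 := by
  rw [cmC, MulChar.ringHomComp_pow, cm_cube, MulChar.ringHomComp_one]

lemma cmC_sq (hχ : IsCubicSymbol χ) (p : PP) : cmC hχ p * cmC hχ p ≠ 1 := by
  intro h
  apply cmC_ne_one hχ p
  have := cmC_cube hχ p
  rwa [pow_succ, sq, h, one_mul] at this

lemma Nm_Jc (hχ : IsCubicSymbol χ) (p : PP) : Nm (Jc hχ p) = Nm p.1 := by
  have h := jacobiSum_mul_jacobiSum_inv (F := KK p) (F' := ℂ) (by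
    rw [ringChar.eq_zero]; exact (CharP.ringChar_ne_zero_of_finite _).symm) (cmC_ne_one hχ p) (cmC_ne_one hχ p) (cmC_sq hχ p)
  have h2 : jacobiSum (cmC hχ p)⁻¹ (cmC hχ p)⁻¹ = (starRingEnd ℂ) (jacobiSum (cmC hχ p) (cmC hχ p)) := by
    simp only [jacobiSum, map_sum, _root_.map_mul]
    refine Finset.sum_congr rfl fun x _ => ?_
    rw [starRingEnd_apply, starRingEnd_apply, MulChar.star_apply', MulChar.star_apply']
  rw [h2, Complex.mul_conj, KK_card] at h
  have h3 : jacobiSum (cmC hχ p) (cmC hχ p) = (Jc hχ p : ℂ) := jacobiSum_ringHomComp _ _ _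
  rw [h3] at h
  rw [← NmN_cast p.1]
  unfold Nm
  exact_mod_cast h

lemma Jc_eq (hχ : IsCubicSymbol χ) (p : PP) : Jc hχ p = - p.1 := by
  obtain ⟨u, hu⟩ := dvd_Jc hχ p
  have h1 := Nm_Jc hχ p
  rw [hu, Nm_mul] at h1
  have h2 : Nm u = 1 := by
    have := Nm_pos p.2.1.ne_zero
    field_simp at h1; exact h1
  have h3 := Jc_mod_three hχ p
  have hassoc : (3 : Eis) ∣ (-u) - 1 := by
    have h4 := (h3.add (p.2.2.mul_right u))
    have : -Jc hχ p - 1 + (p.1 - 1) * u = - u - 1 := by rw [hu]; ring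
    rwa [this] at h4
  obtain ⟨a, b, rfl⟩ := mkE_surj u
  have hU : IsUnit (mkE a b) := by
    refine IsUnit.of_mul_eq_one (mkE (a - b) (-b)) ?_
    rw [mkE_mul]
    rw [Nm_mkE] at h2
    have h2' : a^2 - a*b+b^2 = 1 := by exact_mod_cast h2
    have e1 : a * (a - b) - b * -b = 1 := by linarith
    have e2 : a * -b + b * (a - b) - b * -b = 0 := by ring
    rw [e1, e2]; simp [mkE]
  have h5 := unit_primary hU.neg hassoc
  rw [hu]
  linear_combination -p.1 * h5

lemma recip_rel (hχ : IsCubicSymbol χ) (p q : PP) (h : ringChar (KK q) ≠ ringChar (KK p)) :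
    χ q.1 (NmN p.1 * (- p.1)) * χ p.1 (NmN q.1) = 1 := by
  let ψ := AddChar.FiniteField.primitiveChar (KK p) (KK q) h
  let L := CyclotomicField ψ.n (KK q)
  let f : Eis →+* L := (algebraMap (KK q) L).comp (toK q)
  have finj : ∀ {v w : Eis}, v ∈ V3 → w ∈ V3 → f v = f w → v = w := by
    intro v w hv hw h
    exact toK_V3 hv hw ((algebraMap (KK q) L).injective h)
  have h1V : (1 : Eis) ∈ V3 := by simp [V3]
  let c : MulChar (KK p) L := (cm hχ p).ringHomComp f
  have c3 : c ^ 3 = 1 := by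
    simp only [c]
    rw [MulChar.ringHomComp_pow, cm_cube, MulChar.ringHomComp_one]
  have c1 : c ≠ 1 := by
    intro hc
    apply cm_ne_one hχ p
    refine MulChar.ext fun r => ?_
    have := DFunLike.congr_fun hc (r : KK p)
    rw [MulChar.one_apply_coe] at this ⊢
    refine finj (cm_mem hχ p _) h1V ?_
    rw [_root_.map_one]; exact this
  have hord : orderOf c = 3 := orderOf_eq_prime c3 c1
  set g := gaussSum c ψ.char with hg
  have hcard : (Fintype.card (KK p) : KK q) ≠ 0 := by
    obtain ⟨n, hn, hc⟩ := FiniteField.card (KK p) (ringChar (KK p))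
    have hq := CharP.char_is_prime (KK q) (ringChar (KK q))
    rw [hc, Ne, CharP.cast_eq_zero_iff (KK q) (ringChar (KK q))]
    intro hd
    exact h ((Nat.prime_dvd_prime_iff_eq hq hn).1 (hq.dvd_of_dvd_pow hd))
  have hcardq : (NmN q.1 : KK p) ≠ 0 := by
    rw [← KK_card]
    obtain ⟨n, hn, hc⟩ := FiniteField.card (KK q) (ringChar (KK q))
    have hq := CharP.char_is_prime (KK p) (ringChar (KK p))
    rw [hc, Ne, CharP.cast_eq_zero_iff (KK p) (ringChar (KK p))]
    intro hd
    exact h ((Nat.prime_dvd_prime_iff_eq hq hn).1 (hq.dvd_of_dvd_pow hd)).symm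
  have g0 : g ≠ 0 := gaussSum_ne_zero_of_nontrivial (by
    have := (algebraMap (KK q) L).injective.ne hcard
    simpa using this) c1 ψ.prim
  have g3 : g ^ 3 = f (NmN p.1 * (- p.1)) := by
    have := gaussSum_pow_eq_prod_jacobiSum (χ := c) (ψ := ψ.char) (by omega) ψ.prim
    rw [hord] at this
    rw [this]
    have e1 : c (-1) = 1 := by
      change f (cm hχ p (-1)) = 1
      rw [cm_neg_one, _root_.map_one]
    have e2 : jacobiSum c c = f (Jc hχ p) := jacobiSum_ringHomComp _ _ _
    have e3 : Finset.Ico 1 (3 - 1) = {1} := rfl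
    rw [e1, e3, Finset.prod_singleton, pow_one, e2, Jc_eq, KK_card, _root_.map_mul, map_natCast, one_mul]
  have hfrob : ∀ n : ℕ, g ^ (ringChar (KK q)) ^ n = gaussSum (c ^ (ringChar (KK q)) ^ n) (ψ.char ^ (ringChar (KK q)) ^ n) := by
    haveI : Fact (ringChar (KK q)).Prime := ⟨CharP.char_is_prime (KK q) (ringChar (KK q))⟩
    haveI : CharP L (ringChar (KK q)) := charP_of_injective_algebraMap (algebraMap (KK q) L).injective _
    intro n
    induction n with
    | zero => simp [hg]
    | succ n ih =>
      rw [pow_succ, pow_mul, ih, gaussSum_frob (ringChar (KK q)), ← pow_mul, ← pow_mul]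
  obtain ⟨n, hn, hc⟩ := FiniteField.card (KK q) (ringChar (KK q))
  rw [KK_card] at hc
  have key := hfrob n
  rw [← hc] at key
  obtain ⟨m, hm⟩ := three_dvd_card q
  have hq4 := NmN_PP_gt q
  have hm' : NmN q.1 = 3 * m + 1 := by omega
  have hcq : c ^ NmN q.1 = c := by rw [hm', pow_succ, pow_mul, c3, one_pow, one_mul]
  have hsh := gaussSum_mulShift c ψ.char (Units.mk0 _ hcardq)
  rw [Units.val_mk0, ← AddChar.pow_mulShift, ← hcq, ← key, hcq, ← hg, hm', pow_succ, ← mul_assoc, pow_mul, g3] at hsh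
  have hfin := mul_right_cancel₀ g0 (hsh.trans (one_mul g).symm)
  rw [← hm'] at hfin
  refine finj (V3_mul (hχ.mem q _) (hχ.mem p _)) h1V ?_
  rw [_root_.map_one, ← hfin, _root_.map_mul, mul_comm]
  congr 1
  · rw [← cm_toK hχ p, map_natCast]; rfl
  · change algebraMap (KK q) L (toK q _) = (algebraMap (KK q) L (toK q _)) ^ m
    rw [hχ.congr', hm, Nat.mul_div_cancel_left _ (by norm_num), map_pow]

end

section
variable {χ : Eis → Eis → Eis} 

lemma IsCubicSymbol.map_neg (hχ : IsCubicSymbol χ) (p : PP) (a : Eis) : χ p.1 (-a) = χ p.1 a := by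
  have h : χ p.1 (-1) = 1 := by rw [← cm_toK hχ, _root_.map_neg, _root_.map_one, cm_neg_one]
  have e : -a = (-1) * a := by ring
  rw [e, hχ.map_mul, h, one_mul]

lemma recip_aux (hχ : IsCubicSymbol χ) (p q : PP) (h : ringChar (KK q) ≠ ringChar (KK p)) :
    χ p.1 q.1 = χ q.1 p.1 := by
  have h1 := recip_rel hχ p q h
  have h2 := recip_rel hχ q p h.symm
  obtain ⟨z, hz⟩ := PP_dvd_card p
  obtain ⟨w, hw⟩ := PP_dvd_card q
  rw [hz, hw, hχ.map_mul, hχ.map_mul, hχ.map_mul, hχ.map_neg] at h1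
  rw [hz, hw, hχ.map_mul, hχ.map_mul, hχ.map_mul, hχ.map_neg] at h2
  linear_combination χ q.1 p.1 * h2 - χ p.1 q.1 * h1

lemma ringChar_dvd (p : PP) : p.1 ∣ (ringChar (KK p) : Eis) := by
  rw [← toK_eq_zero, map_natCast]; exact CharP.cast_eq_zero _ _

lemma Nm_natCast (n : ℕ) : Nm (n : Eis) = (n : ℝ) ^ 2 := by
  simp [Nm, Complex.normSq_natCast, sq]

lemma ringChar_le (p : PP) : (ringChar (KK p) : ℝ) ≤ Nm p.1 := by
  obtain ⟨n, hn, hc⟩ := FiniteField.card (KK p) (ringChar (KK p))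
  rw [KK_card] at hc
  rw [← NmN_cast, hc]
  exact_mod_cast Nat.le_self_pow n.ne_zero _

lemma ringChar_three (p q r : PP) (hpq : p ≠ q) (hpr : p ≠ r) (hqr : q ≠ r)
    (h1 : ringChar (KK p) = ringChar (KK q)) (h2 : ringChar (KK p) = ringChar (KK r)) : False := by
  have hp := CharP.char_is_prime (KK p) (ringChar (KK p))
  have d1 := ringChar_dvd p
  have d2 := ringChar_dvd q
  have d3 := ringChar_dvd r
  have l1 := ringChar_le p
  have l2 := ringChar_le q
  have l3 := ringChar_le r
  rw [← h1] at d2 l2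
  rw [← h2] at d3 l3
  have := ((PP.isCoprime hpr).mul_left (PP.isCoprime hqr)).mul_dvd ((PP.isCoprime hpq).mul_dvd d1 d2) d3
  obtain ⟨z, hz⟩ := this
  have hz0 : z ≠ 0 := by
    rintro rfl
    rw [mul_zero] at hz
    exact hp.ne_zero (by exact_mod_cast hz)
  have e := congrArg Nm hz
  rw [Nm_mul, Nm_mul, Nm_mul, Nm_natCast] at e
  have hz1 := one_le_Nm hz0
  have hp2 : (2 : ℝ) ≤ ringChar (KK p) := by exact_mod_cast hp.two_le
  set l : ℝ := (ringChar (KK p) : ℝ)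
  have h3 : l * l * l * 1 ≤ l ^ 2 := by rw [e]; have := Nm_nonneg p.1; have := Nm_nonneg q.1; have := Nm_nonneg r.1; gcongr <;> first | assumption | positivity
  nlinarith

/-- primary elements are products of primary primes -/
lemma exists_multiset {a : Eis} (h0 : a ≠ 0) (h3 : (3 : Eis) ∣ a - 1) :
    ∃ s : Multiset PP, a = (s.map Subtype.val).prod := by
  suffices H : ∀ a : Eis, a ≠ 0 → ¬ lam ∣ a → ∃ s : Multiset PP, ∃ u : Eisˣ, a = u * (s.map Subtype.val).prod by
    obtain ⟨s, u, hu⟩ := H a h0 (primary_not_lam h3)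
    have hs : (3 : Eis) ∣ (s.map Subtype.val).prod - 1 := by
      clear hu
      induction s using Multiset.induction_on with
      | empty => simp
      | cons p s ih => rw [Multiset.map_cons, Multiset.prod_cons]; exact primary_mul p.2.2 ih
    have : (3 : Eis) ∣ u - 1 := by
      have h := h3.sub (hs.mul_left (u : Eis))
      have e : a - 1 - u * ((s.map Subtype.val).prod - 1) = u - 1 := by rw [hu]; ring
      rwa [e] at h
    have hu1 := unit_primary u.isUnit this
    exact ⟨s, by rw [hu, hu1, one_mul]⟩
  intro a
  refine UniqueFactorizationMonoid.induction_on_prime a (fun h => absurd rfl h) ?_ ?_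
  · intro x hx _ _
    exact ⟨0, hx.unit, by simp⟩
  · intro a p ha hp ih hne hl
    obtain ⟨s, u, hs⟩ := ih ha (fun h => hl (h.mul_left p))
    obtain ⟨v, hv⟩ := exists_primary (x := p) (fun h => hl (h.mul_right a))
    have hvp : Prime ((v : Eis) * p) := (Associated.prime ⟨v, mul_comm _ _⟩ hp)
    refine ⟨⟨v * p, hvp, hv⟩ ::ₘ s, v⁻¹ * u, ?_⟩
    rw [Multiset.map_cons, Multiset.prod_cons, Units.val_mul]
    have : (v⁻¹ : Eisˣ) * (v : Eis) = 1 := by simp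
    nth_rewrite 1 [hs]
    linear_combination (-(u:Eis) * p * (s.map Subtype.val).prod) * this

lemma multiset_primary (s : Multiset PP) : (3 : Eis) ∣ (s.map Subtype.val).prod - 1 := by
  induction s using Multiset.induction_on with
  | empty => simp
  | cons p s ih => rw [Multiset.map_cons, Multiset.prod_cons]; exact primary_mul p.2.2 ih

lemma chi_multiset (hχ : IsCubicSymbol χ) (s : Multiset PP) (b : Eis) :
    χ (s.map Subtype.val).prod b = (s.map fun p => χ p.1 b).prod := by
  induction s using Multiset.induction_on with
  | empty => simpa using hχ.one_bot b
  | cons p s ih =>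
    rw [Multiset.map_cons, Multiset.prod_cons, hχ.mul_bot _ _ _ p.2.2 (multiset_primary s), ih, Multiset.map_cons, Multiset.prod_cons]

lemma chi_top_multiset (hχ : IsCubicSymbol χ) (s : Multiset PP) (q : PP) :
    χ q.1 (s.map Subtype.val).prod = (s.map fun p => χ q.1 p.1).prod := by
  induction s using Multiset.induction_on with
  | empty => simpa using hχ.map_one q
  | cons p s ih =>
    rw [Multiset.map_cons, Multiset.prod_cons, hχ.map_mul, ih, Multiset.map_cons, Multiset.prod_cons]

theorem recip (hχ : IsCubicSymbol χ) (p q : PP) : χ p.1 q.1 = χ q.1 p.1 := by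
  rcases eq_or_ne p q with rfl | hpq
  · rfl
  by_cases h : ringChar (KK q) = ringChar (KK p)
  swap
  · exact recip_aux hχ p q h
  -- same residue characteristic
  have hs0 : -(p.1 + q.1) ≠ 0 := by
    intro h
    have : p.1 ∣ q.1 := ⟨-1, by linear_combination -h⟩
    exact hpq (PP.eq_of_dvd this)
  have hs3 : (3 : Eis) ∣ -(p.1 + q.1) - 1 := by
    have := (p.2.2.add q.2.2).neg_right.sub (dvd_refl (3 : Eis))
    have e : -(p.1 - 1 + (q.1 - 1)) - 3 = -(p.1 + q.1) - 1 := by ring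
    rwa [e] at this
  obtain ⟨s, hs⟩ := exists_multiset hs0 hs3
  have e1 : χ p.1 q.1 = χ p.1 (s.map Subtype.val).prod := by
    rw [← hs, hχ.map_neg]
    exact hχ.periodic p (by rw [toK_eq_iff]; exact ⟨-1, by ring⟩)
  have e2 : χ q.1 p.1 = χ q.1 (s.map Subtype.val).prod := by
    rw [← hs, hχ.map_neg]
    exact hχ.periodic q (by rw [toK_eq_iff]; exact ⟨-1, by ring⟩)
  rw [e1, e2, chi_top_multiset hχ, chi_top_multiset hχ]
  congr 1
  refine Multiset.map_congr rfl fun r hr => ?_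
  have hdvd : r.1 ∣ p.1 + q.1 := by
    rw [← dvd_neg, hs]
    exact Multiset.dvd_prod (Multiset.mem_map_of_mem _ hr)
  have hrp : p ≠ r := by
    rintro rfl
    exact hpq (PP.eq_of_dvd ((dvd_add_right (dvd_refl _)).1 hdvd))
  have hrq : q ≠ r := by
    rintro rfl
    exact hpq (PP.eq_of_dvd ((dvd_add_left (dvd_refl _)).1 hdvd)).symm
  have hc1 : ringChar (KK r) ≠ ringChar (KK p) := fun hc => ringChar_three p q r hpq hrp hrq h.symm hc.symm
  rw [recip_aux hχ p r hc1, recip_aux hχ q r (by rw [h]; exact hc1)]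
  rw [← hχ.map_neg r q.1]
  exact hχ.periodic r (by rw [toK_eq_iff]; simpa using hdvd)

/-- uniqueness of the symbol -/
lemma chi_unique {χ' : Eis → Eis → Eis} (hχ : IsCubicSymbol χ) (hχ' : IsCubicSymbol χ') {a : Eis}
    (h0 : a ≠ 0) (h3 : (3 : Eis) ∣ a - 1) (b : Eis) : χ a b = χ' a b := by
  obtain ⟨s, rfl⟩ := exists_multiset h0 h3
  rw [chi_multiset hχ, chi_multiset hχ']
  congr 1
  refine Multiset.map_congr rfl fun p _ => ?_
  apply toK_V3 (hχ.mem p b) (hχ'.mem p b)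
  rw [hχ.congr', hχ'.congr']

end

section
variable {χ : Eis → Eis → Eis} 

/-- additive character on `ℂ`, trivial on `Eis`. -/
def ee (z : ℂ) : ℂ := Complex.exp (2 * Real.pi * Complex.I * ((2 / Real.sqrt 3 * z.im : ℝ) : ℂ))

lemma ee_add (z w : ℂ) : ee (z + w) = ee z * ee w := by
  simp only [ee]; rw [← Complex.exp_add]; congr 1; simp; ring

lemma ee_zero : ee 0 = 1 := by simp [ee]

lemma ee_lin (u v : ℝ) : ee (u + v * ωc) = Complex.exp (2 * Real.pi * Complex.I * v) := by
  unfold ee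
  rw [im_lin]
  congr 3
  have : Real.sqrt 3 ≠ 0 := by positivity
  field_simp

lemma ee_int (x : Eis) : ee x = 1 := by
  obtain ⟨a, b, rfl⟩ := mkE_surj x
  rw [mkE_coe]
  have := ee_lin a b
  push_cast at this
  rw [this, Complex.exp_eq_one_iff]
  exact ⟨b, by ring⟩

lemma ee_conj (z : ℂ) : (starRingEnd ℂ) (ee z) = ee (-z) := by
  simp only [ee]; rw [← Complex.exp_conj]; congr 1; simp [Complex.conj_ofReal, map_ofNat]

lemma norm_ee (z : ℂ) : ‖ee z‖ = 1 := by
  simp only [ee]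
  rw [show (2 * Real.pi * Complex.I * ((2 / Real.sqrt 3 * z.im : ℝ) : ℂ)) = ((2 * Real.pi * (2 / Real.sqrt 3 * z.im) : ℝ) : ℂ) * Complex.I by push_cast; ring]
  exact Complex.norm_exp_ofReal_mul_I _

lemma ee_congr {c x y : Eis} (hc : c ≠ 0) (h : c ∣ x - y) : ee ((x : ℂ) / c) = ee ((y : ℂ) / c) := by
  obtain ⟨z, hz⟩ := h
  have hc' : (c : ℂ) ≠ 0 := by simpa using hc
  have : (x : ℂ) / c = (y : ℂ) / c + z := by
    have e : (x : ℂ) = y + c * z := by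
      have : x = y + c * z := by rw [← hz]; ring
      rw [this]; push_cast; rfl
    rw [e]; field_simp
  rw [this, ee_add, ee_int, mul_one]

lemma exists_lin (z : ℂ) : ∃ u v : ℝ, z = u + v * ωc := by
  have h3 : Real.sqrt 3 ≠ 0 := by positivity
  refine ⟨z.re + z.im / Real.sqrt 3, 2 * z.im / Real.sqrt 3, ?_⟩
  rw [ωc_eq]
  apply Complex.ext <;> simp <;> field_simp <;> ring

lemma ee_eq_one_iff_lin (u v : ℝ) : ee (u + v * ωc) = 1 ↔ ∃ n : ℤ, v = n := by
  rw [ee_lin, Complex.exp_eq_one_iff]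
  constructor
  · rintro ⟨n, hn⟩
    refine ⟨n, ?_⟩
    have h2 : (2 * Real.pi * Complex.I : ℂ) ≠ 0 := Complex.two_pi_I_ne_zero
    have : (v : ℂ) = n := by
      apply mul_left_cancel₀ h2; rw [hn]; ring
    exact_mod_cast this
  · rintro ⟨n, rfl⟩; exact ⟨n, by push_cast; ring⟩

lemma mem_of_ee (z : ℂ) (h1 : ee z = 1) (h2 : ee (ωc * z) = 1) : ∃ x : Eis, z = x := by
  obtain ⟨u, v, rfl⟩ := exists_lin z
  have e : ωc * (u + v * ωc) = ((-v : ℝ) : ℂ) + ((u - v : ℝ) : ℂ) * ωc := by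
    push_cast; linear_combination v * ωc_sq
  rw [e, ee_eq_one_iff_lin] at h2
  rw [ee_eq_one_iff_lin] at h1
  obtain ⟨n, rfl⟩ := h1
  obtain ⟨m, hm⟩ := h2
  refine ⟨mkE (m + n) n, ?_⟩
  rw [mkE_coe]
  have : u = m + n := by linarith
  rw [this]; push_cast; ring

/-- sum over residues of a periodic function -/
def Sm (c : Eis) [NeZero c] (g : Eis → ℂ) : ℂ := ∑ r : Eis ⧸ Ideal.span {c}, g r.out

def Per (c : Eis) (g : Eis → ℂ) : Prop := ∀ x y, c ∣ x - y → g x = g y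

lemma out_dvd (c : Eis) (x : Eis) : c ∣ (Ideal.Quotient.mk (Ideal.span {c}) x).out - x := by
  rw [← Ideal.mem_span_singleton, ← Ideal.Quotient.eq]
  exact Quotient.out_eq' _

lemma Sm_eq {c : Eis} [NeZero c] {g : Eis → ℂ} (hg : Per c g) {ι : Type*} [Fintype ι] (φ : ι → Eis)
    (hφ : Function.Bijective fun i => Ideal.Quotient.mk (Ideal.span {c}) (φ i)) :
    Sm c g = ∑ i, g (φ i) := by
  rw [Sm, ← Function.Bijective.sum_comp hφ]
  exact Finset.sum_congr rfl fun i _ => hg _ _ (out_dvd c _)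

lemma mk_eq_iff {c x y : Eis} : Ideal.Quotient.mk (Ideal.span {c}) x = Ideal.Quotient.mk (Ideal.span {c}) y ↔ c ∣ x - y := by
  rw [Ideal.Quotient.eq, Ideal.mem_span_singleton]

lemma Sm_mul {c d : Eis} [NeZero c] [NeZero d] [NeZero (c * d)] (h : IsCoprime c d) {g : Eis → ℂ} (hg : Per (c * d) g) :
    Sm (c * d) g = Sm c fun x => Sm d fun y => g (d * x + c * y) := by
  rw [Sm_eq hg (ι := (Eis ⧸ Ideal.span {c}) × (Eis ⧸ Ideal.span {d})) (fun r => d * r.1.out + c * r.2.out)]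
  · rw [Fintype.sum_prod_type]; rfl
  · rw [Fintype.bijective_iff_injective_and_card]
    constructor
    · rintro ⟨r, s⟩ ⟨r', s'⟩ h'
      simp only at h'
      rw [mk_eq_iff] at h'
      have e1 : c ∣ d * (r.out - r'.out) := by
        have h1 : c ∣ _ := (dvd_mul_right c d).trans h'
        have := h1.sub (dvd_mul_right c (s.out - s'.out))
        convert this using 1; ring
      have e2 : d ∣ c * (s.out - s'.out) := by
        have h1 : d ∣ _ := (dvd_mul_left d c).trans h'
        have := h1.sub (dvd_mul_right d (r.out - r'.out))
        convert this using 1; ring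
      have e1' := h.dvd_of_dvd_mul_left e1
      have e2' := h.symm.dvd_of_dvd_mul_left e2
      rw [← mk_eq_iff] at e1' e2'
      have o1 : ∀ r : Eis ⧸ Ideal.span {c}, Ideal.Quotient.mk (Ideal.span {c}) r.out = r := fun r => Quotient.out_eq' r
      have o2 : ∀ r : Eis ⧸ Ideal.span {d}, Ideal.Quotient.mk (Ideal.span {d}) r.out = r := fun r => Quotient.out_eq' r
      rw [o1, o1] at e1'
      rw [o2, o2] at e2'
      rw [e1', e2']
    · rw [Fintype.card_prod, ← Nat.card_eq_fintype_card, ← Nat.card_eq_fintype_card, ← Nat.card_eq_fintype_card, card_quot, card_quot, card_quot, NmN_mul]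

/-- finite Fourier transform -/
def hat (c : Eis) [NeZero c] (f : Eis → ℂ) (k : Eis) : ℂ := Sm c fun r => f r * ee (((k * r : Eis) : ℂ) / c)

lemma per_ee {c : Eis} (hc : c ≠ 0) (k : Eis) : Per c fun r => ee (((k * r : Eis) : ℂ) / c) := by
  intro x y h
  exact ee_congr hc (by rw [← mul_sub]; exact h.mul_left k)

lemma hat_mul {c d : Eis} [NeZero c] [NeZero d] [NeZero (c * d)] (h : IsCoprime c d) {f g : Eis → ℂ}
    (hf : Per c f) (hg : Per d g) (k : Eis) :
    hat (c * d) (fun r => f r * g r) k = hat c (fun r => f (d * r)) k * hat d (fun r => g (c * r)) k := by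
  unfold hat
  rw [Sm_mul h]
  · simp only [Sm, Finset.sum_mul_sum]
    refine Finset.sum_congr rfl fun x _ => Finset.sum_congr rfl fun y _ => ?_
    rw [hf (d * x.out + c * y.out) (d * x.out) (by simp), hg (d * x.out + c * y.out) (c * y.out) (by simp)]
    have e : (((k * (d * x.out + c * y.out) : Eis) : ℂ) / ((c * d : Eis) : ℂ)) = ((k * x.out : Eis) : ℂ) / c + ((k * y.out : Eis) : ℂ) / d := by
      have hc : (c : ℂ) ≠ 0 := by simpa using NeZero.ne c
      have hd : (d : ℂ) ≠ 0 := by simpa using NeZero.ne d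
      push_cast; field_simp
    rw [e, ee_add]; ring
  · intro x y hxy
    simp only
    rw [hf x y ((dvd_mul_right c d).trans hxy), hg x y ((dvd_mul_left d c).trans hxy)]
    congr 1
    exact per_ee (NeZero.ne _) k x y hxy

end

section
variable {χ : Eis → Eis → Eis} 

/-- the character attached to a finite set of primes -/
def X (χ : Eis → Eis → Eis) (S : Finset PP) (b : Eis) : ℂ := ∏ p ∈ S, ((χ p.1 b : Eis) : ℂ)

lemma X_empty (b : Eis) : X χ ∅ b = 1 := by simp [X]

lemma X_insert [DecidableEq PP] {p : PP} {S : Finset PP} (h : p ∉ S) (b : Eis) :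
    X χ (insert p S) b = ((χ p.1 b : Eis) : ℂ) * X χ S b := by simp [X, Finset.prod_insert h]

lemma X_mul (hχ : IsCubicSymbol χ) (S : Finset PP) (a b : Eis) : X χ S (a * b) = X χ S a * X χ S b := by
  simp only [X, hχ.map_mul, Subring.coe_mul, Finset.prod_mul_distrib]

lemma X_neg (hχ : IsCubicSymbol χ) (S : Finset PP) (a : Eis) : X χ S (-a) = X χ S a := by
  simp only [X, hχ.map_neg]

lemma X_one (hχ : IsCubicSymbol χ) (S : Finset PP) : X χ S 1 = 1 := by
  simp only [X, hχ.map_one]; simp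

lemma X_per (hχ : IsCubicSymbol χ) (S : Finset PP) : Per (PS S) (X χ S) := by
  intro x y h
  unfold X
  refine Finset.prod_congr rfl fun p hp => ?_
  rw [hχ.periodic p (toK_eq_iff.2 ((dvd_PS_iff.2 hp).trans h))]

lemma norm_V3 {v : Eis} (hv : v ∈ V3) (h0 : v ≠ 0) : ‖(v : ℂ)‖ = 1 := by
  have h := V3_cube hv h0
  have h2 : ‖(v : ℂ)‖ ^ 3 = 1 := by
    rw [← norm_pow]
    have := congrArg (fun x : Eis => ‖(x : ℂ)‖) h
    simpa using this
  exact (pow_eq_one_iff_of_nonneg (norm_nonneg _) (by norm_num)).1 h2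

lemma X_norm_le (hχ : IsCubicSymbol χ) (S : Finset PP) (b : Eis) : ‖X χ S b‖ ≤ 1 := by
  unfold X
  rw [norm_prod]
  refine Finset.prod_le_one (fun _ _ => norm_nonneg _) fun p _ => ?_
  by_cases h : χ p.1 b = 0
  · simp [h]
  · rw [norm_V3 (hχ.mem p b) h]

lemma X_norm_eq (hχ : IsCubicSymbol χ) (S : Finset PP) (b : Eis) (h : ∀ p ∈ S, ¬ p.1 ∣ b) : ‖X χ S b‖ = 1 := by
  unfold X
  rw [norm_prod]
  refine Finset.prod_eq_one fun p hp => ?_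
  exact norm_V3 (hχ.mem p b) (by rw [Ne, hχ.zero_iff]; exact h p hp)

lemma X_PS (hχ : IsCubicSymbol χ) (S T : Finset PP) : X χ S (PS T) = X χ T (PS S) := by
  have h1 : ∀ (p : PP) (T : Finset PP), χ p.1 (PS T) = ∏ q ∈ T, χ p.1 q.1 := by
    intro p T
    classical
    induction T using Finset.induction_on with
    | empty => simpa [PS] using hχ.map_one p
    | insert q T hq ih =>
      rw [Finset.prod_insert hq, ← ih, ← hχ.map_mul]; simp [PS, Finset.prod_insert hq]
  unfold X
  simp only [h1]
  have hc : ∀ (T : Finset PP) (f : PP → Eis), ((∏ q ∈ T, f q : Eis) : ℂ) = ∏ q ∈ T, (f q : ℂ) := fun T f => map_prod Eis.subtype f T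
  simp only [hc]
  rw [Finset.prod_comm]
  refine Finset.prod_congr rfl fun p _ => Finset.prod_congr rfl fun q _ => ?_
  rw [recip hχ]

lemma X_PS_norm (hχ : IsCubicSymbol χ) {S T : Finset PP} (h : Disjoint S T) : ‖X χ S (PS T)‖ = 1 := by
  refine X_norm_eq hχ S _ fun p hp hd => ?_
  exact Finset.disjoint_left.1 h hp (dvd_PS_iff.1 hd)

/-- additive character mod p -/
def psi (p : PP) : AddChar (KK p) ℂ where
  toFun r := ee ((r.out : ℂ) / p.1)
  map_zero_eq_one' := by
    have h : p.1 ∣ (0 : KK p).out - 0 := by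
      have := out_dvd p.1 0
      rwa [map_zero] at this
    rw [ee_congr p.2.1.ne_zero h]; simp [ee_zero]
  map_add_eq_mul' a b := by
    have h : p.1 ∣ (a + b).out - (a.out + b.out) := by
      have := out_dvd p.1 (a.out + b.out)
      rw [map_add] at this
      have o : ∀ r : KK p, Ideal.Quotient.mk (Ideal.span {p.1}) r.out = r := fun r => Quotient.out_eq' r
      rwa [o, o] at this
    rw [ee_congr p.2.1.ne_zero h, ← ee_add]
    push_cast; rw [add_div]

lemma psi_toK (p : PP) (x : Eis) : psi p (toK p x) = ee ((x : ℂ) / p.1) :=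
  ee_congr p.2.1.ne_zero (out_dvd p.1 x)

lemma psi_prim (p : PP) : (psi p).IsPrimitive := by
  apply AddChar.IsPrimitive.of_ne_one
  intro h
  have h1 := DFunLike.congr_fun h (toK p 1)
  have h2 := DFunLike.congr_fun h (toK p ωE)
  rw [psi_toK, AddChar.one_apply] at h1 h2
  have hp : (p.1 : ℂ) ≠ 0 := by simpa using p.2.1.ne_zero
  obtain ⟨x, hx⟩ := mem_of_ee (1 / (p.1 : ℂ)) (by simpa using h1) (by rw [mul_one_div]; simpa [ωE] using h2)
  apply p.2.1.not_unit
  refine IsUnit.of_mul_eq_one x ?_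
  apply Subtype.val_injective
  rw [Subring.coe_mul, ← hx]; field_simp; rfl

lemma hat_prime (hχ : IsCubicSymbol χ) (p : PP) :
    ∃ γ : ℂ, ‖γ‖ ^ 2 = Nm p.1 ∧ ∀ k, hat p.1 (fun r => ((χ p.1 r : Eis) : ℂ)) k = (starRingEnd ℂ) ((χ p.1 k : Eis) : ℂ) * γ := by
  refine ⟨gaussSum (cmC hχ p) (psi p), ?_, ?_⟩
  · have h := gaussSum_mul_gaussSum_eq_card (cmC_ne_one hχ p) (psi_prim p)
    rw [← star_gaussSum_eq, ← starRingEnd_apply, Complex.mul_conj, KK_card] at h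
    rw [← Complex.normSq_eq_norm_sq, ← NmN_cast]
    exact_mod_cast h
  · intro k
    have e : hat p.1 (fun r => ((χ p.1 r : Eis) : ℂ)) k = ∑ r : KK p, cmC hχ p r * psi p (toK p k * r) := by
      unfold hat Sm
      refine Finset.sum_congr rfl fun r _ => ?_
      change ((χ p.1 r.out : Eis) : ℂ) * ee (((k * r.out : Eis) : ℂ) / p.1) = _
      rw [← psi_toK, _root_.map_mul, toK_out]
      rfl
    rw [e]
    by_cases hk : toK p k = 0
    · rw [(hχ.zero_iff p k).2 (toK_eq_zero.1 hk), hk]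
      simp [MulChar.sum_eq_zero_of_ne_one (cmC_ne_one hχ p)]
    · have := gaussSum_mulShift_eq (cmC hχ p) (psi p) (Units.mk0 _ hk)
      rw [Units.val_mk0, ← MulChar.star_apply', ← starRingEnd_apply, cmC_apply, cm_toK] at this
      rw [← this]; rfl

lemma hat_smul (c : Eis) [NeZero c] (a : ℂ) (f : Eis → ℂ) (k : Eis) : hat c (fun r => a * f r) k = a * hat c f k := by
  simp only [hat, Sm, Finset.mul_sum, mul_assoc]

lemma hat_congr {c d : Eis} [NeZero c] [NeZero d] (h : c = d) (f : Eis → ℂ) (k : Eis) : hat c f k = hat d f k := by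
  subst h; rfl

lemma Sm_one {g : Eis → ℂ} (hg : Per 1 g) : Sm 1 g = g 0 := by
  rw [Sm_eq hg (ι := Unit) (fun _ => 0)]
  · simp
  · constructor
    · intro a b _; rfl
    · intro r
      obtain ⟨x, rfl⟩ := Ideal.Quotient.mk_surjective r
      exact ⟨(), mk_eq_iff.2 (one_dvd _)⟩

lemma hat_X (hχ : IsCubicSymbol χ) (S : Finset PP) :
    ∃ γ : ℂ, ‖γ‖ ^ 2 = Nm (PS S) ∧ ∀ k, hat (PS S) (X χ S) k = (starRingEnd ℂ) (X χ S k) * γ := by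
  classical
  induction S using Finset.induction_on with
  | empty =>
    refine ⟨1, by simp [PS, Nm], fun k => ?_⟩
    haveI : NeZero (1 : Eis) := ⟨one_ne_zero⟩
    rw [hat_congr (PS_empty)]
    unfold hat
    rw [Sm_one]
    · simp [X, ee_zero]
    · intro x y _
      simp only [X_empty, Subring.coe_one, div_one, ee_int]
  | insert p S hp ih =>
    obtain ⟨γ, hγ, hk⟩ := ih
    obtain ⟨δ, hδ, hd⟩ := hat_prime hχ p
    have hPS : PS (insert p S) = p.1 * PS S := by simp [PS, Finset.prod_insert hp]
    haveI : NeZero (p.1 * PS S) := ⟨mul_ne_zero p.2.1.ne_zero (PS_ne_zero S)⟩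
    have hc : IsCoprime p.1 (PS S) := by
      have := PS_coprime (S := {p}) (T := S) (by simpa using hp)
      simpa [PS] using this
    refine ⟨((χ p.1 (PS S) : Eis) : ℂ) * X χ S p.1 * (δ * γ), ?_, fun k => ?_⟩
    · have n1 : ‖((χ p.1 (PS S) : Eis) : ℂ)‖ = 1 := norm_V3 (hχ.mem p _) (by
        rw [Ne, hχ.zero_iff, dvd_PS_iff]; exact hp)
      have n2 : ‖X χ S p.1‖ = 1 := by
        have := X_PS_norm hχ (S := S) (T := {p}) (by simpa using hp)
        simpa [PS] using this
      rw [norm_mul, norm_mul, n1, n2, norm_mul, hPS, Nm_mul, ← hγ, ← hδ]; ring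
    · rw [hat_congr hPS]
      have e1 : X χ (insert p S) = fun r => ((χ p.1 r : Eis) : ℂ) * X χ S r := by
        ext r; exact X_insert hp r
      rw [e1, hat_mul hc (f := fun r => ((χ p.1 r : Eis) : ℂ)) (g := X χ S) _ (X_per hχ S)]
      · simp only [hχ.map_mul, X_mul hχ, Subring.coe_mul]
        rw [hat_smul, hat_smul, hk, hd, _root_.map_mul]; ring
      · intro x y hxy
        simp only
        rw [hχ.periodic p (toK_eq_iff.2 hxy)]

/-- the Gauss sum -/
def gam (hχ : IsCubicSymbol χ) (S : Finset PP) : ℂ := (hat_X hχ S).choose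

lemma gam_norm (hχ : IsCubicSymbol χ) (S : Finset PP) : ‖gam hχ S‖ ^ 2 = Nm (PS S) := (hat_X hχ S).choose_spec.1

lemma hat_X_eq (hχ : IsCubicSymbol χ) (S : Finset PP) (k : Eis) :
    hat (PS S) (X χ S) k = (starRingEnd ℂ) (X χ S k) * gam hχ S := (hat_X hχ S).choose_spec.2 k

lemma hat_conj (c : Eis) [NeZero c] (f : Eis → ℂ) (k : Eis) :
    hat c (fun r => (starRingEnd ℂ) (f r)) k = (starRingEnd ℂ) (hat c f (-k)) := by
  unfold hat Sm
  rw [map_sum]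
  refine Finset.sum_congr rfl fun r _ => ?_
  rw [_root_.map_mul, ee_conj]; congr 2; push_cast; ring

theorem hat_XX (hχ : IsCubicSymbol χ) {S T : Finset PP} (h : Disjoint S T) [NeZero (PS S * PS T)] (k : Eis) :
    hat (PS S * PS T) (fun r => X χ S r * (starRingEnd ℂ) (X χ T r)) k =
      ((starRingEnd ℂ) (X χ S k) * gam hχ S) * (starRingEnd ℂ) ((starRingEnd ℂ) (X χ T k) * gam hχ T) := by
  rw [hat_mul (PS_coprime h) (X_per hχ S) (g := fun r => (starRingEnd ℂ) (X χ T r))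
    (fun x y hxy => by simp only; rw [X_per hχ T x y hxy])]
  simp only [X_mul hχ, _root_.map_mul]
  rw [hat_smul, hat_smul, hat_conj, hat_X_eq hχ, hat_X_eq hχ, X_neg hχ, _root_.map_mul]
  have : X χ S (PS T) * (starRingEnd ℂ) (X χ T (PS S)) = 1 := by
    rw [X_PS hχ T S, Complex.mul_conj, Complex.normSq_eq_norm_sq, X_PS_norm hχ h]; simp
  linear_combination (starRingEnd ℂ (X χ S k) * gam hχ S * (starRingEnd ℂ (starRingEnd ℂ (X χ T k)) * starRingEnd ℂ (gam hχ T))) * this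

end

section
lemma sum1 {c : ℝ} (hc : 0 < c) (x : ℝ) : Summable fun n : ℤ => Real.exp (-c * ((n : ℝ) + x) ^ 2) := by
  have h := (summable_jacobiTheta₂_term_iff 0 (Complex.I * (c / 2 / Real.pi : ℝ))).2 (by
    simp; positivity)
  have h2 := h.norm
  refine Summable.of_nonneg_of_le (fun _ => (Real.exp_pos _).le) (fun n => ?_) (h2.mul_left (Real.exp (c * x ^ 2)))
  rw [norm_jacobiTheta₂_term, ← Real.exp_add]
  apply Real.exp_le_exp.2
  simp only [Complex.mul_im, Complex.I_re, Complex.I_im, Complex.ofReal_re, Complex.ofReal_im, Complex.zero_im]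
  have : Real.pi ≠ 0 := Real.pi_ne_zero
  field_simp
  nlinarith [mul_nonneg hc.le (sq_nonneg ((n : ℝ) + 2 * x))]

/-- 1-D Poisson summation for Gaussians -/
lemma poisson1 {s : ℝ} (hs : 0 < s) (x β : ℝ) :
    ∑' n : ℤ, cexp (-Real.pi * s * ((n : ℂ) + x) ^ 2 - 2 * Real.pi * Complex.I * β * (n + x)) =
      ((1 / Real.sqrt s : ℝ) : ℂ) * ∑' l : ℤ, cexp (-Real.pi / s * ((l : ℂ) + β) ^ 2 + 2 * Real.pi * Complex.I * l * x) := by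
  have hs' : (s : ℂ) ≠ 0 := by exact_mod_cast hs.ne'
  have h := Complex.tsum_exp_neg_quadratic (a := ((1 / s : ℝ) : ℂ)) (by simpa using hs) (-β / s + Complex.I * x)
  have e1 : ∑' l : ℤ, cexp (-Real.pi / s * ((l : ℂ) + β) ^ 2 + 2 * Real.pi * Complex.I * l * x) =
      cexp (-Real.pi * β ^ 2 / s) * ∑' n : ℤ, cexp (-Real.pi * ((1 / s : ℝ) : ℂ) * (n : ℂ) ^ 2 + 2 * Real.pi * (-β / s + Complex.I * x) * n) := by
    rw [← tsum_mul_left]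
    congr 1; ext l
    rw [← Complex.exp_add]; congr 1
    push_cast; field_simp; ring
  rw [e1, h]
  have e2 : ∑' n : ℤ, cexp (-Real.pi * s * ((n : ℂ) + x) ^ 2 - 2 * Real.pi * Complex.I * β * (n + x)) =
      cexp (-Real.pi * β ^ 2 / s) * ∑' n : ℤ, cexp (-Real.pi / ((1 / s : ℝ) : ℂ) * ((n : ℂ) + Complex.I * (-β / s + Complex.I * x)) ^ 2) := by
    rw [← tsum_mul_left, ← (Equiv.neg ℤ).tsum_eq]
    congr 1; ext l
    rw [← Complex.exp_add]; congr 1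
    simp only [Equiv.neg_apply]
    push_cast; field_simp
    ring_nf
    simp only [Complex.I_sq]
    have i3 : Complex.I ^ 3 = -Complex.I := by rw [pow_succ, Complex.I_sq]; ring
    have i4 : Complex.I ^ 4 = 1 := Complex.I_pow_four
    simp only [i3, i4]
    ring
  rw [e2]
  have e3 : ((1 / Real.sqrt s : ℝ) : ℂ) * (1 / ((1 / s : ℝ) : ℂ) ^ (1 / 2 : ℂ)) = 1 := by
    have : ((1 / s : ℝ) : ℂ) ^ (1 / 2 : ℂ) = ((1 / Real.sqrt s : ℝ) : ℂ) := by
      rw [show (1 / 2 : ℂ) = ((1 / 2 : ℝ) : ℂ) by push_cast; rfl, ← Complex.ofReal_cpow (by positivity), ← Real.sqrt_eq_rpow,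
        Real.sqrt_div zero_le_one, Real.sqrt_one]
    rw [this]
    have : ((1 / Real.sqrt s : ℝ) : ℂ) ≠ 0 := by
      exact_mod_cast (by positivity : (1 / Real.sqrt s : ℝ) ≠ 0)
    field_simp
  linear_combination (-(cexp (-Real.pi * β ^ 2 / s) * ∑' n : ℤ, cexp (-Real.pi / ((1 / s : ℝ) : ℂ) * ((n : ℂ) + Complex.I * (-β / s + Complex.I * x)) ^ 2))) * e3

end

section
lemma sum2 {c : ℝ} (hc : 0 < c) (u v : ℝ) : Summable fun p : ℤ × ℤ =>
    Real.exp (-c * (((p.1 : ℝ) + u) ^ 2 - (p.1 + u) * (p.2 + v) + (p.2 + v) ^ 2)) := by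
  have h := (sum1 (half_pos hc) u).mul_of_nonneg (sum1 (half_pos hc) v) (fun _ => (Real.exp_pos _).le) (fun _ => (Real.exp_pos _).le)
  refine Summable.of_nonneg_of_le (fun _ => (Real.exp_pos _).le) (fun p => ?_) h
  rw [← Real.exp_add]
  apply Real.exp_le_exp.2
  nlinarith [mul_nonneg hc.le (sq_nonneg (((p.1 : ℝ) + u) - (p.2 + v)))]

lemma sumE {c : ℝ} (hc : 0 < c) (z : ℂ) : Summable fun m : Eis => Real.exp (-c * Complex.normSq (m + z)) := by
  obtain ⟨u, v, rfl⟩ := exists_lin z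
  rw [← eqv.summable_iff]
  convert sum2 hc u v using 2 with p
  simp only [Function.comp, eqv_apply, mkE_coe]
  rw [← normSq_lin]
  congr 3
  push_cast; ring

lemma sumN {c : ℝ} (hc : 0 < c) : Summable fun m : Eis => Real.exp (-c * Nm m) := by
  simpa [Nm] using sumE hc 0

lemma poisson2 {t : ℝ} (ht : 0 < t) (u v : ℝ) :
    ∑' p : ℤ × ℤ, cexp (-Real.pi * t * (((p.1 : ℂ) + u) ^ 2 - (p.1 + u) * (p.2 + v) + (p.2 + v) ^ 2)) =
      ((2 / (Real.sqrt 3 * t) : ℝ) : ℂ) * ∑' p : ℤ × ℤ, cexp (-(4 * Real.pi / (3 * t)) * ((p.1 : ℂ) ^ 2 + p.1 * p.2 + (p.2 : ℂ) ^ 2)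
        + 2 * Real.pi * Complex.I * (p.1 * u + p.2 * v)) := by
  have ht' : (t : ℂ) ≠ 0 := by exact_mod_cast ht.ne'
  have s1 : Summable fun p : ℤ × ℤ => cexp (-Real.pi * t * (((p.1 : ℂ) + u) ^ 2 - (p.1 + u) * (p.2 + v) + (p.2 + v) ^ 2)) := by
    apply Summable.of_norm
    convert sum2 (c := Real.pi * t) (by positivity) u v using 2 with p
    rw [show -Real.pi * t * (((p.1 : ℂ) + u) ^ 2 - (p.1 + u) * (p.2 + v) + (p.2 + v) ^ 2) =
      ((-(Real.pi * t) * (((p.1 : ℝ) + u) ^ 2 - (p.1 + u) * (p.2 + v) + (p.2 + v) ^ 2) : ℝ) : ℂ) by push_cast; ring, Complex.norm_exp_ofReal]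
  have s2 : Summable fun p : ℤ × ℤ => cexp (-Real.pi / t * (p.1 : ℂ) ^ 2 + 2 * Real.pi * Complex.I * p.1 * u) *
      cexp (-Real.pi * (3 * t / 4 : ℝ) * ((p.2 : ℂ) + v) ^ 2 - 2 * Real.pi * Complex.I * (p.1 / 2 : ℝ) * (p.2 + v)) := by
    apply Summable.of_norm
    have h := (sum1 (c := Real.pi / t) (by positivity) 0).mul_of_nonneg (sum1 (c := Real.pi * (3 * t / 4)) (by positivity) v) (fun _ => (Real.exp_pos _).le) (fun _ => (Real.exp_pos _).le)
    convert h using 2 with p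
    rw [norm_mul, Complex.norm_exp, Complex.norm_exp]
    congr 2
    · rw [show -Real.pi / t * (p.1 : ℂ) ^ 2 + 2 * Real.pi * Complex.I * p.1 * u = ((-Real.pi / t * (p.1 : ℝ) ^ 2 : ℝ) : ℂ) + ((2 * Real.pi * p.1 * u : ℝ) : ℂ) * Complex.I by push_cast; ring]
      rw [Complex.add_re, Complex.re_ofReal_mul, Complex.ofReal_re, Complex.I_re]; ring
    · rw [show -Real.pi * (3 * t / 4 : ℝ) * ((p.2 : ℂ) + v) ^ 2 - 2 * Real.pi * Complex.I * (p.1 / 2 : ℝ) * (p.2 + v) = ((-Real.pi * (3 * t / 4) * ((p.2 : ℝ) + v) ^ 2 : ℝ) : ℂ) + ((-2 * Real.pi * (p.1 / 2) * (p.2 + v) : ℝ) : ℂ) * Complex.I by push_cast; ring]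
      rw [Complex.add_re, Complex.re_ofReal_mul, Complex.ofReal_re, Complex.I_re]; ring
  have s3 : Summable fun p : ℤ × ℤ => cexp (-(4 * Real.pi / (3 * t)) * ((p.1 : ℂ) ^ 2 + p.1 * p.2 + (p.2 : ℂ) ^ 2)
        + 2 * Real.pi * Complex.I * (p.1 * u + p.2 * v)) := by
    apply Summable.of_norm
    have h := sum2 (c := 4 * Real.pi / (3 * t)) (by positivity) 0 0
    have h2 := h.comp_injective (i := fun p : ℤ × ℤ => (p.1, -p.2)) (by
      rintro ⟨a, b⟩ ⟨c, d⟩ h; simpa using h)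
    refine h2.congr fun p => ?_
    rw [Complex.norm_exp]
    simp only [Function.comp]
    congr 1
    rw [show -(4 * Real.pi / (3 * t)) * ((p.1 : ℂ) ^ 2 + p.1 * p.2 + (p.2 : ℂ) ^ 2) + 2 * Real.pi * Complex.I * (p.1 * u + p.2 * v) =
      ((-(4 * Real.pi / (3 * t)) * ((p.1 : ℝ) ^ 2 + p.1 * p.2 + (p.2 : ℝ) ^ 2) : ℝ) : ℂ) + ((2 * Real.pi * (p.1 * u + p.2 * v) : ℝ) : ℂ) * Complex.I by push_cast; ring]
    rw [Complex.add_re, Complex.re_ofReal_mul, Complex.ofReal_re, Complex.I_re]; push_cast; ring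
  have s1' : Summable fun p : ℤ × ℤ => cexp (-Real.pi * t * (((p.2 : ℂ) + u) ^ 2 - (p.2 + u) * (p.1 + v) + (p.1 + v) ^ 2)) :=
    (Equiv.prodComm ℤ ℤ).summable_iff.2 s1
  rw [← (Equiv.prodComm ℤ ℤ).tsum_eq]
  simp only [Equiv.prodComm_apply, Prod.swap]
  rw [s1'.tsum_prod, s3.tsum_prod]
  have e1 : ∀ b : ℤ, ∑' a : ℤ, cexp (-Real.pi * t * (((a : ℂ) + u) ^ 2 - (a + u) * (b + v) + (b + v) ^ 2)) =
      ((1 / Real.sqrt t : ℝ) : ℂ) * ∑' j : ℤ, cexp (-Real.pi / t * (j : ℂ) ^ 2 + 2 * Real.pi * Complex.I * j * u) *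
      cexp (-Real.pi * (3 * t / 4 : ℝ) * ((b : ℂ) + v) ^ 2 - 2 * Real.pi * Complex.I * (j / 2 : ℝ) * (b + v)) := by
    intro b
    have h := poisson1 ht (u - (b + v) / 2) 0
    have h2 := congrArg (fun x => x * cexp (-Real.pi * (3 * t / 4 : ℝ) * ((b : ℂ) + v) ^ 2)) h
    simp only [mul_assoc] at h2
    rw [← tsum_mul_right, ← tsum_mul_right] at h2
    convert h2 using 1
    · congr 1; ext a
      rw [← Complex.exp_add]; congr 1; push_cast; ring
    · congr 2; ext a
      rw [← Complex.exp_add, ← Complex.exp_add]; congr 1; push_cast; ring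
  simp_rw [e1]
  rw [tsum_mul_left]
  rw [Summable.tsum_comm (f := fun (j : ℤ) (b : ℤ) => cexp (-Real.pi / t * (j : ℂ) ^ 2 + 2 * Real.pi * Complex.I * j * u) *
      cexp (-Real.pi * (3 * t / 4 : ℝ) * ((b : ℂ) + v) ^ 2 - 2 * Real.pi * Complex.I * (j / 2 : ℝ) * (b + v))) s2]
  have e2 : ∀ j : ℤ, ∑' b : ℤ, cexp (-Real.pi / t * (j : ℂ) ^ 2 + 2 * Real.pi * Complex.I * j * u) *
      cexp (-Real.pi * (3 * t / 4 : ℝ) * ((b : ℂ) + v) ^ 2 - 2 * Real.pi * Complex.I * (j / 2 : ℝ) * (b + v)) =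
      ((1 / Real.sqrt (3 * t / 4) : ℝ) : ℂ) * ∑' l : ℤ, cexp (-(4 * Real.pi / (3 * t)) * ((j : ℂ) ^ 2 + j * l + (l : ℂ) ^ 2)
        + 2 * Real.pi * Complex.I * (j * u + l * v)) := by
    intro j
    rw [tsum_mul_left, poisson1 (by positivity) v (j / 2), mul_left_comm, ← tsum_mul_left]
    congr 2; ext l
    rw [← Complex.exp_add]; congr 1; push_cast; field_simp; ring
  simp_rw [e2]
  rw [tsum_mul_left, ← mul_assoc, ← Complex.ofReal_mul]
  congr 2
  have h4 : Real.sqrt (3 * t / 4) = Real.sqrt 3 * Real.sqrt t / 2 := by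
    rw [Real.sqrt_div (by positivity), Real.sqrt_mul (by norm_num)]
    congr 1
    rw [show (4 : ℝ) = 2 ^ 2 by norm_num, Real.sqrt_sq (by norm_num)]
  rw [h4]
  have h3 : Real.sqrt 3 ≠ 0 := by positivity
  have h5 : Real.sqrt t ≠ 0 := by positivity
  have h6 : Real.sqrt t ^ 2 = t := Real.sq_sqrt ht.le
  field_simp
  rw [h6]

/-- Poisson summation on the Eisenstein lattice. -/
theorem poissonE {t : ℝ} (ht : 0 < t) (z : ℂ) :
    ∑' m : Eis, ((Real.exp (-Real.pi * t * Complex.normSq (m + z)) : ℝ) : ℂ) =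
      ((2 / (Real.sqrt 3 * t) : ℝ) : ℂ) * ∑' k : Eis, ((Real.exp (-(4 * Real.pi / (3 * t)) * Nm k) : ℝ) : ℂ) * ee (k * z) := by
  obtain ⟨u, v, rfl⟩ := exists_lin z
  rw [← eqv.tsum_eq, ← eqv.tsum_eq (fun k : Eis => ((Real.exp (-(4 * Real.pi / (3 * t)) * Nm k) : ℝ) : ℂ) * ee (k * _))]
  let E : ℤ × ℤ ≃ ℤ × ℤ := ⟨fun p => (p.2, p.1 - p.2), fun p => (p.2 + p.1, p.1), fun p => by simp, fun p => by simp⟩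
  have h := poisson2 ht u v
  rw [← E.tsum_eq (fun p : ℤ × ℤ => cexp (-(4 * Real.pi / (3 * t)) * ((p.1 : ℂ) ^ 2 + p.1 * p.2 + (p.2 : ℂ) ^ 2)
        + 2 * Real.pi * Complex.I * (p.1 * u + p.2 * v)))] at h
  convert h using 1
  · congr 1; ext p
    rw [eqv_apply, mkE_coe, Complex.ofReal_exp]
    have : (p.1 : ℂ) + p.2 * ωc + (u + v * ωc) = ((p.1 + u : ℝ) : ℂ) + ((p.2 + v : ℝ) : ℂ) * ωc := by push_cast; ring
    rw [this, normSq_lin]; congr 1; push_cast; ring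
  · congr 2; ext p
    rw [eqv_apply, mkE_coe, Complex.ofReal_exp, Nm_mkE]
    have : ((p.1 : ℂ) + p.2 * ωc) * (u + v * ωc) = ((p.1 * u - p.2 * v : ℝ) : ℂ) + ((p.1 * v + p.2 * u - p.2 * v : ℝ) : ℂ) * ωc := by
      push_cast; linear_combination (p.2 * v : ℂ) * ωc_sq
    rw [this, ee_lin, ← Complex.exp_add]; congr 1
    simp only [E, Equiv.coe_fn_mk]
    push_cast; ring

end

section
variable {χ : Eis → Eis → Eis}

def resEquiv (q : Eis) (hq : q ≠ 0) : (Eis ⧸ Ideal.span {q}) × Eis ≃ Eis :=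
  Equiv.ofBijective (fun p => p.1.out + q * p.2) (by
    have key : ∀ r : Eis ⧸ Ideal.span {q}, ∀ m : Eis, Ideal.Quotient.mk (Ideal.span {q}) (r.out + q * m) = r := by
      intro r m
      have h1 : Ideal.Quotient.mk (Ideal.span {q}) r.out = r := Quotient.out_eq' _
      conv_rhs => rw [← h1]
      rw [mk_eq_iff]
      exact ⟨m, by ring⟩
    constructor
    · rintro ⟨r, m⟩ ⟨s, n⟩ h
      simp only at h
      have h1 : r = s := by rw [← key r m, ← key s n, h]
      subst h1
      have h2 : q * m = q * n := add_left_cancel h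
      rw [mul_left_cancel₀ hq h2]
    · intro b
      obtain ⟨m, hm⟩ := out_dvd q b
      refine ⟨(Ideal.Quotient.mk _ b, -m), ?_⟩
      simp only
      linear_combination hm)

lemma resEquiv_apply (q : Eis) (hq : q ≠ 0) (p) : resEquiv q hq p = p.1.out + q * p.2 := rfl

lemma poissonPer {t : ℝ} (ht : 0 < t) (q : Eis) [NeZero q] {f : Eis → ℂ} (hf : Per q f) (hb : ∀ b, ‖f b‖ ≤ 1) :
    ∑' b : Eis, ((Real.exp (-Real.pi * t * Nm b) : ℝ) : ℂ) * f b =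
      ((2 / (Real.sqrt 3 * (t * Nm q)) : ℝ) : ℂ) *
        ∑' k : Eis, ((Real.exp (-(4 * Real.pi / (3 * (t * Nm q))) * Nm k) : ℝ) : ℂ) * hat q f k := by
  have hq : q ≠ 0 := NeZero.ne q
  have hq' : (q : ℂ) ≠ 0 := by simpa using hq
  have hN : 0 < Nm q := Nm_pos hq
  have s1 : Summable fun b : Eis => ((Real.exp (-Real.pi * t * Nm b) : ℝ) : ℂ) * f b := by
    apply Summable.of_norm_bounded (sumN (c := Real.pi * t) (by positivity))
    intro b
    rw [norm_mul, Complex.norm_real, Real.norm_of_nonneg (Real.exp_pos _).le, neg_mul]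
    exact mul_le_of_le_one_right (Real.exp_pos _).le (hb b)
  have s2 := (resEquiv q hq).summable_iff.2 s1
  rw [← (resEquiv q hq).tsum_eq]
  rw [show (∑' c, ((Real.exp (-Real.pi * t * Nm (resEquiv q hq c)) : ℝ) : ℂ) * f (resEquiv q hq c)) =
    ∑' c, ((fun b : Eis => ((Real.exp (-Real.pi * t * Nm b) : ℝ) : ℂ) * f b) ∘ (resEquiv q hq)) c from rfl]
  rw [s2.tsum_prod, tsum_fintype]
  have e1 : ∀ r : Eis ⧸ Ideal.span {q}, ∑' m : Eis, ((fun b : Eis => ((Real.exp (-Real.pi * t * Nm b) : ℝ) : ℂ) * f b) ∘ (resEquiv q hq)) (r, m) =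
      f r.out * (((2 / (Real.sqrt 3 * (t * Nm q)) : ℝ) : ℂ) * ∑' k : Eis, ((Real.exp (-(4 * Real.pi / (3 * (t * Nm q))) * Nm k) : ℝ) : ℂ) * ee (k * ((r.out : ℂ) / q))) := by
    intro r
    rw [← poissonE (by positivity : 0 < t * Nm q) ((r.out : ℂ) / q), ← tsum_mul_left]
    congr 1; ext m
    simp only [Function.comp, resEquiv_apply]
    rw [hf (r.out + q * m) r.out ⟨m, by ring⟩, mul_comm]
    have e2 : Nm (r.out + q * m) = Nm q * Complex.normSq (m + (r.out : ℂ) / q) := by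
      unfold Nm
      rw [← Complex.normSq_mul]
      congr 1
      push_cast
      field_simp; ring
    rw [e2, ← mul_assoc, ← mul_assoc, mul_assoc (-Real.pi)]
  simp_rw [e1]
  simp_rw [mul_left_comm (f _), ← Finset.mul_sum]
  congr 1
  simp_rw [← tsum_mul_left]
  rw [← Summable.tsum_finsetSum]
  · congr 1; ext k
    unfold hat Sm
    rw [Finset.mul_sum]
    refine Finset.sum_congr rfl fun r _ => ?_
    push_cast
    rw [mul_div_assoc]; ring
  · intro r _
    apply Summable.mul_left
    apply Summable.of_norm_bounded (sumN (c := 4 * Real.pi / (3 * (t * Nm q))) (by positivity))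
    intro b
    rw [norm_mul, Complex.norm_real, Real.norm_of_nonneg (Real.exp_pos _).le, norm_ee, mul_one]

def Th (χ : Eis → Eis → Eis) (t : ℝ) (S T : Finset PP) : ℂ :=
  ∑' b : Eis, ((Real.exp (-Real.pi * t * Nm b) : ℝ) : ℂ) * (X χ S b * (starRingEnd ℂ) (X χ T b))

def uu (hχ : IsCubicSymbol χ) (S : Finset PP) (k : Eis) : ℂ := (starRingEnd ℂ) (X χ S k) * gam hχ S / (Nm (PS S) : ℝ)

theorem Th_eq (hχ : IsCubicSymbol χ) {t : ℝ} (ht : 0 < t) {S T : Finset PP} (h : Disjoint S T) :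
    Th χ t S T = ((2 / (Real.sqrt 3 * t) : ℝ) : ℂ) *
      ∑' k : Eis, ((Real.exp (-(4 * Real.pi / 3) * (Nm k / (t * Nm (PS S) * Nm (PS T)))) : ℝ) : ℂ) *
        (uu hχ S k * (starRingEnd ℂ) (uu hχ T k)) := by
  have hS : 0 < Nm (PS S) := Nm_pos (PS_ne_zero S)
  have hT : 0 < Nm (PS T) := Nm_pos (PS_ne_zero T)
  haveI : NeZero (PS S * PS T) := ⟨mul_ne_zero (PS_ne_zero S) (PS_ne_zero T)⟩
  unfold Th
  rw [poissonPer ht (PS S * PS T) (f := fun b => X χ S b * (starRingEnd ℂ) (X χ T b))]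
  · have h3 : Real.sqrt 3 ≠ 0 := by positivity
    rw [← tsum_mul_left, ← tsum_mul_left]
    congr 1; ext k
    rw [hat_XX hχ h, Nm_mul]
    unfold uu
    rw [show -(4 * Real.pi / (3 * (t * (Nm (PS S) * Nm (PS T))))) * Nm k = -(4 * Real.pi / 3) * (Nm k / (t * Nm (PS S) * Nm (PS T))) by field_simp]
    simp only [map_mul, map_div₀, Complex.conj_ofReal, Complex.conj_conj]
    have h1 : (Nm (PS S) : ℂ) ≠ 0 := by exact_mod_cast hS.ne'
    have h2 : (Nm (PS T) : ℂ) ≠ 0 := by exact_mod_cast hT.ne'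
    have h4 : (t : ℂ) ≠ 0 := by exact_mod_cast ht.ne'
    have h5 : (Real.sqrt 3 : ℂ) ≠ 0 := by exact_mod_cast h3
    push_cast
    field_simp
  · intro x y hxy
    simp only
    rw [X_per hχ S x y ((dvd_mul_right _ _).trans hxy), X_per hχ T x y ((dvd_mul_left _ _).trans hxy)]
  · intro b
    rw [norm_mul, RCLike.norm_conj]
    exact mul_le_one₀ (X_norm_le hχ S b) (norm_nonneg _) (X_norm_le hχ T b)

lemma uu_norm_le (hχ : IsCubicSymbol χ) (S : Finset PP) (k : Eis) : ‖uu hχ S k‖ ≤ 1 := by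
  unfold uu
  have hS : 1 ≤ Nm (PS S) := one_le_Nm (PS_ne_zero S)
  have hg := gam_norm hχ S
  have h1 : ‖gam hχ S‖ ≤ Nm (PS S) := by
    apply abs_le_of_sq_le_sq' _ (by linarith) |>.2
    nlinarith
  rw [norm_div, norm_mul, RCLike.norm_conj, Complex.norm_real, Real.norm_of_nonneg (by linarith), div_le_one (by linarith)]
  calc _ ≤ 1 * ‖gam hχ S‖ := mul_le_mul_of_nonneg_right (X_norm_le hχ S k) (norm_nonneg _)
    _ ≤ _ := by linarith

end

section
lemma norm_Gamma_le {s : ℂ} (hs : 0 < s.re) : ‖Complex.Gamma s‖ ≤ Real.Gamma s.re := by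
  rw [Complex.Gamma_eq_integral hs, Complex.GammaIntegral, Real.Gamma_eq_integral hs]
  refine (MeasureTheory.norm_integral_le_integral_norm _).trans (le_of_eq ?_)
  refine MeasureTheory.setIntegral_congr_fun measurableSet_Ioi fun x hx => ?_
  rw [norm_mul, Complex.norm_of_nonneg (Real.exp_pos _).le, Complex.norm_cpow_eq_rpow_re_of_pos hx]
  simp

lemma norm_Gamma_le2 {σ : ℝ} (hσ : 0 < σ) (τ : ℝ) : ‖Complex.Gamma (σ + τ * Complex.I)‖ ≤ Real.Gamma (σ + 2) / (min 1 (σ ^ 2)) * (1 + τ ^ 2)⁻¹ := by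
  set s : ℂ := σ + τ * Complex.I with hs
  have hre : s.re = σ := by simp [hs]
  have him : s.im = τ := by simp [hs]
  have h0 : s ≠ 0 := by intro h; rw [h] at hre; simp at hre; linarith
  have h1 : s + 1 ≠ 0 := by
    intro h; have := congrArg Complex.re h; simp [hre] at this; linarith
  have e1 := Complex.Gamma_add_one (s + 1) h1
  rw [Complex.Gamma_add_one s h0] at e1
  have h2 := norm_Gamma_le (s := s + 1 + 1) (by simp [hre]; linarith)
  rw [e1, norm_mul, norm_mul] at h2
  have h3 : (s + 1 + 1).re = σ + 2 := by simp [hre]; ring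
  rw [h3] at h2
  have n1 : ‖s‖ ^ 2 = σ ^ 2 + τ ^ 2 := by rw [Complex.sq_norm, Complex.normSq_apply, hre, him]; ring
  have n2 : ‖s + 1‖ ^ 2 = (σ + 1) ^ 2 + τ ^ 2 := by rw [Complex.sq_norm, Complex.normSq_apply]; simp [hre, him]; ring
  have n3 : ‖s‖ ≤ ‖s + 1‖ := by
    apply abs_le_of_sq_le_sq' _ (norm_nonneg _) |>.2
    rw [n1, n2]; nlinarith
  have hm : 0 < min 1 (σ ^ 2) := lt_min one_pos (by positivity)
  have n4 : min 1 (σ ^ 2) * (1 + τ ^ 2) ≤ ‖s‖ * ‖s + 1‖ := by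
    calc _ ≤ ‖s‖ ^ 2 := by
          rw [n1]
          have a1 := min_le_left 1 (σ ^ 2)
          have a2 := min_le_right 1 (σ ^ 2)
          nlinarith [sq_nonneg τ]
      _ ≤ _ := by rw [sq]; exact mul_le_mul_of_nonneg_left n3 (norm_nonneg _)
  rw [← div_eq_mul_inv, div_div, le_div_iff₀ (by positivity)]
  calc _ ≤ ‖Complex.Gamma s‖ * (‖s‖ * ‖s + 1‖) := mul_le_mul_of_nonneg_left n4 (norm_nonneg _)
    _ ≤ _ := by linarith

lemma Gamma_line_cont {σ : ℝ} (hσ : 0 < σ) : Continuous fun τ : ℝ => Complex.Gamma (σ + τ * Complex.I) := by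
  rw [continuous_iff_continuousAt]
  intro τ
  have : ContinuousAt Complex.Gamma (σ + τ * Complex.I) := by
    refine (Complex.differentiableAt_Gamma _ fun m h => ?_).continuousAt
    have := congrArg Complex.re h
    simp at this
    have : (0 : ℝ) ≤ m := Nat.cast_nonneg m
    linarith
  exact ContinuousAt.comp (f := fun τ : ℝ => (σ + τ * Complex.I : ℂ)) this (by fun_prop)

lemma Gamma_line_int {σ : ℝ} (hσ : 0 < σ) : MeasureTheory.Integrable fun τ : ℝ => Complex.Gamma (σ + τ * Complex.I) := by
  refine MeasureTheory.Integrable.mono' (integrable_inv_one_add_sq.const_mul (Real.Gamma (σ + 2) / (min 1 (σ ^ 2)))) (Gamma_line_cont hσ).aestronglyMeasurable ?_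
  exact Filter.Eventually.of_forall fun τ => norm_Gamma_le2 hσ τ

theorem mellin_exp {σ : ℝ} (hσ : 0 < σ) : ∃ G : ℝ → ℂ, Continuous G ∧ MeasureTheory.Integrable G ∧
    ∀ z : ℝ, 0 < z → ((Real.exp (-z) : ℝ) : ℂ) = ∫ τ : ℝ, G τ * (z : ℂ) ^ (-(σ + τ * Complex.I)) := by
  refine ⟨fun τ => (1 / (2 * Real.pi) : ℝ) * Complex.Gamma (σ + τ * Complex.I), continuous_const.mul (Gamma_line_cont hσ), (Gamma_line_int hσ).const_mul _, fun z hz => ?_⟩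
  have hM : ∀ s : ℂ, 0 < s.re → mellin (fun x : ℝ => ((Real.exp (-x) : ℝ) : ℂ)) s = Complex.Gamma s := fun s hs => by
    rw [Complex.Gamma_eq_integral hs, Complex.GammaIntegral_eq_mellin]
  have h := mellinInv_mellin_eq σ (fun x : ℝ => ((Real.exp (-x) : ℝ) : ℂ)) (x := z) hz ?_ ?_ ?_
  · rw [← h, mellinInv, ← MeasureTheory.integral_smul]
    congr 1; ext τ
    rw [hM _ (by simp [hσ])]
    simp only [smul_eq_mul, Complex.real_smul]
    push_cast; ring
  · have := Complex.GammaIntegral_convergent (s := (σ : ℂ)) (by simpa using hσ)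
    unfold MellinConvergent
    simpa [mul_comm] using this
  · unfold Complex.VerticalIntegrable
    refine (Gamma_line_int hσ).congr (Filter.Eventually.of_forall fun τ => ?_)
    simp only
    rw [hM _ (by simp [hσ])]
  · fun_prop

end

section
variable {χ : Eis → Eis → Eis}

lemma mellin_bound {σ : ℝ} (hσ : 0 < σ) : ∃ C : ℝ, 0 ≤ C ∧ ∀ {ι : Type} (I : Finset ι) (c : ι → ℂ) (z : ι → ℝ) (M : ℝ),
    (∀ i ∈ I, 0 < z i) → (∀ τ : ℝ, ‖∑ i ∈ I, c i * (z i : ℂ) ^ (-(σ + τ * Complex.I))‖ ≤ M) →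
    ‖∑ i ∈ I, c i * ((Real.exp (-z i) : ℝ) : ℂ)‖ ≤ C * M := by
  obtain ⟨G, hGc, hGi, hG⟩ := mellin_exp hσ
  refine ⟨∫ τ, ‖G τ‖, MeasureTheory.integral_nonneg fun _ => norm_nonneg _, fun I c z M hz hM => ?_⟩
  have h1 : ∑ i ∈ I, c i * ((Real.exp (-z i) : ℝ) : ℂ) = ∫ τ : ℝ, G τ * ∑ i ∈ I, c i * (z i : ℂ) ^ (-(σ + τ * Complex.I)) := by
    simp_rw [Finset.mul_sum]
    rw [MeasureTheory.integral_finset_sum]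
    · refine Finset.sum_congr rfl fun i hi => ?_
      rw [hG _ (hz i hi), ← MeasureTheory.integral_const_mul]
      congr 1; ext τ; ring
    · intro i hi
      have hzi := hz i hi
      refine MeasureTheory.Integrable.mono' (hGi.norm.const_mul (‖c i‖ * (z i) ^ (-σ))) ?_ ?_
      · apply Continuous.aestronglyMeasurable
        refine hGc.mul (continuous_const.mul ?_)
        have : (z i : ℂ) ≠ 0 := by exact_mod_cast hzi.ne'
        exact Continuous.const_cpow (by fun_prop) (Or.inl this)
      · refine Filter.Eventually.of_forall fun τ => ?_
        rw [norm_mul, norm_mul, Complex.norm_cpow_eq_rpow_re_of_pos hzi]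
        simp only [Complex.neg_re, Complex.add_re, Complex.ofReal_re, Complex.mul_re, Complex.I_re, Complex.I_im, Complex.ofReal_im]
        simp only [mul_zero, mul_one, sub_zero, add_zero]
        apply le_of_eq; ring
  rw [h1, ← MeasureTheory.integral_mul_const]
  refine MeasureTheory.norm_integral_le_of_norm_le (hGi.norm.mul_const M) (Filter.Eventually.of_forall fun τ => ?_)
  rw [norm_mul]
  exact mul_le_mul_of_nonneg_left (hM τ) (norm_nonneg _)

/-- squarefree primary elements of norm at most A -/
lemma SF_finite (A : ℝ) : {S : Finset PP | Nm (PS S) ≤ A}.Finite := by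
  refine Set.Finite.of_finite_image (f := PS) ?_ (fun S _ T _ h => PS_inj h)
  refine (ball_finite A).subset ?_
  rintro _ ⟨S, hS, rfl⟩
  exact hS

def SF (A : ℝ) : Finset (Finset PP) := (SF_finite A).toFinset

lemma mem_SF {A : ℝ} {S : Finset PP} : S ∈ SF A ↔ Nm (PS S) ≤ A := by simp [SF]

open Classical in
lemma Nm_PS_union {S T : Finset PP} (h : Disjoint S T) : Nm (PS (S ∪ T)) = Nm (PS S) * Nm (PS T) := by
  rw [PS_union h, Nm_mul]

lemma Nm_PS_ge (S : Finset PP) : 1 ≤ Nm (PS S) := one_le_Nm (PS_ne_zero S)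

open Classical in
lemma Nm_PS_mono {S T : Finset PP} (h : S ⊆ T) : Nm (PS S) ≤ Nm (PS T) := by
  rw [← Finset.union_sdiff_of_subset h, Nm_PS_union Finset.disjoint_sdiff]
  nlinarith [Nm_PS_ge S, Nm_PS_ge (T \ S)]

lemma SF_mono {A B : ℝ} (h : A ≤ B) : SF A ⊆ SF B := fun S hS => mem_SF.2 ((mem_SF.1 hS).trans h)

lemma SF_down {A : ℝ} {S T : Finset PP} (h : S ⊆ T) (hT : T ∈ SF A) : S ∈ SF A :=
  mem_SF.2 ((Nm_PS_mono h).trans (mem_SF.1 hT))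

def LS (χ : Eis → Eis → Eis) (A B Y : ℝ) : Prop := ∀ l : Finset PP → ℂ,
  ∑ b ∈ Ball B, ‖∑ S ∈ SF A, l S * X χ S b‖ ^ 2 ≤ Y * ∑ S ∈ SF A, ‖l S‖ ^ 2

lemma LS.mono_Y {A B Y Y' : ℝ} (h : LS χ A B Y) (hY : Y ≤ Y') : LS χ A B Y' := fun l =>
  (h l).trans (mul_le_mul_of_nonneg_right hY (Finset.sum_nonneg fun _ _ => sq_nonneg _))

lemma LS.mono_B {A B B' Y : ℝ} (h : LS χ A B Y) (hB : B' ≤ B) : LS χ A B' Y := fun l =>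
  (Finset.sum_le_sum_of_subset_of_nonneg (fun b hb => mem_Ball.2 ((mem_Ball.1 hb).trans hB)) fun _ _ _ => sq_nonneg _).trans (h l)

open Classical in
lemma LS.mono_A {A A' B Y : ℝ} (h : LS χ A B Y) (hA : A' ≤ A) : LS χ A' B Y := by
  intro l
  have := h (fun S => if S ∈ SF A' then l S else 0)
  have e1 : ∀ b, ∑ S ∈ SF A, (if S ∈ SF A' then l S else 0) * X χ S b = ∑ S ∈ SF A', l S * X χ S b := by
    intro b
    rw [← Finset.sum_subset (SF_mono hA)]
    · exact Finset.sum_congr rfl fun S hS => by rw [if_pos hS]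
    · intro S _ hS; rw [if_neg hS, zero_mul]
  have e2 : ∑ S ∈ SF A, ‖(if S ∈ SF A' then l S else 0)‖ ^ 2 = ∑ S ∈ SF A', ‖l S‖ ^ 2 := by
    rw [← Finset.sum_subset (SF_mono hA)]
    · exact Finset.sum_congr rfl fun S hS => by rw [if_pos hS]
    · intro S _ hS; rw [if_neg hS]; simp
  rw [e2] at this
  simpa only [e1] using this

open Classical in
lemma disj_sum (C : ℝ) (f g : Finset PP → ℂ) :
    ‖∑ R ∈ SF C, ∑ R' ∈ SF C, if Disjoint R R' then f R * g R' else 0‖ ≤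
      ∑ E ∈ SF C, ‖∑ R ∈ SF C, if E ⊆ R then f R else 0‖ * ‖∑ R ∈ SF C, if E ⊆ R then g R else 0‖ := by
  have h1 : ∑ R ∈ SF C, ∑ R' ∈ SF C, (if Disjoint R R' then f R * g R' else 0) =
      ∑ E ∈ SF C, (-1) ^ E.card * ((∑ R ∈ SF C, if E ⊆ R then f R else 0) * (∑ R ∈ SF C, if E ⊆ R then g R else 0)) := by
    simp_rw [Finset.sum_mul_sum, Finset.mul_sum]
    conv_rhs => rw [Finset.sum_comm]
    refine Finset.sum_congr rfl fun R hR => ?_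
    conv_rhs => rw [Finset.sum_comm]
    refine Finset.sum_congr rfl fun R' hR' => ?_
    have h2 := Finset.sum_powerset_neg_one_pow_card (x := R ∩ R')
    have h3 : ∑ E ∈ SF C, (-1 : ℂ) ^ E.card * ((if E ⊆ R then f R else 0) * (if E ⊆ R' then g R' else 0)) =
        ∑ E ∈ (R ∩ R').powerset, (-1 : ℂ) ^ E.card * (f R * g R') := by
      symm
      rw [← Finset.sum_subset (s₁ := (R ∩ R').powerset) (s₂ := SF C)]
      · refine Finset.sum_congr rfl fun E hE => ?_
        rw [Finset.mem_powerset, Finset.subset_inter_iff] at hE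
        rw [if_pos hE.1, if_pos hE.2]
      · intro E hE
        rw [Finset.mem_powerset] at hE
        exact SF_down (hE.trans Finset.inter_subset_left) hR
      · intro E _ hE
        rw [Finset.mem_powerset, Finset.subset_inter_iff, not_and_or] at hE
        rcases hE with hE | hE <;> simp [hE]
    rw [h3, ← Finset.sum_mul]
    have h4 : ∑ E ∈ (R ∩ R').powerset, (-1 : ℂ) ^ E.card = ((∑ E ∈ (R ∩ R').powerset, (-1 : ℤ) ^ E.card : ℤ) : ℂ) := by push_cast; rfl
    rw [h4, h2]
    simp only [Finset.disjoint_iff_inter_eq_empty]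
    split_ifs <;> simp
  rw [h1]
  refine (norm_sum_le _ _).trans (Finset.sum_le_sum fun E _ => ?_)
  rw [norm_mul, norm_mul, norm_pow, norm_neg, norm_one, one_pow, one_mul]

open Classical in
lemma sum_sup (C : ℝ) (f : Finset PP → ℝ) :
    ∑ E ∈ SF C, ∑ R ∈ SF C, (if E ⊆ R then f R else 0) = ∑ R ∈ SF C, 2 ^ R.card * f R := by
  rw [Finset.sum_comm]
  refine Finset.sum_congr rfl fun R hR => ?_
  rw [← Finset.sum_filter, Finset.sum_const, nsmul_eq_mul]
  congr 1
  have : (SF C).filter (fun E => E ⊆ R) = R.powerset := by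
    ext E
    rw [Finset.mem_filter, Finset.mem_powerset]
    exact ⟨fun h => h.2, fun h => ⟨SF_down h hR, h⟩⟩
  rw [this, Finset.card_powerset]; push_cast; rfl

lemma uu_sq (hχ : IsCubicSymbol χ) (S : Finset PP) : ‖gam hχ S / (Nm (PS S) : ℝ)‖ ^ 2 = (Nm (PS S))⁻¹ := by
  have := Nm_PS_ge S
  rw [norm_div, div_pow, gam_norm, Complex.norm_real, Real.norm_of_nonneg (by linarith)]
  field_simp

lemma LS_u (hχ : IsCubicSymbol χ) {C B Y : ℝ} (hC : 1 ≤ C) (hY : 0 ≤ Y) (h : LS χ C B Y) (s : Finset Eis)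
    (hs : s ⊆ Ball B) (a : Finset PP → ℂ) (ha : ∀ R ∈ SF C, a R ≠ 0 → C / 2 < Nm (PS R)) {σ : ℝ} (hσ : 0 < σ) (τ : ℝ) :
    ∑ k ∈ s, ‖∑ R ∈ SF C, a R * (Nm (PS R) : ℂ) ^ (σ + τ * Complex.I) * uu hχ R k‖ ^ 2 ≤
      2 * C ^ (2 * σ) / C * Y * ∑ R ∈ SF C, ‖a R‖ ^ 2 := by
  have h1 := h fun R => (starRingEnd ℂ) (a R * (Nm (PS R) : ℂ) ^ (σ + τ * Complex.I) * (gam hχ R / (Nm (PS R) : ℝ)))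
  have e1 : ∀ k, ‖∑ R ∈ SF C, a R * (Nm (PS R) : ℂ) ^ (σ + τ * Complex.I) * uu hχ R k‖ =
      ‖∑ R ∈ SF C, (starRingEnd ℂ) (a R * (Nm (PS R) : ℂ) ^ (σ + τ * Complex.I) * (gam hχ R / (Nm (PS R) : ℝ))) * X χ R k‖ := by
    intro k
    rw [← RCLike.norm_conj, map_sum]
    congr 1
    refine Finset.sum_congr rfl fun R _ => ?_
    unfold uu
    simp only [map_mul, map_div₀, Complex.conj_conj]
    ring
  simp_rw [e1]
  refine (Finset.sum_le_sum_of_subset_of_nonneg hs fun _ _ _ => sq_nonneg _).trans (h1.trans ?_)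
  rw [mul_comm (2 * C ^ (2 * σ) / C) Y, mul_assoc]
  refine mul_le_mul_of_nonneg_left ?_ hY
  rw [Finset.mul_sum]
  refine Finset.sum_le_sum fun R hR => ?_
  by_cases h0 : a R = 0
  · simp [h0]
  have hN := Nm_PS_ge R
  have hN2 := ha R hR h0
  rw [mem_SF] at hR
  rw [RCLike.norm_conj, norm_mul, norm_mul, mul_pow, uu_sq, mul_pow, Complex.norm_cpow_eq_rpow_re_of_pos (by linarith)]
  simp only [Complex.add_re, Complex.ofReal_re, Complex.mul_re, Complex.I_re, Complex.I_im, Complex.ofReal_im]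
  simp only [mul_zero, mul_one, sub_zero, add_zero]
  rw [← Real.rpow_natCast (Nm (PS R) ^ σ), ← Real.rpow_mul (by linarith)]
  have h2 : Nm (PS R) ^ (σ * (2 : ℕ)) ≤ C ^ (2 * σ) := by
    rw [show σ * (2 : ℕ) = 2 * σ by push_cast; ring]
    exact Real.rpow_le_rpow (by linarith) hR (by linarith)
  have h3 : (Nm (PS R))⁻¹ ≤ 2 / C := by
    rw [inv_le_comm₀ (by linarith) (by positivity), inv_div]; linarith
  calc _ ≤ ‖a R‖ ^ 2 * C ^ (2 * σ) * (2 / C) := by gcongr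
    _ = _ := by ring

end

section
variable {χ : Eis → Eis → Eis}

open Classical in
def hk (hχ : IsCubicSymbol χ) (C t : ℝ) (a : Finset PP → ℂ) (k : Eis) : ℂ :=
  ∑ R ∈ SF C, ∑ R' ∈ SF C, if Disjoint R R' then a R * (starRingEnd ℂ) (a R') *
    (((Real.exp (-(4 * Real.pi / 3) * (Nm k / (t * Nm (PS R) * Nm (PS R')))) : ℝ) : ℂ) * (uu hχ R k * (starRingEnd ℂ) (uu hχ R' k))) else 0

lemma exists_phase (z : ℂ) : ∃ θ : ℂ, ‖θ‖ ≤ 1 ∧ θ * z = (‖z‖ : ℂ) := by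
  by_cases h : z = 0
  · exact ⟨0, by simp, by simp [h]⟩
  · refine ⟨(starRingEnd ℂ) z / ‖z‖, ?_, ?_⟩
    · rw [norm_div, RCLike.norm_conj, Complex.norm_real, norm_norm, div_self (by simpa using h)]
    · have : (‖z‖ : ℂ) ≠ 0 := by simpa using h
      rw [div_mul_eq_mul_div, mul_comm, Complex.mul_conj, Complex.normSq_eq_norm_sq]
      push_cast; field_simp

lemma cpow_split {c n t x y σ τ : ℝ} (hc : 0 < c) (hn : 0 < n) (ht : 0 < t) (hx : 0 < x) (hy : 0 < y) :
    ((c * (n / (t * x * y)) : ℝ) : ℂ) ^ (-(σ + τ * Complex.I)) =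
      ((c * n / t : ℝ) : ℂ) ^ (-(σ + τ * Complex.I)) * ((x : ℂ) ^ (σ + τ * Complex.I) * (starRingEnd ℂ) ((y : ℂ) ^ (σ + (-τ : ℝ) * Complex.I))) := by
  have e : c * (n / (t * x * y)) = c * n / t * (x⁻¹ * y⁻¹) := by field_simp
  rw [e, Complex.ofReal_mul, Complex.mul_cpow_ofReal_nonneg (by positivity) (by positivity), Complex.ofReal_mul,
    Complex.mul_cpow_ofReal_nonneg (by positivity) (by positivity)]
  congr 2
  · rw [Complex.ofReal_inv, Complex.cpow_neg, Complex.inv_cpow, inv_inv]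
    rw [Complex.arg_ofReal_of_nonneg hx.le]; exact Real.pi_pos.ne
  · rw [Complex.ofReal_inv, Complex.cpow_neg, Complex.inv_cpow, inv_inv]
    · have hy' : (y : ℂ).arg ≠ Real.pi := by rw [Complex.arg_ofReal_of_nonneg hy.le]; exact Real.pi_pos.ne
      have h1 := Complex.conj_cpow (x := (y : ℂ)) (σ + (-τ : ℝ) * Complex.I) hy'
      rw [Complex.conj_ofReal] at h1
      rw [Complex.cpow_conj _ _ hy'] at h1
      have h2 := Complex.cpow_conj (y : ℂ) (σ + (-τ : ℝ) * Complex.I) hy'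
      rw [Complex.conj_ofReal] at h2
      rw [← h2]
      congr 1
      simp
    · rw [Complex.arg_ofReal_of_nonneg hy.le]; exact Real.pi_pos.ne

open Classical in
lemma shell {σ : ℝ} (hσ : 0 < σ) : ∃ D : ℝ, 0 ≤ D ∧ ∀ {χ : Eis → Eis → Eis} (hχ : IsCubicSymbol χ) (C t K Y : ℝ) (a : Finset PP → ℂ)
    (s : Finset Eis), 1 ≤ C → 0 < t → 0 < K → 0 ≤ Y → LS χ C (2 * K) Y → (∀ k ∈ s, K ≤ Nm k ∧ Nm k ≤ 2 * K) →
    (∀ R ∈ SF C, a R ≠ 0 → C / 2 < Nm (PS R)) →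
    ∑ k ∈ s, ‖hk hχ C t a k‖ ≤ D * ((K / (t * C ^ 2)) ^ (-σ) / C * Y * ∑ R ∈ SF C, 2 ^ R.card * ‖a R‖ ^ 2) := by
  obtain ⟨D, hD, hb⟩ := mellin_bound hσ
  refine ⟨D * 2, by positivity, fun hχ C t K Y a s hC ht hK hY hLS hs ha => ?_⟩
  choose θ hθ1 hθ2 using fun k : Eis => exists_phase (hk hχ C t a k)
  have hc : 0 < 4 * Real.pi / 3 := by positivity
  have hc1 : 1 ≤ 4 * Real.pi / 3 := by linarith [Real.pi_gt_three]
  have hpos : ∀ k ∈ s, 0 < Nm k := fun k hk => hK.trans_le (hs k hk).1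
  have key := hb (ι := Eis × Finset PP × Finset PP) (s ×ˢ SF C ×ˢ SF C)
    (fun i => θ i.1 * (if Disjoint i.2.1 i.2.2 then a i.2.1 * (starRingEnd ℂ) (a i.2.2) * (uu hχ i.2.1 i.1 * (starRingEnd ℂ) (uu hχ i.2.2 i.1)) else 0))
    (fun i => 4 * Real.pi / 3 * (Nm i.1 / (t * Nm (PS i.2.1) * Nm (PS i.2.2))))
    ((K / t) ^ (-σ) * ((2 * C ^ (2 * σ) / C) * Y * ∑ R ∈ SF C, 2 ^ R.card * ‖a R‖ ^ 2)) ?_ ?_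
  · have e1 : ((∑ k ∈ s, ‖hk hχ C t a k‖ : ℝ) : ℂ) = ∑ i ∈ s ×ˢ SF C ×ˢ SF C, (θ i.1 * (if Disjoint i.2.1 i.2.2 then a i.2.1 * (starRingEnd ℂ) (a i.2.2) * (uu hχ i.2.1 i.1 * (starRingEnd ℂ) (uu hχ i.2.2 i.1)) else 0)) * ((Real.exp (-(4 * Real.pi / 3 * (Nm i.1 / (t * Nm (PS i.2.1) * Nm (PS i.2.2))))) : ℝ) : ℂ) := by
      rw [Finset.sum_product, Complex.ofReal_sum]
      refine Finset.sum_congr rfl fun k _ => ?_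
      rw [← hθ2, hk, Finset.sum_product, Finset.mul_sum]
      refine Finset.sum_congr rfl fun R _ => ?_
      rw [Finset.mul_sum]
      refine Finset.sum_congr rfl fun R' _ => ?_
      simp only
      split_ifs
      · rw [neg_mul]; ring
      · simp
    have e2 : ∑ k ∈ s, ‖hk hχ C t a k‖ = ‖((∑ k ∈ s, ‖hk hχ C t a k‖ : ℝ) : ℂ)‖ := by
      rw [Complex.norm_real, Real.norm_of_nonneg (Finset.sum_nonneg fun _ _ => norm_nonneg _)]
    rw [e2, e1]
    refine key.trans (le_of_eq ?_)
    have e3 : (K / (t * C ^ 2)) ^ (-σ) = (K / t) ^ (-σ) * C ^ (2 * σ) := by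
      rw [show K / (t * C ^ 2) = K / t * (C ^ 2)⁻¹ by field_simp, Real.mul_rpow (by positivity) (by positivity)]
      congr 1
      rw [Real.inv_rpow (by positivity), Real.rpow_neg (by positivity), inv_inv, ← Real.rpow_natCast C 2, ← Real.rpow_mul (by linarith)]
      norm_cast
    rw [e3]; ring
  · rintro ⟨k, R, R'⟩ hi
    simp only [Finset.mem_product] at hi
    have := hpos k hi.1
    have := Nm_PS_ge R
    have := Nm_PS_ge R'
    positivity
  · intro τ
    set f : Eis → Finset PP → ℂ := fun k R => a R * (Nm (PS R) : ℂ) ^ (σ + τ * Complex.I) * uu hχ R k with hf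
    set g : Eis → Finset PP → ℂ := fun k R => a R * (Nm (PS R) : ℂ) ^ (σ + (-τ : ℝ) * Complex.I) * uu hχ R k with hg
    have e1 : ∑ i ∈ s ×ˢ SF C ×ˢ SF C, (θ i.1 * (if Disjoint i.2.1 i.2.2 then a i.2.1 * (starRingEnd ℂ) (a i.2.2) * (uu hχ i.2.1 i.1 * (starRingEnd ℂ) (uu hχ i.2.2 i.1)) else 0)) * ((4 * Real.pi / 3 * (Nm i.1 / (t * Nm (PS i.2.1) * Nm (PS i.2.2))) : ℝ) : ℂ) ^ (-(σ + τ * Complex.I)) =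
      ∑ k ∈ s, θ k * ((4 * Real.pi / 3 * Nm k / t : ℝ) : ℂ) ^ (-(σ + τ * Complex.I)) *
        ∑ R ∈ SF C, ∑ R' ∈ SF C, if Disjoint R R' then f k R * (starRingEnd ℂ) (g k R') else 0 := by
      rw [Finset.sum_product]
      refine Finset.sum_congr rfl fun k hk => ?_
      rw [Finset.sum_product, Finset.mul_sum]
      refine Finset.sum_congr rfl fun R _ => ?_
      rw [Finset.mul_sum]
      refine Finset.sum_congr rfl fun R' _ => ?_
      simp only
      split_ifs
      · rw [cpow_split hc (hpos k hk) ht (by linarith [Nm_PS_ge R]) (by linarith [Nm_PS_ge R'])]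
        simp only [hf, hg, map_mul]
        ring
      · simp
    rw [e1]
    refine (norm_sum_le _ _).trans ?_
    have e2 : ∀ k ∈ s, ‖θ k * ((4 * Real.pi / 3 * Nm k / t : ℝ) : ℂ) ^ (-(σ + τ * Complex.I)) *
        ∑ R ∈ SF C, ∑ R' ∈ SF C, (if Disjoint R R' then f k R * (starRingEnd ℂ) (g k R') else 0)‖ ≤
        (K / t) ^ (-σ) * ∑ E ∈ SF C, (‖∑ R ∈ SF C, (if E ⊆ R then f k R else 0)‖ ^ 2 + ‖∑ R ∈ SF C, (if E ⊆ R then g k R else 0)‖ ^ 2) / 2 := by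
      intro k hk
      rw [norm_mul, norm_mul]
      refine mul_le_mul ?_ ?_ (norm_nonneg _) (by positivity)
      · have hp := hpos k hk
        rw [Complex.norm_cpow_eq_rpow_re_of_pos (by positivity)]
        simp only [Complex.neg_re, Complex.add_re, Complex.ofReal_re, Complex.mul_re, Complex.I_re, Complex.I_im, Complex.ofReal_im]
        simp only [mul_zero, mul_one, sub_zero, add_zero]
        calc _ ≤ 1 * (K / t) ^ (-σ) := by
              refine mul_le_mul (hθ1 k) ?_ (by positivity) zero_le_one
              refine Real.rpow_le_rpow_of_nonpos (by positivity) ?_ (by linarith)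
              have := (hs k hk).1
              gcongr
              nlinarith
          _ = _ := one_mul _
      · refine (disj_sum C (f k) (fun R => (starRingEnd ℂ) (g k R))).trans ?_
        refine Finset.sum_le_sum fun E _ => ?_
        have e3 : ‖∑ R ∈ SF C, (if E ⊆ R then (starRingEnd ℂ) (g k R) else 0)‖ = ‖∑ R ∈ SF C, (if E ⊆ R then g k R else 0)‖ := by
          rw [← RCLike.norm_conj, map_sum]
          congr 1
          refine Finset.sum_congr rfl fun R _ => ?_
          split_ifs <;> simp
        rw [e3]
        nlinarith [sq_nonneg (‖∑ R ∈ SF C, (if E ⊆ R then f k R else 0)‖ - ‖∑ R ∈ SF C, (if E ⊆ R then g k R else 0)‖)]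
    refine (Finset.sum_le_sum e2).trans ?_
    rw [← Finset.mul_sum]
    refine mul_le_mul_of_nonneg_left ?_ (by positivity)
    rw [Finset.sum_comm, ← sum_sup, Finset.mul_sum]
    refine Finset.sum_le_sum fun E _ => ?_
    have hsB : s ⊆ Ball (2 * K) := fun k hk => mem_Ball.2 (hs k hk).2
    have haE : ∀ R ∈ SF C, (if E ⊆ R then a R else 0) ≠ 0 → C / 2 < Nm (PS R) := by
      intro R hR h
      split_ifs at h
      · exact ha R hR h
      · exact absurd rfl h
    have b1 := LS_u hχ hC hY hLS s hsB (fun R => if E ⊆ R then a R else 0) haE hσ τ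
    have b2 := LS_u hχ hC hY hLS s hsB (fun R => if E ⊆ R then a R else 0) haE hσ (-τ)
    have e4 : ∑ R ∈ SF C, ‖(if E ⊆ R then a R else 0)‖ ^ 2 = ∑ R ∈ SF C, if E ⊆ R then ‖a R‖ ^ 2 else 0 := by
      refine Finset.sum_congr rfl fun R _ => ?_
      split_ifs <;> simp
    rw [e4] at b1 b2
    simp only [ite_mul, zero_mul] at b1 b2
    rw [← Finset.sum_div, Finset.sum_add_distrib]
    simp only [hf, hg]
    linarith

end

section
variable {χ : Eis → Eis → Eis}

lemma X_zero (hχ : IsCubicSymbol χ) {R : Finset PP} (h : R.Nonempty) : X χ R 0 = 0 := by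
  obtain ⟨p, hp⟩ := h
  unfold X
  refine Finset.prod_eq_zero hp ?_
  have : χ p.1 0 = 0 := (hχ.zero_iff p 0).2 (dvd_zero _)
  rw [this]; simp

lemma hk_zero (hχ : IsCubicSymbol χ) (C t : ℝ) (a : Finset PP → ℂ) : ‖hk hχ C t a 0‖ ≤ ‖a ∅‖ ^ 2 := by
  classical
  have h0 : ∀ R : Finset PP, R ≠ ∅ → uu hχ R 0 = 0 := fun R hR => by
    unfold uu; rw [X_zero hχ (Finset.nonempty_iff_ne_empty.2 hR)]; simp
  by_cases h : (∅ : Finset PP) ∈ SF C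
  · unfold hk
    rw [Finset.sum_eq_single_of_mem ∅ h, Finset.sum_eq_single_of_mem ∅ h]
    · simp only [Nm_zero, zero_div, mul_zero, Real.exp_zero, Complex.ofReal_one, one_mul, disjoint_self, Finset.bot_eq_empty, if_true]
      rw [norm_mul, norm_mul, norm_mul, RCLike.norm_conj, RCLike.norm_conj, ← sq, ← sq]
      have := uu_norm_le hχ ∅ 0
      calc _ ≤ ‖a ∅‖ ^ 2 * 1 ^ 2 := by gcongr
        _ = _ := by ring
    · intro R _ hR; simp [h0 R hR]
    · intro R _ hR; apply Finset.sum_eq_zero; intro R' _; simp [h0 R hR]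
  · have : SF C = ∅ := by
      rw [Finset.eq_empty_iff_forall_notMem]
      intro S hS
      exact h (SF_down (Finset.empty_subset S) hS)
    unfold hk
    rw [this]; simp

open Classical in
lemma all_shells {ε p : ℝ} (hε : 0 < ε) (hp : 0 ≤ p) : ∃ D : ℝ, 0 ≤ D ∧ ∀ {χ : Eis → Eis → Eis} (hχ : IsCubicSymbol χ) (C t M : ℝ)
    (a : Finset PP → ℂ), 1 ≤ C → 0 < t → 0 ≤ M → (∀ K, 1 ≤ K → LS χ C K (M * (max 1 (K / (t * C ^ 2))) ^ p)) →
    (∀ R ∈ SF C, a R ≠ 0 → C / 2 < Nm (PS R)) → ∀ s : Finset Eis,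
    ∑ k ∈ s, ‖hk hχ C t a k‖ ≤ ‖a ∅‖ ^ 2 + D * (M * (t * C ^ 2) ^ ε / C * ∑ R ∈ SF C, 2 ^ R.card * ‖a R‖ ^ 2) := by
  obtain ⟨D₁, hD₁, h₁⟩ := shell hε
  obtain ⟨D₂, hD₂, h₂⟩ := shell (σ := p + ε) (by linarith)
  have hr0 : (0:ℝ) < (2:ℝ) ^ (-ε) := by positivity
  have hr1 : (2:ℝ) ^ (-ε) < 1 := Real.rpow_lt_one_of_one_lt_of_neg (by norm_num) (by linarith)
  refine ⟨(D₁ + D₂) * 2 ^ p * (1 - (2:ℝ) ^ (-ε))⁻¹, ?_, fun {χ} hχ C t M a hC ht hM hLS ha s => ?_⟩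
  · have := sub_pos.2 hr1
    positivity
  set Z := ∑ R ∈ SF C, 2 ^ R.card * ‖a R‖ ^ 2 with hZ
  have hZ0 : 0 ≤ Z := Finset.sum_nonneg fun _ _ => by positivity
  set K0 := t * C ^ 2 with hK0
  have hK0p : 0 < K0 := by positivity
  -- one dyadic shell
  have sh : ∀ j : ℕ, ∀ s' : Finset Eis, (∀ k ∈ s', (2:ℝ) ^ j ≤ Nm k ∧ Nm k ≤ 2 * 2 ^ j) →
      ∑ k ∈ s', ‖hk hχ C t a k‖ ≤ (D₁ + D₂) * 2 ^ p * (M * K0 ^ ε / C * Z) * ((2:ℝ) ^ (-ε)) ^ j := by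
    intro j s' hs'
    have hj : (1:ℝ) ≤ 2 ^ j := one_le_pow₀ (by norm_num)
    have hL := hLS (2 * 2 ^ j) (by linarith)
    have e1 : ((2:ℝ) ^ j / K0) ^ (-ε) = K0 ^ ε * ((2:ℝ) ^ (-ε)) ^ j := by
      rw [Real.div_rpow (by positivity) hK0p.le, Real.rpow_neg hK0p.le, div_inv_eq_mul, mul_comm, ← Real.rpow_natCast, ← Real.rpow_natCast, ← Real.rpow_mul (by norm_num), ← Real.rpow_mul (by norm_num)]
      congr 2; ring
    have fin : ∀ D, 0 ≤ D → D ≤ D₁ + D₂ → D * (((2:ℝ) ^ j / K0) ^ (-ε) / C * (M * 2 ^ p) * Z) ≤ (D₁ + D₂) * 2 ^ p * (M * K0 ^ ε / C * Z) * ((2:ℝ) ^ (-ε)) ^ j := by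
      intro D h0 hD
      rw [e1]
      calc _ = D * (2 ^ p * (M * K0 ^ ε / C * Z) * ((2:ℝ) ^ (-ε)) ^ j) := by ring
        _ ≤ (D₁ + D₂) * (2 ^ p * (M * K0 ^ ε / C * Z) * ((2:ℝ) ^ (-ε)) ^ j) := by gcongr
        _ = _ := by ring
    rcases lt_or_ge ((2:ℝ) ^ j) K0 with hlt | hge
    · have hL' : LS χ C (2 * 2 ^ j) (M * 2 ^ p) := by
        refine hL.mono_Y ?_
        gcongr
        rw [max_le_iff]
        refine ⟨by norm_num, ?_⟩
        rw [div_le_iff₀ hK0p]; linarith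
      exact (h₁ hχ C t (2 ^ j) (M * 2 ^ p) a s' hC ht (by positivity) (by positivity) hL' hs' ha).trans (fin D₁ hD₁ (by linarith))
    · have hL' : LS χ C (2 * 2 ^ j) (M * (2 * (2 ^ j / K0)) ^ p) := by
        refine hL.mono_Y ?_
        gcongr
        rw [max_le_iff]
        have : 1 ≤ 2 ^ j / K0 := (one_le_div hK0p).2 hge
        exact ⟨by linarith, by rw [mul_div_assoc]⟩
      refine (h₂ hχ C t (2 ^ j) _ a s' hC ht (by positivity) (by positivity) hL' hs' ha).trans ?_
      refine le_trans (le_of_eq ?_) (fin D₂ hD₂ (by linarith))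
      rw [Real.mul_rpow (by norm_num) (by positivity), neg_add, Real.rpow_add (by positivity) (-p) (-ε), Real.rpow_neg (by positivity) p]
      have : (2 ^ j / K0) ^ p ≠ 0 := by positivity
      rw [← hZ, ← hK0]
      field_simp
  -- split
  have h3 : ∑ k ∈ s, ‖hk hχ C t a k‖ ≤ ‖hk hχ C t a 0‖ + ∑ k ∈ s.filter (· ≠ 0), ‖hk hχ C t a k‖ := by
    rw [← Finset.sum_filter_add_sum_filter_not s (fun k => k ≠ 0), add_comm]
    gcongr
    have : s.filter (fun k => ¬ k ≠ 0) ⊆ {0} := by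
      intro k hk; simpa using (Finset.mem_filter.1 hk).2
    refine (Finset.sum_le_sum_of_subset_of_nonneg this fun _ _ _ => norm_nonneg _).trans ?_
    simp
  refine h3.trans (add_le_add (hk_zero hχ C t a) ?_)
  set s1 := s.filter (· ≠ 0) with hs1
  set J := (s1.sup fun k => Nat.log 2 (NmN k)) + 1 with hJ
  have h4 : ∑ k ∈ s1, ‖hk hχ C t a k‖ = ∑ j ∈ Finset.range J, ∑ k ∈ s1.filter (fun k => Nat.log 2 (NmN k) = j), ‖hk hχ C t a k‖ := by
    rw [Finset.sum_fiberwise_of_maps_to]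
    intro k hk
    rw [Finset.mem_range, hJ, Nat.lt_succ_iff]
    exact Finset.le_sup (f := fun k => Nat.log 2 (NmN k)) hk
  rw [h4]
  have h5 : ∀ j ∈ Finset.range J, ∑ k ∈ s1.filter (fun k => Nat.log 2 (NmN k) = j), ‖hk hχ C t a k‖ ≤
      (D₁ + D₂) * 2 ^ p * (M * K0 ^ ε / C * Z) * ((2:ℝ) ^ (-ε)) ^ j := by
    intro j _
    apply sh
    intro k hk
    rw [Finset.mem_filter] at hk
    have hk0 : k ≠ 0 := (Finset.mem_filter.1 hk.1).2
    have hn : NmN k ≠ 0 := by rw [Ne, NmN_eq_zero]; exact hk0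
    rw [← NmN_cast, ← hk.2]
    constructor
    · exact_mod_cast Nat.pow_log_le_self 2 hn
    · have := (Nat.lt_pow_succ_log_self (by norm_num : 1 < 2) (NmN k)).le
      rw [pow_succ, mul_comm] at this
      exact_mod_cast this
  refine (Finset.sum_le_sum h5).trans ?_
  rw [← Finset.mul_sum]
  have h6 : ∑ j ∈ Finset.range J, ((2:ℝ) ^ (-ε)) ^ j ≤ (1 - (2:ℝ) ^ (-ε))⁻¹ := by
    rw [← tsum_geometric_of_lt_one hr0.le hr1]
    exact (summable_geometric_of_lt_one hr0.le hr1).sum_le_tsum _ fun _ _ => by positivity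
  calc _ ≤ (D₁ + D₂) * 2 ^ p * (M * K0 ^ ε / C * Z) * (1 - (2:ℝ) ^ (-ε))⁻¹ := by gcongr
    _ = _ := by ring

open Classical in
lemma disj_Th {ε p : ℝ} (hε : 0 < ε) (hp : 0 ≤ p) : ∃ D : ℝ, 0 ≤ D ∧ ∀ {χ : Eis → Eis → Eis} (_ : IsCubicSymbol χ) (C t M : ℝ)
    (a : Finset PP → ℂ), 1 ≤ C → 0 < t → 0 ≤ M → (∀ K, 1 ≤ K → LS χ C K (M * (max 1 (K / (t * C ^ 2))) ^ p)) →
    (∀ R ∈ SF C, a R ≠ 0 → C / 2 < Nm (PS R)) →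
    ‖∑ R ∈ SF C, ∑ R' ∈ SF C, if Disjoint R R' then a R * (starRingEnd ℂ) (a R') * Th χ t R R' else 0‖ ≤
      2 / t * (‖a ∅‖ ^ 2 + D * (M * (t * C ^ 2) ^ ε / C * ∑ R ∈ SF C, 2 ^ R.card * ‖a R‖ ^ 2)) := by
  obtain ⟨D, hD, h⟩ := all_shells hε hp
  refine ⟨D, hD, fun {χ} hχ C t M a hC ht hM hLS ha => ?_⟩
  have hb := h hχ C t M a hC ht hM hLS ha
  set Bd := ‖a ∅‖ ^ 2 + D * (M * (t * C ^ 2) ^ ε / C * ∑ R ∈ SF C, 2 ^ R.card * ‖a R‖ ^ 2)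
  have hsum : ∀ R R' : Finset PP, Summable fun k : Eis => if Disjoint R R' then a R * (starRingEnd ℂ) (a R') *
    (((Real.exp (-(4 * Real.pi / 3) * (Nm k / (t * Nm (PS R) * Nm (PS R')))) : ℝ) : ℂ) * (uu hχ R k * (starRingEnd ℂ) (uu hχ R' k))) else 0 := by
    intro R R'
    split_ifs
    · apply Summable.mul_left
      have h1 := Nm_PS_ge R
      have h2 := Nm_PS_ge R'
      apply Summable.of_norm_bounded (sumN (c := (4 * Real.pi / 3) / (t * Nm (PS R) * Nm (PS R'))) (by positivity))
      intro k
      rw [norm_mul, norm_mul, RCLike.norm_conj, Complex.norm_real, Real.norm_of_nonneg (Real.exp_pos _).le]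
      have h3 := uu_norm_le hχ R k
      have h4 := uu_norm_le hχ R' k
      calc _ ≤ Real.exp (-(4 * Real.pi / 3) * (Nm k / (t * Nm (PS R) * Nm (PS R')))) * (1 * 1) := by gcongr
        _ = _ := by rw [mul_one, mul_one]; congr 1; field_simp
    · exact summable_zero
  have e1 : ∑ R ∈ SF C, ∑ R' ∈ SF C, (if Disjoint R R' then a R * (starRingEnd ℂ) (a R') * Th χ t R R' else 0) =
      ((2 / (Real.sqrt 3 * t) : ℝ) : ℂ) * ∑' k, hk hχ C t a k := by
    unfold hk
    rw [Summable.tsum_finsetSum (fun R _ => summable_sum fun R' _ => hsum R R'), Finset.mul_sum]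
    refine Finset.sum_congr rfl fun R _ => ?_
    rw [Summable.tsum_finsetSum (fun R' _ => hsum R R'), Finset.mul_sum]
    refine Finset.sum_congr rfl fun R' _ => ?_
    split_ifs with hd
    · rw [Th_eq hχ ht hd, tsum_mul_left]; ring
    · simp
  have s1 : Summable (hk hχ C t a) := summable_sum fun R _ => summable_sum fun R' _ => hsum R R'
  have h2 : ‖∑' k, hk hχ C t a k‖ ≤ Bd := by
    have := s1.hasSum.norm
    exact le_of_tendsto this (Filter.Eventually.of_forall fun s => (norm_sum_le _ _).trans (hb s))
  rw [e1, norm_mul, Complex.norm_real, Real.norm_of_nonneg (by positivity)]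
  have h3 : 1 ≤ Real.sqrt 3 := by rw [Real.one_le_sqrt]; norm_num
  refine mul_le_mul ?_ h2 (norm_nonneg _) (by positivity)
  apply div_le_div_of_nonneg_left (by norm_num) ht
  nlinarith

end

section
variable {χ : Eis → Eis → Eis}

lemma Th_summable (hχ : IsCubicSymbol χ) {t : ℝ} (ht : 0 < t) (S T : Finset PP) :
    Summable fun b : Eis => ((Real.exp (-Real.pi * t * Nm b) : ℝ) : ℂ) * (X χ S b * (starRingEnd ℂ) (X χ T b)) := by
  apply Summable.of_norm_bounded (sumN (c := Real.pi * t) (by positivity))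
  intro b
  rw [norm_mul, Complex.norm_real, Real.norm_of_nonneg (Real.exp_pos _).le, neg_mul, norm_mul, RCLike.norm_conj]
  exact mul_le_of_le_one_right (Real.exp_pos _).le (mul_le_one₀ (X_norm_le hχ S b) (norm_nonneg _) (X_norm_le hχ T b))

lemma gauss_major (hχ : IsCubicSymbol χ) (A : ℝ) {B : ℝ} (hB : 1 ≤ B) (l : Finset PP → ℂ) :
    ∑ b ∈ Ball B, ‖∑ S ∈ SF A, l S * X χ S b‖ ^ 2 ≤
      Real.exp Real.pi * ‖∑ S ∈ SF A, ∑ T ∈ SF A, l S * (starRingEnd ℂ) (l T) * Th χ (1 / B) S T‖ := by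
  have hB0 : 0 < 1 / B := by positivity
  set w : Eis → ℝ := fun b => Real.exp (-Real.pi * (1 / B) * Nm b) * ‖∑ S ∈ SF A, l S * X χ S b‖ ^ 2 with hw
  have e1 : ∀ b : Eis, ((w b : ℝ) : ℂ) = ∑ S ∈ SF A, ∑ T ∈ SF A, l S * (starRingEnd ℂ) (l T) *
      (((Real.exp (-Real.pi * (1 / B) * Nm b) : ℝ) : ℂ) * (X χ S b * (starRingEnd ℂ) (X χ T b))) := by
    intro b
    simp only [hw]
    rw [← Complex.normSq_eq_norm_sq, Complex.ofReal_mul, ← Complex.mul_conj, map_sum, Finset.sum_mul_sum, Finset.mul_sum]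
    refine Finset.sum_congr rfl fun S _ => ?_
    rw [Finset.mul_sum]
    refine Finset.sum_congr rfl fun T _ => ?_
    rw [map_mul]; ring
  have s0 : Summable fun b => ((w b : ℝ) : ℂ) := by
    simp_rw [e1]
    exact summable_sum fun S _ => summable_sum fun T _ => (Th_summable hχ hB0 S T).mul_left _
  have s1 : Summable w := Complex.summable_ofReal.1 s0
  have e2 : ∑ S ∈ SF A, ∑ T ∈ SF A, l S * (starRingEnd ℂ) (l T) * Th χ (1 / B) S T = ((∑' b, w b : ℝ) : ℂ) := by
    rw [Complex.ofReal_tsum]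
    simp_rw [e1]
    rw [Summable.tsum_finsetSum (fun S _ => summable_sum fun T _ => (Th_summable hχ hB0 S T).mul_left _)]
    refine Finset.sum_congr rfl fun S _ => ?_
    rw [Summable.tsum_finsetSum (fun T _ => (Th_summable hχ hB0 S T).mul_left _)]
    refine Finset.sum_congr rfl fun T _ => ?_
    rw [tsum_mul_left]; rfl
  have hw0 : ∀ b, 0 ≤ w b := fun b => by simp only [hw]; positivity
  rw [e2, Complex.norm_real, Real.norm_of_nonneg (tsum_nonneg hw0)]
  refine le_trans ?_ (mul_le_mul_of_nonneg_left (s1.sum_le_tsum (Ball B) fun b _ => hw0 b) (Real.exp_pos _).le)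
  rw [Finset.mul_sum]
  refine Finset.sum_le_sum fun b hb => ?_
  rw [mem_Ball] at hb
  simp only [hw]
  rw [← mul_assoc, ← Real.exp_add]
  refine le_mul_of_one_le_left (sq_nonneg _) (Real.one_le_exp ?_)
  have : 1 / B * Nm b ≤ 1 := by rw [one_div, inv_mul_le_iff₀ (by linarith)]; linarith
  nlinarith [Real.pi_pos]

open Classical in
lemma X_sq (hχ : IsCubicSymbol χ) (G : Finset PP) (b : Eis) :
    X χ G b * (starRingEnd ℂ) (X χ G b) = ∑ D ∈ G.powerset, (-1) ^ D.card * (if PS D ∣ b then 1 else 0) := by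
  set G' := G.filter fun p => p.1 ∣ b with hG'
  have h1 : ∑ D ∈ G.powerset, (-1 : ℂ) ^ D.card * (if PS D ∣ b then 1 else 0) = ∑ D ∈ G'.powerset, (-1 : ℂ) ^ D.card := by
    symm
    rw [← Finset.sum_subset (s₁ := G'.powerset) (s₂ := G.powerset)]
    · refine Finset.sum_congr rfl fun D hD => ?_
      rw [Finset.mem_powerset] at hD
      rw [if_pos, mul_one]
      exact PS_dvd_of_forall fun p hp => (Finset.mem_filter.1 (hD hp)).2
    · exact Finset.powerset_mono.2 (Finset.filter_subset _ _)
    · intro D hD hD'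
      rw [if_neg, mul_zero]
      intro hd
      apply hD'
      rw [Finset.mem_powerset] at hD ⊢
      intro p hp
      exact Finset.mem_filter.2 ⟨hD hp, (dvd_PS_iff.2 hp).trans hd⟩
  have h4 : ∑ E ∈ G'.powerset, (-1 : ℂ) ^ E.card = ((∑ E ∈ G'.powerset, (-1 : ℤ) ^ E.card : ℤ) : ℂ) := by push_cast; rfl
  rw [h1, h4, Finset.sum_powerset_neg_one_pow_card, Complex.mul_conj, Complex.normSq_eq_norm_sq]
  split_ifs with h
  · rw [X_norm_eq hχ]
    · simp
    · intro p hp hd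
      have : p ∈ G' := Finset.mem_filter.2 ⟨hp, hd⟩
      rw [h] at this; simp at this
  · obtain ⟨p, hp⟩ := Finset.nonempty_iff_ne_empty.2 h
    rw [Finset.mem_filter] at hp
    have : X χ G b = 0 := by
      unfold X
      refine Finset.prod_eq_zero hp.1 ?_
      rw [(hχ.zero_iff p b).2 hp.2]; simp
    rw [this]; simp

open Classical in
lemma X_union {S T : Finset PP} (h : Disjoint S T) (b : Eis) : X χ (S ∪ T) b = X χ S b * X χ T b := by
  unfold X; rw [Finset.prod_union h]

open Classical in
lemma Th_split (hχ : IsCubicSymbol χ) {t : ℝ} (ht : 0 < t) {G R R' : Finset PP} (h : Disjoint G R) (h' : Disjoint G R') :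
    Th χ t (G ∪ R) (G ∪ R') = ∑ D ∈ G.powerset, (-1) ^ D.card * (X χ R (PS D) * (starRingEnd ℂ) (X χ R' (PS D)) * Th χ (t * Nm (PS D)) R R') := by
  have e1 : ∀ b : Eis, ((Real.exp (-Real.pi * t * Nm b) : ℝ) : ℂ) * (X χ (G ∪ R) b * (starRingEnd ℂ) (X χ (G ∪ R') b)) =
      ∑ D ∈ G.powerset, (-1) ^ D.card * (if PS D ∣ b then ((Real.exp (-Real.pi * t * Nm b) : ℝ) : ℂ) * (X χ R b * (starRingEnd ℂ) (X χ R' b)) else 0) := by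
    intro b
    rw [X_union h, X_union h', map_mul]
    calc _ = (X χ G b * (starRingEnd ℂ) (X χ G b)) * (((Real.exp (-Real.pi * t * Nm b) : ℝ) : ℂ) * (X χ R b * (starRingEnd ℂ) (X χ R' b))) := by ring
      _ = _ := by
        rw [X_sq hχ, Finset.sum_mul]
        refine Finset.sum_congr rfl fun D _ => ?_
        split_ifs <;> ring
  have s1 : ∀ D : Finset PP, Summable fun b : Eis => (if PS D ∣ b then ((Real.exp (-Real.pi * t * Nm b) : ℝ) : ℂ) * (X χ R b * (starRingEnd ℂ) (X χ R' b)) else 0) := by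
    intro D
    refine Summable.of_norm_bounded (Th_summable hχ ht R R').norm fun b => ?_
    split_ifs
    · exact le_rfl
    · rw [norm_zero]; exact norm_nonneg _
  unfold Th
  simp_rw [e1]
  rw [Summable.tsum_finsetSum (fun D _ => (s1 D).mul_left _)]
  refine Finset.sum_congr rfl fun D _ => ?_
  rw [tsum_mul_left]
  congr 1
  have hinj : Function.Injective fun m : Eis => PS D * m := fun m n hmn => mul_left_cancel₀ (PS_ne_zero D) hmn
  rw [← hinj.tsum_eq, ← tsum_mul_left]
  · congr 1; ext m
    rw [if_pos (dvd_mul_right _ _), X_mul hχ, X_mul hχ, Nm_mul, map_mul, ← mul_assoc (-Real.pi * t), ← mul_assoc (-Real.pi)]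
    ring
  · intro b hb
    rw [Function.mem_support] at hb
    have : PS D ∣ b := by
      by_contra hn; rw [if_neg hn] at hb; exact hb rfl
    obtain ⟨m, rfl⟩ := this
    exact ⟨m, rfl⟩

open Classical in
lemma reindex (A : ℝ) (f : Finset PP → Finset PP → ℂ) :
    ∑ S ∈ SF A, ∑ T ∈ SF A, f S T = ∑ G ∈ SF A, ∑ R ∈ SF (A / Nm (PS G)), ∑ R' ∈ SF (A / Nm (PS G)),
      if Disjoint G R ∧ Disjoint G R' ∧ Disjoint R R' then f (G ∪ R) (G ∪ R') else 0 := by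
  have h1 : ∀ G R : Finset PP, Disjoint G R → (G ∪ R ∈ SF A ↔ R ∈ SF (A / Nm (PS G))) := by
    intro G R h
    have := Nm_PS_ge G
    rw [mem_SF, mem_SF, Nm_PS_union h, le_div_iff₀ (by linarith), mul_comm]
  rw [← Finset.sum_product', Finset.sum_congr rfl (fun G _ => (Finset.sum_product' (SF (A / Nm (PS G))) (SF (A / Nm (PS G)))
    (fun R R' => if Disjoint G R ∧ Disjoint G R' ∧ Disjoint R R' then f (G ∪ R) (G ∪ R') else 0)).symm)]
  rw [Finset.sum_sigma', ← Finset.sum_filter_of_ne (p := fun x : (_ : Finset PP) × Finset PP × Finset PP => Disjoint x.1 x.2.1 ∧ Disjoint x.1 x.2.2 ∧ Disjoint x.2.1 x.2.2)]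
  · refine Finset.sum_nbij' (fun x => ⟨x.1 ∩ x.2, x.1 \ x.2, x.2 \ x.1⟩) (fun x => (x.1 ∪ x.2.1, x.1 ∪ x.2.2)) ?_ ?_ ?_ ?_ ?_
    · rintro ⟨S, T⟩ h
      rw [Finset.mem_product] at h
      have d1 : Disjoint (S ∩ T) (S \ T) := by
        rw [Finset.disjoint_left]; intro p; simp; tauto
      have d2 : Disjoint (S ∩ T) (T \ S) := by
        rw [Finset.disjoint_left]; intro p; simp; tauto
      have d3 : Disjoint (S \ T) (T \ S) := by
        rw [Finset.disjoint_left]; intro p; simp; tauto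
      simp only [Finset.mem_filter, Finset.mem_sigma, Finset.mem_product]
      refine ⟨⟨SF_down Finset.inter_subset_left h.1, ?_, ?_⟩, d1, d2, d3⟩
      · rw [← h1 _ _ d1]
        convert h.1 using 1
        ext p; simp; tauto
      · rw [← h1 _ _ d2]
        convert h.2 using 1
        ext p; simp; tauto
    · rintro ⟨G, R, R'⟩ h
      simp only [Finset.mem_filter, Finset.mem_sigma, Finset.mem_product] at h ⊢
      exact ⟨(h1 _ _ h.2.1).2 h.1.2.1, (h1 _ _ h.2.2.1).2 h.1.2.2⟩
    · rintro ⟨S, T⟩ h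
      simp only [Prod.mk.injEq]
      constructor <;> (ext p; simp; tauto)
    · rintro ⟨G, R, R'⟩ h
      simp only [Finset.mem_filter, Finset.mem_sigma, Finset.mem_product] at h
      obtain ⟨-, d1, d2, d3⟩ := h
      rw [Finset.disjoint_left] at d1 d2 d3
      have e1 : (G ∪ R) ∩ (G ∪ R') = G := by
        ext p; have := @d3 p; simp; tauto
      have e2 : (G ∪ R) \ (G ∪ R') = R := by
        ext p; have := @d3 p; have := @d1 p; simp; tauto
      have e3 : (G ∪ R') \ (G ∪ R) = R' := by
        ext p; have := @d3 p; have := @d2 p; simp; tauto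
      simp only [e1, e2, e3]
    · rintro ⟨S, T⟩ h
      simp only
      have d1 : Disjoint (S ∩ T) (S \ T) := by
        rw [Finset.disjoint_left]; intro p; simp; tauto
      have d2 : Disjoint (S ∩ T) (T \ S) := by
        rw [Finset.disjoint_left]; intro p; simp; tauto
      have d3 : Disjoint (S \ T) (T \ S) := by
        rw [Finset.disjoint_left]; intro p; simp; tauto
      rw [if_pos ⟨d1, d2, d3⟩]
      congr 1 <;> (ext p; simp; tauto)
  · rintro ⟨G, R, R'⟩ _ h
    by_contra hn
    exact h (if_neg hn)

end

section
variable {χ : Eis → Eis → Eis}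

def FF (A B : ℝ) : ℝ := A * B ^ ((1:ℝ)/3) + B + (A * B) ^ ((2:ℝ)/3)

lemma FF_nonneg {A B : ℝ} (hA : 0 ≤ A) (hB : 0 ≤ B) : 0 ≤ FF A B := by unfold FF; positivity

lemma FF_pos {A B : ℝ} (hA : 0 ≤ A) (hB : 0 < B) : 0 < FF A B := by unfold FF; positivity

lemma FF_ge {A B : ℝ} (hA : 0 ≤ A) (hB : 0 ≤ B) : B ≤ FF A B := by
  unfold FF
  have : 0 ≤ A * B ^ ((1:ℝ)/3) := by positivity
  have : 0 ≤ (A * B) ^ ((2:ℝ)/3) := by positivity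
  linarith

lemma FF_scale {A B C t : ℝ} (hB : 1 ≤ B) (hC : 1 ≤ C) (hCA : C ≤ A) (ht : 1 / B ≤ t) :
    1 / (t * C) * FF C (t * C ^ 2) ≤ 2 * FF A B := by
  have hB0 : 0 < B := by linarith
  have hC0 : 0 < C := by linarith
  have hA0 : 0 ≤ A := by linarith
  have ht0 : 0 < t := lt_of_lt_of_le (by positivity) ht
  have hti : t⁻¹ ≤ B := by rw [inv_le_comm₀ ht0 hB0, ← one_div]; exact ht
  have e : 1 / (t * C) * FF C (t * C ^ 2) = C ^ ((2:ℝ)/3) * t⁻¹ ^ ((2:ℝ)/3) + C + C * t⁻¹ ^ ((1:ℝ)/3) := by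
    unfold FF
    have h1 : (t * C ^ 2) ^ ((1:ℝ)/3) = t ^ ((1:ℝ)/3) * C ^ ((2:ℝ)/3) := by
      rw [Real.mul_rpow ht0.le (by positivity), ← Real.rpow_natCast, ← Real.rpow_mul hC0.le]; norm_num
    have h2 : (C * (t * C ^ 2)) ^ ((2:ℝ)/3) = t ^ ((2:ℝ)/3) * C ^ 2 := by
      rw [show C * (t * C ^ 2) = t * C ^ (3:ℕ) by ring, Real.mul_rpow ht0.le (by positivity), ← Real.rpow_natCast, ← Real.rpow_mul hC0.le]
      norm_num
    have h3 : t⁻¹ ^ ((2:ℝ)/3) = t ^ ((1:ℝ)/3) / t := by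
      rw [Real.inv_rpow ht0.le, ← Real.rpow_neg ht0.le, eq_div_iff ht0.ne']
      nth_rewrite 2 [← Real.rpow_one t]
      rw [← Real.rpow_add ht0]; norm_num
    have h4 : t⁻¹ ^ ((1:ℝ)/3) = t ^ ((2:ℝ)/3) / t := by
      rw [Real.inv_rpow ht0.le, ← Real.rpow_neg ht0.le, eq_div_iff ht0.ne']
      nth_rewrite 2 [← Real.rpow_one t]
      rw [← Real.rpow_add ht0]; norm_num
    rw [h1, h2, h3, h4]
    field_simp
  rw [e]
  have a1 : C ^ ((2:ℝ)/3) * t⁻¹ ^ ((2:ℝ)/3) ≤ (A * B) ^ ((2:ℝ)/3) := by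
    rw [← Real.mul_rpow hC0.le (by positivity)]
    gcongr
  have hb : (1:ℝ) ≤ B ^ ((1:ℝ)/3) := Real.one_le_rpow hB (by norm_num)
  have a2 : C * t⁻¹ ^ ((1:ℝ)/3) ≤ A * B ^ ((1:ℝ)/3) := by gcongr
  have a3 : C ≤ A * B ^ ((1:ℝ)/3) := by nlinarith
  have a4 : 0 ≤ (A * B) ^ ((2:ℝ)/3) := by positivity
  unfold FF
  linarith

open Classical in
lemma Z_bound {A : ℝ} {G : Finset PP} (w : Finset PP → ℝ) (hw : ∀ S, 0 ≤ w S) :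
    ∑ R ∈ SF (A / Nm (PS G)), 2 ^ R.card * (if Disjoint G R then w (G ∪ R) else 0) ≤
      ∑ S ∈ SF A, if G ⊆ S then 2 ^ S.card * w S else 0 := by
  have hG := Nm_PS_ge G
  rw [← Finset.sum_filter]
  calc ∑ R ∈ SF (A / Nm (PS G)), 2 ^ R.card * (if Disjoint G R then w (G ∪ R) else 0)
      = ∑ R ∈ (SF (A / Nm (PS G))).filter (fun R => Disjoint G R), 2 ^ R.card * w (G ∪ R) := by
        rw [Finset.sum_filter]
        refine Finset.sum_congr rfl fun R _ => ?_
        split_ifs <;> simp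
    _ ≤ ∑ R ∈ (SF (A / Nm (PS G))).filter (fun R => Disjoint G R), 2 ^ (G ∪ R).card * w (G ∪ R) := by
        refine Finset.sum_le_sum fun R _ => mul_le_mul_of_nonneg_right ?_ (hw _)
        exact pow_le_pow_right₀ (by norm_num) (Finset.card_le_card Finset.subset_union_right)
    _ = ∑ S ∈ ((SF (A / Nm (PS G))).filter (fun R => Disjoint G R)).image (fun R => G ∪ R), 2 ^ S.card * w S := by
        rw [Finset.sum_image]
        intro R hR R' hR' h
        have h1 := (Finset.mem_filter.1 hR).2
        have h2 := (Finset.mem_filter.1 hR').2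
        simp only at h
        rw [← Finset.union_sdiff_cancel_left h1, h, Finset.union_sdiff_cancel_left h2]
    _ ≤ _ := by
        refine Finset.sum_le_sum_of_subset_of_nonneg ?_ fun S _ _ => mul_nonneg (by positivity) (hw _)
        intro S hS
        obtain ⟨R, hR, rfl⟩ := Finset.mem_image.1 hS
        obtain ⟨hR1, hR2⟩ := Finset.mem_filter.1 hR
        rw [Finset.mem_filter, mem_SF, Nm_PS_union hR2]
        rw [mem_SF, le_div_iff₀ (by linarith)] at hR1
        exact ⟨by linarith, Finset.subset_union_left⟩

open Classical in
lemma inner_split (hχ : IsCubicSymbol χ) {t : ℝ} (ht : 0 < t) (C : ℝ) (G : Finset PP) (l : Finset PP → ℂ) :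
    (∑ R ∈ SF C, ∑ R' ∈ SF C,
      if Disjoint G R ∧ Disjoint G R' ∧ Disjoint R R' then l (G ∪ R) * (starRingEnd ℂ) (l (G ∪ R')) * Th χ t (G ∪ R) (G ∪ R') else 0) =
    ∑ D ∈ G.powerset, (-1) ^ D.card * ∑ R ∈ SF C, ∑ R' ∈ SF C, if Disjoint R R' then
      (if Disjoint G R then l (G ∪ R) * X χ R (PS D) else 0) * (starRingEnd ℂ) (if Disjoint G R' then l (G ∪ R') * X χ R' (PS D) else 0) *
        Th χ (t * Nm (PS D)) R R' else 0 := by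
  simp_rw [Finset.mul_sum]
  conv_rhs => rw [Finset.sum_comm]
  refine Finset.sum_congr rfl fun R _ => ?_
  conv_rhs => rw [Finset.sum_comm]
  refine Finset.sum_congr rfl fun R' _ => ?_
  by_cases h1 : Disjoint G R
  · by_cases h2 : Disjoint G R'
    · by_cases h3 : Disjoint R R'
      · simp only [h1, h2, h3, and_self, if_true]
        rw [Th_split hχ ht h1 h2, Finset.mul_sum]
        refine Finset.sum_congr rfl fun D _ => ?_
        rw [map_mul]; ring
      · simp [h3]
    · simp [h2]
  · simp [h1]

end

section
variable {χ : Eis → Eis → Eis}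

open Classical in
lemma recdy {ε p : ℝ} (hε : 0 < ε) (hp : 0 ≤ p) : ∃ D : ℝ, 0 ≤ D ∧ ∀ {χ : Eis → Eis → Eis} (_ : IsCubicSymbol χ) (A B Cst : ℝ)
    (l : Finset PP → ℂ), 1 ≤ A → 1 ≤ B → 0 ≤ Cst →
    (∀ C, 1 ≤ C → C ≤ A → ∀ K0, 0 < K0 → K0 ≤ A * C / B → ∀ K, 1 ≤ K → LS χ C K (Cst * (C * K0) ^ ε * FF C K0 * (max 1 (K / K0)) ^ p)) →
    (∀ S ∈ SF A, l S ≠ 0 → A / 2 < Nm (PS S)) →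
    ∑ b ∈ Ball B, ‖∑ S ∈ SF A, l S * X χ S b‖ ^ 2 ≤ D * (1 + Cst) * A ^ (5 * ε) * FF A B * ∑ S ∈ SF A, 8 ^ S.card * ‖l S‖ ^ 2 := by
  obtain ⟨D0, hD0, h⟩ := disj_Th hε hp
  refine ⟨Real.exp Real.pi * (2 + 4 * D0), by positivity, ?_⟩
  intro χ hχ A B Cst l hA hB hCst hLS hl
  have hA0 : 0 < A := by linarith
  have hB0 : 0 < B := by linarith
  have hF := FF_pos hA0.le hB0
  have hAe : 1 ≤ A ^ (5 * ε) := Real.one_le_rpow hA (by positivity)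
  set W := (2 + 4 * D0) * (1 + Cst) * A ^ (5 * ε) * FF A B with hW
  have hW0 : 0 ≤ W := by positivity
  have hG : ∀ G ∈ SF A, ‖∑ R ∈ SF (A / Nm (PS G)), ∑ R' ∈ SF (A / Nm (PS G)),
      if Disjoint G R ∧ Disjoint G R' ∧ Disjoint R R' then l (G ∪ R) * (starRingEnd ℂ) (l (G ∪ R')) * Th χ (1 / B) (G ∪ R) (G ∪ R') else 0‖
      ≤ ∑ S ∈ SF A, if G ⊆ S then W * (4 ^ S.card * ‖l S‖ ^ 2) else 0 := by
    intro G hGA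
    have hGA' := mem_SF.1 hGA
    have hG1 := Nm_PS_ge G
    rw [inner_split hχ (by positivity)]
    refine (norm_sum_le _ _).trans ?_
    set Z := ∑ S ∈ SF A, if G ⊆ S then 2 ^ S.card * ‖l S‖ ^ 2 else 0 with hZ
    have hZ0 : 0 ≤ Z := Finset.sum_nonneg fun S _ => by split_ifs <;> positivity
    have hlG : ‖l G‖ ^ 2 ≤ Z := by
      have h1 : (if G ⊆ G then 2 ^ G.card * ‖l G‖ ^ 2 else 0) ≤ Z :=
        Finset.single_le_sum (f := fun S => if G ⊆ S then 2 ^ S.card * ‖l S‖ ^ 2 else 0) (fun S _ => by split_ifs <;> positivity) hGA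
      rw [if_pos (Finset.Subset.refl G)] at h1
      refine le_trans ?_ h1
      exact le_mul_of_one_le_left (sq_nonneg _) (one_le_pow₀ (by norm_num))
    set C := A / Nm (PS G) with hC
    have hC1 : 1 ≤ C := by rw [hC, le_div_iff₀ (by linarith)]; linarith
    have hCA : C ≤ A := div_le_self hA0.le hG1
    have hC0 : 0 < C := by linarith
    have step : ∀ D ∈ G.powerset, ‖(-1) ^ D.card * ∑ R ∈ SF C, ∑ R' ∈ SF C, if Disjoint R R' then
      (if Disjoint G R then l (G ∪ R) * X χ R (PS D) else 0) * (starRingEnd ℂ) (if Disjoint G R' then l (G ∪ R') * X χ R' (PS D) else 0) *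
        Th χ (1 / B * Nm (PS D)) R R' else 0‖ ≤ W * Z := by
      intro D hD
      rw [Finset.mem_powerset] at hD
      have hD1 := Nm_PS_ge D
      have hDG := Nm_PS_mono hD
      set t := 1 / B * Nm (PS D) with ht
      have htB : 1 / B ≤ t := le_mul_of_one_le_right (by positivity) hD1
      have ht0 : 0 < t := lt_of_lt_of_le (by positivity) htB
      have hK0 : t * C ^ 2 ≤ A * C / B := by
        have e : A * C / B = 1 / B * Nm (PS G) * C ^ 2 := by
          rw [hC]; field_simp
        rw [e, ht]
        gcongr
      have hK0' : 0 < t * C ^ 2 := by positivity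
      have hFC := FF_pos hC0.le hK0'
      rw [norm_mul, norm_pow, norm_neg, norm_one, one_pow, one_mul]
      have hmain := h hχ C t (Cst * (C * (t * C ^ 2)) ^ ε * FF C (t * C ^ 2))
        (fun R => if Disjoint G R then l (G ∪ R) * X χ R (PS D) else 0) hC1 ht0 (by positivity)
        (fun K hK => hLS C hC1 hCA _ hK0' hK0 K hK) ?_
      · refine hmain.trans ?_
        have b1 : ‖if Disjoint G (∅ : Finset PP) then l (G ∪ ∅) * X χ ∅ (PS D) else 0‖ ^ 2 ≤ Z := by
          rw [if_pos (Finset.disjoint_empty_right G), Finset.union_empty, X_empty, mul_one]; exact hlG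
        have b2 : ∑ R ∈ SF C, 2 ^ R.card * ‖if Disjoint G R then l (G ∪ R) * X χ R (PS D) else 0‖ ^ 2 ≤ Z := by
          refine le_trans (Finset.sum_le_sum fun R _ => ?_) (Z_bound (fun S => ‖l S‖ ^ 2) fun S => sq_nonneg _)
          refine mul_le_mul_of_nonneg_left ?_ (by positivity)
          split_ifs
          · refine pow_le_pow_left₀ (norm_nonneg _) ?_ 2
            rw [norm_mul]
            exact mul_le_of_le_one_right (norm_nonneg _) (X_norm_le hχ _ _)
          · simp
        have b3 : 1 / t ≤ FF A B := by
          refine le_trans ?_ (FF_ge hA0.le hB0.le)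
          rw [div_le_comm₀ ht0 hB0]; exact htB
        have b4 := FF_scale hB hC1 hCA htB
        have b5 : (C * (t * C ^ 2)) ^ ε * (t * C ^ 2) ^ ε ≤ A ^ (5 * ε) := by
          rw [← Real.mul_rpow (by positivity) (by positivity), Real.rpow_mul hA0.le]
          refine Real.rpow_le_rpow (by positivity) ?_ hε.le
          have : t * C ^ 2 ≤ A ^ 2 := by
            refine hK0.trans ?_
            rw [div_le_iff₀ hB0]
            nlinarith [mul_le_mul_of_nonneg_left hCA hA0.le, sq_nonneg A]
          calc C * (t * C ^ 2) * (t * C ^ 2) ≤ A * A ^ 2 * A ^ 2 := by gcongr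
            _ = A ^ (5:ℝ) := by rw [show (5:ℝ) = ((5:ℕ):ℝ) by norm_num, Real.rpow_natCast]; ring
        calc _ ≤ 2 / t * (Z + D0 * (Cst * (C * (t * C ^ 2)) ^ ε * FF C (t * C ^ 2) * (t * C ^ 2) ^ ε / C * Z)) := by
              gcongr
          _ = (2 * (1 / t) + 2 * D0 * Cst * (((C * (t * C ^ 2)) ^ ε * (t * C ^ 2) ^ ε) * (1 / (t * C) * FF C (t * C ^ 2)))) * Z := by
              field_simp
          _ ≤ (2 * FF A B + 2 * D0 * Cst * (A ^ (5 * ε) * (2 * FF A B))) * Z := by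
              gcongr
          _ ≤ W * Z := by
              refine mul_le_mul_of_nonneg_right ?_ hZ0
              rw [hW]
              have q1 : 2 * FF A B ≤ 2 * A ^ (5 * ε) * FF A B := by nlinarith
              have q2 : 0 ≤ (2 * Cst + 4 * D0) * A ^ (5 * ε) * FF A B := by positivity
              nlinarith
      · intro R hR hne
        have hdis : Disjoint G R := by
          by_contra hn; rw [if_neg hn] at hne; exact hne rfl
        rw [if_pos hdis] at hne
        have hRC := mem_SF.1 hR
        have := hl (G ∪ R) (by
          rw [mem_SF, Nm_PS_union hdis]
          rw [hC, le_div_iff₀ (by linarith)] at hRC; linarith) (left_ne_zero_of_mul hne)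
        rw [Nm_PS_union hdis] at this
        rw [hC, div_div, div_lt_iff₀ (by positivity)]
        linarith
    refine (Finset.sum_le_card_nsmul _ _ _ step).trans ?_
    rw [Finset.card_powerset, nsmul_eq_mul, hZ, Finset.mul_sum, Finset.mul_sum]
    refine Finset.sum_le_sum fun S _ => ?_
    split_ifs with hGS
    · push_cast
      have : (2:ℝ) ^ G.card ≤ 2 ^ S.card := pow_le_pow_right₀ (by norm_num) (Finset.card_le_card hGS)
      have e4 : (4:ℝ) ^ S.card = 2 ^ S.card * 2 ^ S.card := by rw [← mul_pow]; norm_num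
      rw [e4]
      calc (2:ℝ) ^ G.card * (W * (2 ^ S.card * ‖l S‖ ^ 2)) ≤ 2 ^ S.card * (W * (2 ^ S.card * ‖l S‖ ^ 2)) := by gcongr
        _ = _ := by ring
    · simp
  refine (gauss_major hχ A hB l).trans ?_
  rw [reindex]
  have e8 : ∑ G ∈ SF A, ∑ S ∈ SF A, (if G ⊆ S then W * (4 ^ S.card * ‖l S‖ ^ 2) else 0) = W * ∑ S ∈ SF A, 8 ^ S.card * ‖l S‖ ^ 2 := by
    rw [sum_sup, Finset.mul_sum]
    refine Finset.sum_congr rfl fun S _ => ?_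
    rw [show (8:ℝ) = 2 * 4 by norm_num, mul_pow]; ring
  calc _ ≤ Real.exp Real.pi * (W * ∑ S ∈ SF A, 8 ^ S.card * ‖l S‖ ^ 2) := by
        refine mul_le_mul_of_nonneg_left ?_ (Real.exp_pos _).le
        rw [← e8]
        exact (norm_sum_le _ _).trans (Finset.sum_le_sum hG)
    _ = _ := by rw [hW]; ring

end

section
variable {χ : Eis → Eis → Eis}

lemma Nm_PS_prod (S : Finset PP) : Nm (PS S) = ∏ p ∈ S, Nm p.1 := by
  classical
  induction S using Finset.induction_on with
  | empty => rw [PS_empty, Nm_one, Finset.prod_empty]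
  | insert p S hp ih => rw [Finset.prod_insert hp, ← ih, ← Nm_mul]; unfold PS; rw [Finset.prod_insert hp]

open Classical in
lemma div_bound {ε : ℝ} (hε : 0 < ε) : ∃ D : ℝ, 0 ≤ D ∧ ∀ S : Finset PP, (8:ℝ) ^ S.card ≤ D * Nm (PS S) ^ ε := by
  have hfin : {p : PP | Nm p.1 ≤ 8 ^ (1 / ε)}.Finite := by
    refine Set.Finite.of_finite_image (f := Subtype.val) ?_ Subtype.val_injective.injOn
    refine (ball_finite (8 ^ (1 / ε))).subset ?_
    rintro _ ⟨p, hp, rfl⟩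
    exact hp
  set Bad := hfin.toFinset with hBad
  refine ⟨8 ^ Bad.card, by positivity, fun S => ?_⟩
  have hnn : ∀ p : PP, 1 ≤ Nm p.1 := fun p => one_le_Nm p.2.1.ne_zero
  rw [Nm_PS_prod, ← Real.finsetProd_rpow _ _ (fun p _ => (by linarith [hnn p] : 0 ≤ Nm p.1))]
  calc (8:ℝ) ^ S.card = ∏ p ∈ S, (8:ℝ) := by rw [Finset.prod_const]
    _ ≤ ∏ p ∈ S, ((if p ∈ Bad then 8 else 1) * Nm p.1 ^ ε) := by
        refine Finset.prod_le_prod (fun _ _ => by norm_num) fun p _ => ?_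
        split_ifs with h
        · exact le_mul_of_one_le_right (by norm_num) (Real.one_le_rpow (hnn p) hε.le)
        · rw [one_mul]
          rw [hBad, Set.Finite.mem_toFinset, Set.mem_setOf_eq, not_le] at h
          calc (8:ℝ) = (8 ^ (1 / ε)) ^ ε := by rw [← Real.rpow_mul (by norm_num)]; field_simp; simp
            _ ≤ _ := Real.rpow_le_rpow (by positivity) h.le hε.le
    _ = 8 ^ (S.filter (· ∈ Bad)).card * ∏ p ∈ S, Nm p.1 ^ ε := by
        rw [Finset.prod_mul_distrib, Finset.prod_ite, Finset.prod_const, Finset.prod_const_one, mul_one]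
    _ ≤ _ := by
        refine mul_le_mul_of_nonneg_right ?_ (Finset.prod_nonneg fun p _ => Real.rpow_nonneg (by linarith [hnn p]) _)
        refine pow_le_pow_right₀ (by norm_num) (Finset.card_le_card fun p hp => (Finset.mem_filter.1 hp).2)

lemma log_bound {ε : ℝ} (hε : 0 < ε) : ∃ D : ℝ, 0 ≤ D ∧ ∀ A : ℝ, 1 ≤ A → ((Nat.log 2 ⌊A⌋₊ + 1 : ℕ) : ℝ) ≤ D * A ^ ε := by
  set δ := (2:ℝ) ^ ε - 1 with hδ
  have hδ0 : 0 < δ := by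
    have : (1:ℝ) < 2 ^ ε := Real.one_lt_rpow (by norm_num) hε
    linarith
  refine ⟨1 + 1 / δ, by positivity, fun A hA => ?_⟩
  set m := Nat.log 2 ⌊A⌋₊ with hm
  have h1 : (2:ℝ) ^ m ≤ A := by
    have h2 : 2 ^ m ≤ ⌊A⌋₊ := Nat.pow_log_le_self 2 (Nat.floor_pos.2 hA).ne'
    calc (2:ℝ) ^ m = ((2 ^ m : ℕ) : ℝ) := by push_cast; rfl
      _ ≤ (⌊A⌋₊ : ℝ) := by exact_mod_cast h2
      _ ≤ A := Nat.floor_le (by linarith)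
  have h3 : 1 + (m:ℝ) * δ ≤ A ^ ε := by
    calc 1 + (m:ℝ) * δ ≤ (1 + δ) ^ m := one_add_mul_le_pow (by linarith) m
      _ = ((2:ℝ) ^ m) ^ ε := by
          rw [hδ, add_sub_cancel, ← Real.rpow_natCast, ← Real.rpow_natCast, ← Real.rpow_mul (by norm_num), ← Real.rpow_mul (by norm_num), mul_comm]
      _ ≤ _ := Real.rpow_le_rpow (by positivity) h1 hε.le
  calc ((m + 1 : ℕ) : ℝ) ≤ (1 + 1 / δ) * (1 + m * δ) := by
        push_cast
        have : (1 + 1 / δ) * (1 + m * δ) = m + 1 + m * δ + 1 / δ := by field_simp; ring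
        rw [this]
        have : 0 ≤ m * δ := by positivity
        have : 0 ≤ 1 / δ := by positivity
        linarith
    _ ≤ _ := by gcongr

lemma FF_mono {A A' B B' : ℝ} (hA : 0 ≤ A) (hB : 0 ≤ B) (h : A ≤ A') (h' : B ≤ B') : FF A B ≤ FF A' B' := by
  have : 0 ≤ A' := hA.trans h
  have : 0 ≤ B' := hB.trans h'
  unfold FF
  gcongr

open Classical in
lemma rec1 {ε p : ℝ} (hε : 0 < ε) (hp : 0 ≤ p) : ∃ D : ℝ, 0 ≤ D ∧ ∀ {χ : Eis → Eis → Eis} (_ : IsCubicSymbol χ) (A B Cst : ℝ),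
    1 ≤ A → 1 ≤ B → 0 ≤ Cst →
    (∀ C, 1 ≤ C → C ≤ A → ∀ K0, 0 < K0 → K0 ≤ A * C / B → ∀ K, 1 ≤ K → LS χ C K (Cst * (C * K0) ^ ε * FF C K0 * (max 1 (K / K0)) ^ p)) →
    LS χ A B (D * (1 + Cst) * A ^ (7 * ε) * FF A B) := by
  obtain ⟨D0, hD0, h⟩ := recdy hε hp
  obtain ⟨D8, hD8, h8⟩ := div_bound hε
  obtain ⟨Dl, hDl, hlog⟩ := log_bound hε
  refine ⟨Dl * D0 * D8, by positivity, ?_⟩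
  intro χ hχ A B Cst hA hB hCst hLS l
  have hA0 : 0 < A := by linarith
  have hB0 : 0 < B := by linarith
  have hF := FF_pos hA0.le hB0
  set idx : Finset PP → ℕ := fun S => Nat.log 2 ⌊A / Nm (PS S)⌋₊ with hidx
  set n := Nat.log 2 ⌊A⌋₊ + 1 with hn
  have hidn : ∀ S ∈ SF A, idx S < n := by
    intro S hS
    have : idx S ≤ Nat.log 2 ⌊A⌋₊ := Nat.log_mono_right (Nat.floor_mono (div_le_self hA0.le (Nm_PS_ge S)))
    omega
  set li : ℕ → Finset PP → ℂ := fun i S => if idx S = i then l S else 0 with hli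
  have hlo : ∀ S ∈ SF A, Nm (PS S) ≤ A / 2 ^ idx S ∧ A / 2 ^ idx S / 2 < Nm (PS S) := by
    intro S hS
    have hS1 := Nm_PS_ge S
    have hx : 1 ≤ A / Nm (PS S) := by rw [le_div_iff₀ (by linarith)]; linarith [mem_SF.1 hS]
    have h1 : ((2 ^ idx S : ℕ) : ℝ) ≤ A / Nm (PS S) := by
      have := Nat.pow_log_le_self 2 (Nat.floor_pos.2 hx).ne'
      exact (Nat.cast_le.2 this).trans (Nat.floor_le (by linarith))
    have h2 : A / Nm (PS S) < ((2 ^ (idx S + 1) : ℕ) : ℝ) := by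
      rw [← Nat.floor_lt (by linarith)]
      exact Nat.lt_pow_succ_log_self (by norm_num) _
    push_cast at h1 h2
    rw [le_div_iff₀ (by linarith)] at h1
    rw [div_lt_iff₀ (by linarith), pow_succ] at h2
    constructor
    · rw [le_div_iff₀ (by positivity)]; linarith
    · rw [div_div, div_lt_iff₀ (by positivity)]; linarith
  have hdec : ∀ b, ∑ S ∈ SF A, l S * X χ S b = ∑ i ∈ Finset.range n, ∑ S ∈ SF A, li i S * X χ S b := by
    intro b
    rw [Finset.sum_comm]
    refine Finset.sum_congr rfl fun S hS => ?_
    rw [← Finset.sum_mul]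
    simp only [hli, Finset.sum_ite_eq, Finset.mem_range, hidn S hS, if_true]
  have hdec2 : ∑ S ∈ SF A, ‖l S‖ ^ 2 = ∑ i ∈ Finset.range n, ∑ S ∈ SF A, ‖li i S‖ ^ 2 := by
    rw [Finset.sum_comm]
    refine Finset.sum_congr rfl fun S hS => ?_
    have : ∀ i, ‖li i S‖ ^ 2 = if idx S = i then ‖l S‖ ^ 2 else 0 := fun i => by simp only [hli]; split_ifs <;> simp
    simp only [this, Finset.sum_ite_eq, Finset.mem_range, hidn S hS, if_true]
  have hblock : ∀ i ∈ Finset.range n, ∑ b ∈ Ball B, ‖∑ S ∈ SF A, li i S * X χ S b‖ ^ 2 ≤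
      D0 * (1 + Cst) * A ^ (5 * ε) * FF A B * (D8 * A ^ ε) * ∑ S ∈ SF A, ‖li i S‖ ^ 2 := by
    intro i _
    set Ai := A / 2 ^ i with hAi
    have hAiA : Ai ≤ A := div_le_self hA0.le (one_le_pow₀ (by norm_num))
    have hAi0 : 0 < Ai := by positivity
    have hsub := SF_mono hAiA
    have hz : ∀ S ∈ SF A, S ∉ SF Ai → li i S = 0 := by
      intro S hS hn
      simp only [hli]
      rw [if_neg]
      rintro rfl
      exact hn (mem_SF.2 (hlo S hS).1)
    have e1 : ∀ b, ∑ S ∈ SF A, li i S * X χ S b = ∑ S ∈ SF Ai, li i S * X χ S b := by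
      intro b
      symm
      refine Finset.sum_subset hsub fun S hS hn => ?_
      rw [hz S hS hn, zero_mul]
    simp_rw [e1]
    by_cases h1 : 1 ≤ Ai
    · have := h hχ Ai B Cst (li i) h1 hB hCst (fun C hC hCA K0 hK hK' => hLS C hC (hCA.trans hAiA) K0 hK (hK'.trans (by gcongr))) ?_
      · refine this.trans ?_
        have e2 : ∑ S ∈ SF Ai, 8 ^ S.card * ‖li i S‖ ^ 2 ≤ D8 * A ^ ε * ∑ S ∈ SF A, ‖li i S‖ ^ 2 := by
          rw [Finset.mul_sum]
          refine (Finset.sum_le_sum_of_subset_of_nonneg hsub fun _ _ _ => by positivity).trans ?_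
          refine Finset.sum_le_sum fun S hS => mul_le_mul_of_nonneg_right ((h8 S).trans ?_) (sq_nonneg _)
          have := Nm_PS_ge S
          exact mul_le_mul_of_nonneg_left (Real.rpow_le_rpow (by linarith) (mem_SF.1 hS) hε.le) hD8
        rw [mul_assoc _ (D8 * A ^ ε)]
        have hFm := FF_mono hAi0.le hB0.le hAiA le_rfl
        have := FF_pos hAi0.le hB0
        gcongr
      · intro S hS hne
        have hid : idx S = i := by
          by_contra hn; exact hne (if_neg hn)
        have := (hlo S (hsub hS)).2
        rwa [hid] at this
    · have : SF Ai = ∅ := by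
        refine Finset.eq_empty_of_forall_notMem fun S hS => h1 ((Nm_PS_ge S).trans (mem_SF.1 hS))
      rw [this]
      simp only [Finset.sum_empty, norm_zero]
      have : 0 ≤ D0 * (1 + Cst) * A ^ (5 * ε) * FF A B * (D8 * A ^ ε) * ∑ S ∈ SF A, ‖li i S‖ ^ 2 := by positivity
      simpa using this
  calc ∑ b ∈ Ball B, ‖∑ S ∈ SF A, l S * X χ S b‖ ^ 2
      ≤ ∑ b ∈ Ball B, (n : ℝ) * ∑ i ∈ Finset.range n, ‖∑ S ∈ SF A, li i S * X χ S b‖ ^ 2 := by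
        refine Finset.sum_le_sum fun b _ => ?_
        rw [hdec]
        refine (pow_le_pow_left₀ (norm_nonneg _) (norm_sum_le _ _) 2).trans ?_
        refine (sq_sum_le_card_mul_sum_sq).trans ?_
        rw [Finset.card_range]
    _ = (n : ℝ) * ∑ i ∈ Finset.range n, ∑ b ∈ Ball B, ‖∑ S ∈ SF A, li i S * X χ S b‖ ^ 2 := by
        rw [← Finset.mul_sum, Finset.sum_comm]
    _ ≤ (n : ℝ) * ∑ i ∈ Finset.range n, (D0 * (1 + Cst) * A ^ (5 * ε) * FF A B * (D8 * A ^ ε) * ∑ S ∈ SF A, ‖li i S‖ ^ 2) :=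
        mul_le_mul_of_nonneg_left (Finset.sum_le_sum hblock) (Nat.cast_nonneg _)
    _ = (n : ℝ) * (D0 * (1 + Cst) * A ^ (5 * ε) * FF A B * (D8 * A ^ ε)) * ∑ S ∈ SF A, ‖l S‖ ^ 2 := by
        rw [← Finset.mul_sum, ← hdec2]; ring
    _ ≤ (Dl * A ^ ε) * (D0 * (1 + Cst) * A ^ (5 * ε) * FF A B * (D8 * A ^ ε)) * ∑ S ∈ SF A, ‖l S‖ ^ 2 := by
        have := hlog A hA
        gcongr
    _ = _ := by
        rw [show 7 * ε = ε + 5 * ε + ε by ring, Real.rpow_add hA0, Real.rpow_add hA0]; ring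

end

section
variable {χ : Eis → Eis → Eis}

def RR (η : ℝ) : Prop := ∃ c : ℝ, 0 ≤ c ∧ ∀ ε : ℝ, 0 < ε → ∃ C : ℝ, 0 ≤ C ∧ ∀ {χ : Eis → Eis → Eis} (_ : IsCubicSymbol χ) (A B T : ℝ),
  1 ≤ A → 1 ≤ B → 1 ≤ T → B ≤ T * A ^ η → LS χ A B (C * (A * B * T) ^ ε * T ^ c * FF A B)

def QQ (η : ℝ) : Prop := ∀ ε : ℝ, 0 < ε → ∃ C : ℝ, 0 ≤ C ∧ ∀ {χ : Eis → Eis → Eis} (_ : IsCubicSymbol χ) (A B : ℝ),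
  1 ≤ A → 1 ≤ B → A ≤ B ^ η → LS χ A B (C * (A * B) ^ ε * FF A B)

lemma rpow_le_of_one_le {T a : ℝ} (hT : 1 ≤ T) (ha : a ≤ 1) : T ^ a ≤ T := by
  calc T ^ a ≤ T ^ (1:ℝ) := Real.rpow_le_rpow_of_exponent_le hT ha
    _ = T := Real.rpow_one T

lemma FF_T {A B T : ℝ} (hA : 0 ≤ A) (hB : 0 ≤ B) (hT : 1 ≤ T) : FF A (T * B) ≤ T * FF A B := by
  have hT0 : 0 ≤ T := by linarith
  unfold FF
  rw [show A * (T * B) = T * (A * B) by ring, Real.mul_rpow hT0 hB, Real.mul_rpow hT0 (by positivity)]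
  have h1 := rpow_le_of_one_le hT (show (1:ℝ)/3 ≤ 1 by norm_num)
  have h2 := rpow_le_of_one_le hT (show (2:ℝ)/3 ≤ 1 by norm_num)
  have : A * (T ^ ((1:ℝ)/3) * B ^ ((1:ℝ)/3)) ≤ T * (A * B ^ ((1:ℝ)/3)) := by
    calc _ = T ^ ((1:ℝ)/3) * (A * B ^ ((1:ℝ)/3)) := by ring
      _ ≤ _ := by gcongr
  have : T ^ ((2:ℝ)/3) * (A * B) ^ ((2:ℝ)/3) ≤ T * (A * B) ^ ((2:ℝ)/3) := by gcongr
  linarith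

lemma R_to_Q {η : ℝ} (h0 : 0 ≤ η) (h1 : η ≤ 1) (h : RR η) : QQ (1 / (2 - η)) := by
  obtain ⟨c, hc, h⟩ := h
  intro ε hε
  obtain ⟨Cst, hCst, hR⟩ := h (ε / 7) (by positivity)
  obtain ⟨D, hD, hrec⟩ := rec1 (ε := ε / 7) (p := c + 1 + 2 * (ε / 7)) (by positivity) (by positivity)
  refine ⟨D * (1 + Cst), by positivity, ?_⟩
  intro χ hχ A B hA hB hAB
  have hA0 : 0 < A := by linarith
  have hB0 : 0 < B := by linarith
  have hF := FF_pos hA0.le hB0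
  have hAB' : A ^ (2 - η) ≤ B := by
    calc A ^ (2 - η) ≤ (B ^ (1 / (2 - η))) ^ (2 - η) := Real.rpow_le_rpow hA0.le hAB (by linarith)
      _ = B := by rw [← Real.rpow_mul hB0.le, one_div_mul_cancel (by linarith), Real.rpow_one]
  refine (hrec hχ A B Cst hA hB hCst ?_).mono_Y ?_
  · intro C hC hCA K0 hK0 hK0' K hK
    have hC0 : 0 < C := by linarith
    have hKη : K0 ≤ C ^ η := by
      refine hK0'.trans ?_
      rw [div_le_iff₀ hB0]
      calc A * C = C ^ η * (A * C ^ (1 - η)) := by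
            rw [show C ^ η * (A * C ^ (1 - η)) = A * (C ^ η * C ^ (1 - η)) by ring, ← Real.rpow_add hC0]
            simp
        _ ≤ C ^ η * (A * A ^ (1 - η)) := by
            have : C ^ (1 - η) ≤ A ^ (1 - η) := Real.rpow_le_rpow hC0.le hCA (by linarith)
            gcongr
        _ = C ^ η * A ^ (2 - η) := by
            rw [show (2 - η) = 1 + (1 - η) by ring, Real.rpow_add hA0, Real.rpow_one]
        _ ≤ C ^ η * B := by gcongr
    rcases le_total K K0 with hle | hle
    · have hT : max 1 (K / K0) = 1 := max_eq_left ((div_le_one hK0).2 hle)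
      rw [hT, Real.one_rpow, mul_one]
      have := hR hχ C K0 1 hC (hK.trans hle) le_rfl (by linarith)
      rw [Real.one_rpow, mul_one, mul_one] at this
      exact this.mono_B hle
    · have hT1 : 1 ≤ K / K0 := (one_le_div hK0).2 hle
      rw [max_eq_right hT1]
      set T := K / K0 with hT
      have hKT : K = T * K0 := by rw [hT]; field_simp
      have hT0 : 0 < T := by linarith
      have := hR hχ C K T hC hK hT1 (by rw [hKT]; gcongr)
      refine this.mono_Y ?_
      rw [hKT]
      have e1 : (C * (T * K0) * T) ^ (ε / 7) = (C * K0) ^ (ε / 7) * T ^ (2 * (ε / 7)) := by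
        rw [Real.rpow_mul hT0.le, ← Real.mul_rpow (by positivity) (by positivity)]
        congr 1
        rw [Real.rpow_two]; ring
      have e2 := FF_T hC0.le hK0.le hT1
      rw [e1, Real.rpow_add hT0, Real.rpow_add hT0, Real.rpow_one]
      calc Cst * ((C * K0) ^ (ε / 7) * T ^ (2 * (ε / 7))) * T ^ c * FF C (T * K0)
          ≤ Cst * ((C * K0) ^ (ε / 7) * T ^ (2 * (ε / 7))) * T ^ c * (T * FF C K0) := by gcongr
        _ = _ := by ring
  · have : A ^ (7 * (ε / 7)) ≤ (A * B) ^ ε := by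
      rw [show 7 * (ε / 7) = ε by ring]
      exact Real.rpow_le_rpow hA0.le (le_mul_of_one_le_right hA0.le hB) hε.le
    gcongr

lemma dual_fin {ι κ : Type*} (I : Finset ι) (J : Finset κ) (a : ι → κ → ℂ) {Y : ℝ} (hY : 0 ≤ Y)
    (h : ∀ c : ι → ℂ, ∑ j ∈ J, ‖∑ i ∈ I, c i * a i j‖ ^ 2 ≤ Y * ∑ i ∈ I, ‖c i‖ ^ 2) (d : κ → ℂ) :
    ∑ i ∈ I, ‖∑ j ∈ J, d j * a i j‖ ^ 2 ≤ Y * ∑ j ∈ J, ‖d j‖ ^ 2 := by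
  set e : ι → ℂ := fun i => ∑ j ∈ J, d j * a i j with he
  set Q := ∑ i ∈ I, ‖e i‖ ^ 2 with hQ
  have hQ0 : 0 ≤ Q := Finset.sum_nonneg fun _ _ => sq_nonneg _
  set N := ∑ j ∈ J, ‖d j‖ ^ 2 with hN
  have hN0 : 0 ≤ N := Finset.sum_nonneg fun _ _ => sq_nonneg _
  have h1 := h fun i => (starRingEnd ℂ) (e i)
  simp only [RCLike.norm_conj] at h1
  have h2 : ((Q : ℝ) : ℂ) = ∑ j ∈ J, d j * ∑ i ∈ I, (starRingEnd ℂ) (e i) * a i j := by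
    calc ((Q : ℝ) : ℂ) = ∑ i ∈ I, (starRingEnd ℂ) (e i) * e i := by
          rw [hQ]; push_cast
          refine Finset.sum_congr rfl fun i _ => ?_
          rw [mul_comm, Complex.mul_conj, Complex.normSq_eq_norm_sq]; push_cast; rfl
      _ = ∑ i ∈ I, ∑ j ∈ J, d j * ((starRingEnd ℂ) (e i) * a i j) := by
          refine Finset.sum_congr rfl fun i _ => ?_
          conv_lhs => rw [he]
          simp only
          rw [Finset.mul_sum]
          refine Finset.sum_congr rfl fun j _ => by simp only [he]; ring
      _ = _ := by
          rw [Finset.sum_comm]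
          exact Finset.sum_congr rfl fun j _ => by rw [Finset.mul_sum]
  have h3 : Q ≤ ∑ j ∈ J, ‖d j‖ * ‖∑ i ∈ I, (starRingEnd ℂ) (e i) * a i j‖ := by
    have : ‖((Q : ℝ) : ℂ)‖ = Q := by rw [Complex.norm_real, Real.norm_of_nonneg hQ0]
    rw [← this, h2]
    refine (norm_sum_le _ _).trans (le_of_eq (Finset.sum_congr rfl fun j _ => norm_mul _ _))
  have h4 : Q ^ 2 ≤ N * (Y * Q) := by
    calc Q ^ 2 ≤ (∑ j ∈ J, ‖d j‖ * ‖∑ i ∈ I, (starRingEnd ℂ) (e i) * a i j‖) ^ 2 := pow_le_pow_left₀ hQ0 h3 2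
      _ ≤ N * ∑ j ∈ J, ‖∑ i ∈ I, (starRingEnd ℂ) (e i) * a i j‖ ^ 2 := Finset.sum_mul_sq_le_sq_mul_sq _ _ _
      _ ≤ _ := mul_le_mul_of_nonneg_left h1 hN0
  rcases hQ0.eq_or_lt with hq | hq
  · rw [← hq]; positivity
  · nlinarith

lemma dual_LS (hχ : IsCubicSymbol χ) {X0 A Y : ℝ} (hY : 0 ≤ Y) (h : LS χ X0 A Y) (l : Finset PP → ℂ) :
    ∑ U ∈ SF X0, ‖∑ S ∈ SF A, l S * X χ S (PS U)‖ ^ 2 ≤ Y * ∑ S ∈ SF A, ‖l S‖ ^ 2 := by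
  classical
  have := dual_fin (SF X0) (SF A) (fun U S => X χ U (PS S)) hY (fun c => ?_) l
  · simp_rw [fun U S => X_PS hχ S U]
    exact this
  · refine le_trans ?_ (h c)
    have : ∑ S ∈ SF A, ‖∑ i ∈ SF X0, c i * X χ i (PS S)‖ ^ 2 = ∑ b ∈ (SF A).image PS, ‖∑ i ∈ SF X0, c i * X χ i b‖ ^ 2 := by
      rw [Finset.sum_image fun S _ T _ h => PS_inj h]
    rw [this]
    refine Finset.sum_le_sum_of_subset_of_nonneg ?_ fun _ _ _ => sq_nonneg _
    intro b hb
    obtain ⟨S, hS, rfl⟩ := Finset.mem_image.1 hb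
    exact mem_Ball.2 (mem_SF.1 hS)

lemma sum_inv_Ball {ε : ℝ} (hε : 0 < ε) : ∃ D : ℝ, 0 ≤ D ∧ ∀ B : ℝ, 1 ≤ B → ∑ b ∈ (Ball B).erase 0, (Nm b)⁻¹ ≤ D * B ^ ε := by
  classical
  obtain ⟨D, hD, h⟩ := log_bound hε
  refine ⟨32 * D, by positivity, fun B hB => ?_⟩
  set n := Nat.log 2 ⌊B⌋₊ + 1 with hn
  have hmap : ∀ b ∈ (Ball B).erase 0, Nat.log 2 ⌊Nm b⌋₊ ∈ Finset.range n := by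
    intro b hb
    rw [Finset.mem_range, hn, Nat.lt_succ_iff]
    exact Nat.log_mono_right (Nat.floor_mono (mem_Ball.1 (Finset.mem_of_mem_erase hb)))
  rw [← Finset.sum_fiberwise_of_maps_to hmap]
  have hb : ∀ i ∈ Finset.range n, ∑ b ∈ ((Ball B).erase 0).filter (fun b => Nat.log 2 ⌊Nm b⌋₊ = i), (Nm b)⁻¹ ≤ 32 := by
    intro i _
    have hle : ∀ b ∈ ((Ball B).erase 0).filter (fun b => Nat.log 2 ⌊Nm b⌋₊ = i), (2:ℝ) ^ i ≤ Nm b ∧ Nm b ≤ 2 ^ (i + 1) := by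
      intro b hb
      rw [Finset.mem_filter] at hb
      have h1 := one_le_Nm (Finset.ne_of_mem_erase hb.1)
      constructor
      · have := Nat.pow_log_le_self 2 (Nat.floor_pos.2 h1).ne'
        rw [hb.2] at this
        have h2 : ((2 ^ i : ℕ) : ℝ) ≤ Nm b := (Nat.cast_le.2 this).trans (Nat.floor_le (by linarith))
        push_cast at h2; exact h2
      · have := Nat.lt_pow_succ_log_self (b := 2) (by norm_num) ⌊Nm b⌋₊
        rw [hb.2, Nat.floor_lt (by linarith)] at this
        push_cast at this; exact this.le
    have hc : ((((Ball B).erase 0).filter (fun b => Nat.log 2 ⌊Nm b⌋₊ = i)).card : ℝ) ≤ 16 * 2 ^ (i + 1) := by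
      refine le_trans ?_ (card_Ball (one_le_pow₀ (by norm_num)))
      exact_mod_cast Finset.card_le_card fun b hb => mem_Ball.2 (hle b hb).2
    calc _ ≤ (((Ball B).erase 0).filter (fun b => Nat.log 2 ⌊Nm b⌋₊ = i)).card • ((2:ℝ) ^ i)⁻¹ :=
          Finset.sum_le_card_nsmul _ _ _ fun b hb => inv_anti₀ (by positivity) (hle b hb).1
      _ ≤ 16 * 2 ^ (i + 1) * ((2:ℝ) ^ i)⁻¹ := by rw [nsmul_eq_mul]; gcongr
      _ = 32 := by rw [pow_succ]; field_simp; norm_num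
  refine (Finset.sum_le_card_nsmul _ _ _ hb).trans ?_
  rw [Finset.card_range, nsmul_eq_mul]
  linarith [h B hB]

end

section
variable {χ : Eis → Eis → Eis}

open Classical in
lemma PS_insert {p : PP} {S : Finset PP} (h : p ∉ S) : PS (insert p S) = p.1 * PS S := by
  unfold PS; rw [Finset.prod_insert h]

open Classical in
lemma PS_erase {p : PP} {S : Finset PP} (h : p ∈ S) : p.1 * PS (S.erase p) = PS S := by
  unfold PS; rw [Finset.mul_prod_erase S (fun q => q.1) h]

open Classical in
lemma multiset_decomp (s : Multiset PP) : ∃ (l : Eis) (V U : Finset PP), (s.map Subtype.val).prod = l ^ 3 * PS V * PS U ^ 2 := by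
  induction s using Multiset.induction_on with
  | empty => exact ⟨1, ∅, ∅, by simp [PS_empty]⟩
  | cons p s ih =>
    obtain ⟨l, V, U, h⟩ := ih
    rw [Multiset.map_cons, Multiset.prod_cons, h]
    by_cases hU : p ∈ U
    · refine ⟨l * p.1, V, U.erase p, ?_⟩
      rw [← PS_erase hU]; ring
    · by_cases hV : p ∈ V
      · refine ⟨l, V.erase p, insert p U, ?_⟩
        rw [PS_insert hU, ← PS_erase hV]; ring
      · refine ⟨l, insert p V, U, ?_⟩
        rw [PS_insert hV]; ring

lemma Nm_lam : Nm lam = 3 := by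
  have h : (Nm lam) ^ 2 = 9 := by
    rw [← Nm_pow, lam_sq]
    rw [Nm_neg]
    unfold Nm
    rw [show ((3 : Eis) : ℂ) = 3 from rfl]
    norm_num [Complex.normSq_apply]
  have := Nm_nonneg lam
  nlinarith

lemma decomp {b : Eis} (hb : b ≠ 0) : ∃ (w l : Eis) (V U : Finset PP), Nm w ≤ 9 ∧ b = w * l ^ 3 * PS V * PS U ^ 2 := by
  have hlu : ¬ IsUnit lam := fun h => by
    have := Nm_unit h; rw [Nm_lam] at this; norm_num at this
  obtain ⟨c, hbc, hc⟩ := FiniteMultiplicity.exists_eq_pow_mul_and_not_dvd (FiniteMultiplicity.of_not_isUnit hlu hb)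
  set k := multiplicity lam b
  obtain ⟨u, hu⟩ := exists_primary hc
  have hc0 : c ≠ 0 := by rintro rfl; exact hc (dvd_zero _)
  obtain ⟨s, hs⟩ := exists_multiset (a := u * c) (mul_ne_zero u.ne_zero hc0) hu
  obtain ⟨l, V, U, h⟩ := multiset_decomp s
  refine ⟨((u⁻¹ : Eisˣ) : Eis) * lam ^ (k % 3), lam ^ (k / 3) * l, V, U, ?_, ?_⟩
  · rw [Nm_mul, Nm_unit (u⁻¹).isUnit, one_mul, Nm_pow, Nm_lam]
    have : k % 3 ≤ 2 := by omega
    calc (3:ℝ) ^ (k % 3) ≤ 3 ^ 2 := pow_le_pow_right₀ (by norm_num) this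
      _ = 9 := by norm_num
  · have h1 : c = ((u⁻¹ : Eisˣ) : Eis) * (l ^ 3 * PS V * PS U ^ 2) := by
      rw [← h, ← hs, ← mul_assoc, Units.inv_mul, one_mul]
    have h2 : lam ^ k = lam ^ (k % 3) * (lam ^ (k / 3)) ^ 3 := by
      rw [← pow_mul, ← pow_add]; congr 1; omega
    rw [hbc, h1, h2]; ring

lemma X_conj (hχ : IsCubicSymbol χ) (S : Finset PP) (b : Eis) : X χ S (b ^ 2) = (starRingEnd ℂ) (X χ S b) := by
  rw [pow_two, X_mul hχ]
  unfold X
  rw [map_prod, ← Finset.prod_mul_distrib]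
  refine Finset.prod_congr rfl fun p _ => ?_
  rw [conj_V3 (hχ.mem p b)]; push_cast; ring

lemma sum_le_image {ι κ : Type*} [DecidableEq ι] (s : Finset ι) (t : Finset κ) (f : κ → ι) (F : ι → ℝ) (hF : ∀ i, 0 ≤ F i)
    (h : ∀ i ∈ s, ∃ k ∈ t, f k = i) : ∑ i ∈ s, F i ≤ ∑ k ∈ t, F (f k) := by
  calc ∑ i ∈ s, F i ≤ ∑ i ∈ s, ∑ k ∈ t.filter (fun k => f k = i), F (f k) := by
        refine Finset.sum_le_sum fun i hi => ?_
        obtain ⟨k, hk, rfl⟩ := h i hi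
        exact Finset.single_le_sum (f := fun k => F (f k)) (fun _ _ => hF _) (Finset.mem_filter.2 ⟨hk, rfl⟩)
    _ ≤ ∑ k ∈ t, F (f k) := by
        rw [Finset.sum_fiberwise_eq_sum_filter]
        exact Finset.sum_le_sum_of_subset_of_nonneg (Finset.filter_subset _ _) fun _ _ _ => hF _

lemma FF_num {A B T η r : ℝ} (hA : 1 ≤ A) (hB : 1 ≤ B) (hT : 1 ≤ T) (h0 : 0 < η) (h1 : η ≤ 1) (hBT : B ≤ T * A ^ η)
    (hr : 1 ≤ r) (hrB : r ^ 3 ≤ B) : FF (B / r ^ 2) (A * T ^ (1 / η)) ≤ 2 * (T ^ (1 / η + 1 / 3) * FF A B) * r⁻¹ := by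
  have hA0 : 0 < A := by linarith
  have hB0 : 0 < B := by linarith
  have hT0 : 0 < T := by linarith
  have hr0 : 0 < r := by linarith
  rw [Real.rpow_add hT0]
  set q := T ^ (1 / η) with hq
  have hq1 : 1 ≤ q := Real.one_le_rpow hT (by positivity)
  have hq0 : 0 < q := by linarith
  set τ := T ^ ((1:ℝ)/3) with hτ
  have hτ1 : 1 ≤ τ := Real.one_le_rpow hT (by positivity)
  have hr2 : (r ^ 2)⁻¹ ≤ r⁻¹ := inv_anti₀ hr0 (by nlinarith)
  have hrB' : r ≤ B ^ ((1:ℝ)/3) := by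
    calc r = (r ^ 3) ^ ((1:ℝ)/3) := by rw [← Real.rpow_natCast, ← Real.rpow_mul hr0.le]; norm_num
      _ ≤ _ := Real.rpow_le_rpow (by positivity) hrB (by norm_num)
  have hBT' : B ^ ((1:ℝ)/3) ≤ τ * A ^ ((1:ℝ)/3) := by
    rw [hτ, ← Real.mul_rpow hT0.le hA0.le]
    refine Real.rpow_le_rpow hB0.le (hBT.trans ?_) (by norm_num)
    have := rpow_le_of_one_le hA h1
    gcongr
  have hq3 : q ^ ((1:ℝ)/3) ≤ q := rpow_le_of_one_le hq1 (by norm_num)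
  have hq23 : q ^ ((2:ℝ)/3) ≤ q := rpow_le_of_one_le hq1 (by norm_num)
  have hB1 : B = B ^ ((1:ℝ)/3) * B ^ ((2:ℝ)/3) := by rw [← Real.rpow_add hB0]; norm_num
  have hA2 : A ^ ((2:ℝ)/3) = A ^ ((1:ℝ)/3) * A ^ ((1:ℝ)/3) := by rw [← Real.rpow_add hA0]; norm_num
  set P := (A * B) ^ ((2:ℝ)/3) with hP
  have hP0 : 0 < P := by positivity
  have t1 : B / r ^ 2 * (A * q) ^ ((1:ℝ)/3) ≤ q * τ * P * r⁻¹ := by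
    rw [Real.mul_rpow hA0.le hq0.le, div_eq_mul_inv]
    calc B * (r ^ 2)⁻¹ * (A ^ ((1:ℝ)/3) * q ^ ((1:ℝ)/3)) ≤ B * r⁻¹ * (A ^ ((1:ℝ)/3) * q) := by gcongr
      _ = B ^ ((1:ℝ)/3) * (B ^ ((2:ℝ)/3) * r⁻¹ * (A ^ ((1:ℝ)/3) * q)) := by nth_rewrite 1 [hB1]; ring
      _ ≤ (τ * A ^ ((1:ℝ)/3)) * (B ^ ((2:ℝ)/3) * r⁻¹ * (A ^ ((1:ℝ)/3) * q)) := by gcongr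
      _ = _ := by rw [hP, Real.mul_rpow hA0.le hB0.le, hA2]; ring
  have t2 : A * q ≤ q * τ * (A * B ^ ((1:ℝ)/3)) * r⁻¹ := by
    rw [le_mul_inv_iff₀ hr0]
    calc A * q * r ≤ A * q * B ^ ((1:ℝ)/3) := by gcongr
      _ = q * 1 * (A * B ^ ((1:ℝ)/3)) := by ring
      _ ≤ _ := by gcongr
  have t3 : (B / r ^ 2 * (A * q)) ^ ((2:ℝ)/3) ≤ q * τ * P * r⁻¹ := by
    have e : B / r ^ 2 * (A * q) = (A * B) * q * (r ^ 2)⁻¹ := by rw [div_eq_mul_inv]; ring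
    have e2 : ((r ^ 2)⁻¹) ^ ((2:ℝ)/3) ≤ r⁻¹ := by
      rw [Real.inv_rpow (by positivity)]
      refine inv_anti₀ hr0 ?_
      rw [← Real.rpow_natCast, ← Real.rpow_mul hr0.le]
      nth_rewrite 1 [← Real.rpow_one r]
      exact Real.rpow_le_rpow_of_exponent_le hr (by norm_num)
    rw [e, Real.mul_rpow (by positivity) (by positivity), Real.mul_rpow (by positivity) hq0.le]
    calc P * q ^ ((2:ℝ)/3) * ((r ^ 2)⁻¹) ^ ((2:ℝ)/3) ≤ P * q * r⁻¹ := by gcongr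
      _ = q * 1 * P * r⁻¹ := by ring
      _ ≤ _ := by gcongr
  unfold FF
  have t4 : 0 ≤ q * τ * r⁻¹ * (A * B ^ ((1:ℝ)/3) + 2 * B) := by positivity
  have e5 : 2 * (q * τ * (A * B ^ ((1:ℝ)/3) + B + P)) * r⁻¹ = q * τ * P * r⁻¹ + q * τ * (A * B ^ ((1:ℝ)/3)) * r⁻¹ + q * τ * P * r⁻¹ +
      q * τ * r⁻¹ * (A * B ^ ((1:ℝ)/3) + 2 * B) := by ring
  rw [e5]
  linarith

end

section
variable {χ : Eis → Eis → Eis}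

lemma block_bound (hχ : IsCubicSymbol χ) {X0 A Y : ℝ} (hY : 0 ≤ Y) (h : LS χ X0 A Y) (l : Finset PP → ℂ) (g : Eis) :
    ∑ U ∈ SF X0, ‖∑ S ∈ SF A, l S * X χ S (g * PS U)‖ ^ 2 ≤ Y * ∑ S ∈ SF A, ‖l S‖ ^ 2 ∧
    ∑ U ∈ SF X0, ‖∑ S ∈ SF A, l S * X χ S (g * PS U ^ 2)‖ ^ 2 ≤ Y * ∑ S ∈ SF A, ‖l S‖ ^ 2 := by
  have hle : ∑ S ∈ SF A, ‖l S * X χ S g‖ ^ 2 ≤ ∑ S ∈ SF A, ‖l S‖ ^ 2 := by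
    refine Finset.sum_le_sum fun S _ => pow_le_pow_left₀ (norm_nonneg _) ?_ 2
    rw [norm_mul]
    exact mul_le_of_le_one_right (norm_nonneg _) (X_norm_le hχ _ _)
  constructor
  · refine le_trans (le_of_eq ?_) ((dual_LS hχ hY h fun S => l S * X χ S g).trans (mul_le_mul_of_nonneg_left hle hY))
    refine Finset.sum_congr rfl fun U _ => ?_
    congr 2
    refine Finset.sum_congr rfl fun S _ => ?_
    rw [X_mul hχ]; ring
  · have := dual_LS hχ hY h fun S => (starRingEnd ℂ) (l S * X χ S g)
    simp only [RCLike.norm_conj] at this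
    refine le_trans (le_of_eq ?_) (this.trans (mul_le_mul_of_nonneg_left hle hY))
    refine Finset.sum_congr rfl fun U _ => ?_
    congr 1
    rw [← RCLike.norm_conj, map_sum]
    congr 1
    refine Finset.sum_congr rfl fun S _ => ?_
    rw [X_mul hχ, X_conj hχ, map_mul, map_mul, map_mul, Complex.conj_conj]; ring

def dr (d : Eis × Finset PP × Eis) : ℝ := Nm (PS d.2.1) * Nm d.2.2

open Classical in
def dset (B : ℝ) : Finset (Eis × Finset PP × Eis) := (Ball 9 ×ˢ SF B ×ˢ (Ball B).erase 0).filter fun d => dr d ^ 3 ≤ B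

lemma mem_dset {B : ℝ} {d : Eis × Finset PP × Eis} : d ∈ dset B ↔ (Nm d.1 ≤ 9 ∧ Nm (PS d.2.1) ≤ B ∧ d.2.2 ≠ 0 ∧ Nm d.2.2 ≤ B) ∧ dr d ^ 3 ≤ B := by
  rw [dset, Finset.mem_filter, Finset.mem_product, Finset.mem_product, mem_Ball, mem_SF, Finset.mem_erase, mem_Ball]

def dmap (x : (_ : Eis × Finset PP × Eis) × Finset PP × Bool) : Eis :=
  if x.2.2 then (x.1.1 * x.1.2.2 ^ 3 * PS x.1.2.1 ^ 2) * PS x.2.1 else (x.1.1 * x.1.2.2 ^ 3 * PS x.1.2.1) * PS x.2.1 ^ 2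

open Classical in
lemma dcover {B : ℝ} (b : Eis) (hb : b ∈ (Ball B).erase 0) :
    ∃ k ∈ (dset B).sigma (fun d => SF (B / dr d ^ 2) ×ˢ (Finset.univ : Finset Bool)), dmap k = b := by
  rw [Finset.mem_erase, mem_Ball] at hb
  obtain ⟨hb0, hbB⟩ := hb
  obtain ⟨w, l, V, U, hw, hbe⟩ := decomp hb0
  have hw0 : w ≠ 0 := by rintro rfl; apply hb0; rw [hbe]; ring
  have hl0 : l ≠ 0 := by rintro rfl; apply hb0; rw [hbe]; ring
  have w1 := one_le_Nm hw0
  have l1 := one_le_Nm hl0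
  have V1 := Nm_PS_ge V
  have U1 := Nm_PS_ge U
  have hN : Nm w * Nm l ^ 3 * Nm (PS V) * Nm (PS U) ^ 2 ≤ B := by
    rw [← Nm_pow, ← Nm_pow, ← Nm_mul, ← Nm_mul, ← Nm_mul, ← hbe]; exact hbB
  set w' := Nm w
  set l' := Nm l
  set V' := Nm (PS V)
  set U' := Nm (PS U)
  have hN' : l' ^ 3 * V' * U' ^ 2 ≤ B := by
    refine le_trans ?_ hN
    have : 0 ≤ l' ^ 3 * V' * U' ^ 2 := by positivity
    nlinarith
  have hl3 : l' ≤ l' ^ 3 := le_self_pow₀ l1 (by norm_num)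
  have hl23 : l' ^ 2 ≤ l' ^ 3 := pow_le_pow_right₀ l1 (by norm_num)
  have hU2 : U' ≤ U' ^ 2 := le_self_pow₀ U1 (by norm_num)
  have hlB : l' ≤ B := by
    calc l' = l' * 1 * 1 := by ring
      _ ≤ l' ^ 3 * V' * U' ^ 2 := by gcongr; nlinarith
      _ ≤ B := hN'
  have hVB : V' ≤ B := by
    calc V' = 1 * V' * 1 := by ring
      _ ≤ l' ^ 3 * V' * U' ^ 2 := by gcongr; nlinarith; nlinarith
      _ ≤ B := hN'
  have hUB : U' ≤ B := by
    calc U' = 1 * 1 * U' := by ring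
      _ ≤ l' ^ 3 * V' * U' ^ 2 := by gcongr; nlinarith
      _ ≤ B := hN'
  rcases le_total V' U' with hVU | hVU
  · refine ⟨⟨(w, V, l), U, false⟩, ?_, ?_⟩
    · simp only [Finset.mem_sigma, Finset.mem_product, mem_dset, mem_SF, Finset.mem_univ, and_true, dr]
      refine ⟨⟨⟨hw, hVB, hl0, hlB⟩, ?_⟩, ?_⟩
      · calc (V' * l') ^ 3 = l' ^ 3 * V' * V' ^ 2 := by ring
          _ ≤ l' ^ 3 * V' * U' ^ 2 := by gcongr
          _ ≤ B := hN'
      · rw [le_div_iff₀ (by positivity)]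
        calc U' * (V' * l') ^ 2 = l' ^ 2 * V' * (U' * V') := by ring
          _ ≤ l' ^ 3 * V' * (U' * U') := by gcongr
          _ = l' ^ 3 * V' * U' ^ 2 := by ring
          _ ≤ B := hN'
    · simp only [dmap, Bool.false_eq_true, if_false]; exact hbe.symm
  · refine ⟨⟨(w, U, l), V, true⟩, ?_, ?_⟩
    · simp only [Finset.mem_sigma, Finset.mem_product, mem_dset, mem_SF, Finset.mem_univ, and_true, dr]
      refine ⟨⟨⟨hw, hUB, hl0, hlB⟩, ?_⟩, ?_⟩
      · calc (U' * l') ^ 3 = l' ^ 3 * U' * U' ^ 2 := by ring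
          _ ≤ l' ^ 3 * V' * U' ^ 2 := by gcongr
          _ ≤ B := hN'
      · rw [le_div_iff₀ (by positivity)]
        calc V' * (U' * l') ^ 2 = l' ^ 2 * V' * U' ^ 2 := by ring
          _ ≤ l' ^ 3 * V' * U' ^ 2 := by gcongr
          _ ≤ B := hN'
    · simp only [dmap, if_true]; rw [hbe]; ring

open Classical in
lemma dsum {ε : ℝ} (hε : 0 < ε) : ∃ D : ℝ, 0 ≤ D ∧ ∀ B : ℝ, 1 ≤ B → ∑ d ∈ dset B, (dr d)⁻¹ ≤ D * B ^ (2 * ε) := by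
  obtain ⟨D, hD, h⟩ := sum_inv_Ball hε
  refine ⟨(Ball 9).card * (D * D), by positivity, fun B hB => ?_⟩
  have hB0 : 0 < B := by linarith
  have h1 := h B hB
  have h2 : ∑ V ∈ SF B, (Nm (PS V))⁻¹ ≤ D * B ^ ε := by
    refine le_trans ?_ h1
    rw [← Finset.sum_image (f := fun b => (Nm b)⁻¹) (g := PS) fun S _ T _ h => PS_inj h]
    refine Finset.sum_le_sum_of_subset_of_nonneg ?_ fun b _ _ => inv_nonneg.2 (Nm_nonneg b)
    intro b hb
    obtain ⟨S, hS, rfl⟩ := Finset.mem_image.1 hb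
    exact Finset.mem_erase.2 ⟨PS_ne_zero S, mem_Ball.2 (mem_SF.1 hS)⟩
  have hnn : ∀ d, 0 ≤ (dr d)⁻¹ := fun d => inv_nonneg.2 (mul_nonneg (Nm_nonneg _) (Nm_nonneg _))
  calc ∑ d ∈ dset B, (dr d)⁻¹ ≤ ∑ d ∈ Ball 9 ×ˢ SF B ×ˢ (Ball B).erase 0, (dr d)⁻¹ :=
        Finset.sum_le_sum_of_subset_of_nonneg (Finset.filter_subset _ _) fun d _ _ => hnn d
    _ = (Ball 9).card * ((∑ V ∈ SF B, (Nm (PS V))⁻¹) * ∑ b ∈ (Ball B).erase 0, (Nm b)⁻¹) := by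
        rw [Finset.sum_product, ← nsmul_eq_mul, ← Finset.sum_const, Finset.sum_mul_sum]
        refine Finset.sum_congr rfl fun w _ => ?_
        rw [Finset.sum_product]
        refine Finset.sum_congr rfl fun V _ => Finset.sum_congr rfl fun b _ => ?_
        simp only [dr]; rw [mul_inv]
    _ ≤ (Ball 9).card * ((D * B ^ ε) * (D * B ^ ε)) := by
        have : 0 ≤ ∑ b ∈ (Ball B).erase 0, (Nm b)⁻¹ := Finset.sum_nonneg fun b _ => inv_nonneg.2 (Nm_nonneg b)
        gcongr
    _ = _ := by rw [two_mul, Real.rpow_add hB0]; ring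

open Classical in
lemma Q_to_R {η : ℝ} (h0 : 0 < η) (h1 : η ≤ 1) (h : QQ η) : RR η := by
  refine ⟨1 / η + 1 / 3, by positivity, fun ε hε => ?_⟩
  have hε' : 0 < ε * η / 3 := by positivity
  obtain ⟨C, hC, hQ⟩ := h _ hε'
  obtain ⟨D, hD, hDs⟩ := dsum hε'
  refine ⟨1 + 4 * C * D, by positivity, ?_⟩
  intro χ hχ A B T hA hB hT hBT l
  have hA0 : 0 < A := by linarith
  have hB0 : 0 < B := by linarith
  have hT0 : 0 < T := by linarith
  have hF1 : 1 ≤ FF A B := hB.trans (FF_ge hA0.le hB0.le)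
  set N := ∑ S ∈ SF A, ‖l S‖ ^ 2 with hN
  have hN0 : 0 ≤ N := Finset.sum_nonneg fun _ _ => sq_nonneg _
  set F : Eis → ℝ := fun b => ‖∑ S ∈ SF A, l S * X χ S b‖ ^ 2 with hF
  set q := T ^ (1 / η) with hq
  have hq1 : 1 ≤ q := Real.one_le_rpow hT (by positivity)
  have hq0 : 0 < q := by linarith
  set Tc := T ^ (1 / η + 1 / 3) with hTc
  have hTc1 : 1 ≤ Tc := Real.one_le_rpow hT (by positivity)
  set Y := C * (B * (A * q)) ^ (ε * η / 3) * (2 * (Tc * FF A B)) with hY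
  have hY0 : 0 ≤ Y := by positivity
  have hLSd : ∀ d ∈ dset B, LS χ (B / dr d ^ 2) A (Y * (dr d)⁻¹) := by
    intro d hd
    rw [dset, Finset.mem_filter, Finset.mem_product, Finset.mem_product] at hd
    have hl0 : d.2.2 ≠ 0 := Finset.ne_of_mem_erase hd.1.2.2
    have hr1 : 1 ≤ dr d := by
      have := one_le_Nm hl0
      have := Nm_PS_ge d.2.1
      unfold dr; nlinarith
    have hr0 : 0 < dr d := by linarith
    by_cases hX : 1 ≤ B / dr d ^ 2
    · have hXB : B / dr d ^ 2 ≤ B := div_le_self hB0.le (one_le_pow₀ hr1)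
      have hle : B ≤ (A * q) ^ η := by
        rw [Real.mul_rpow hA0.le hq0.le, hq, ← Real.rpow_mul hT0.le, one_div_mul_cancel h0.ne', Real.rpow_one]
        linarith
      have := hQ hχ (B / dr d ^ 2) (A * q) hX (by nlinarith) (hXB.trans hle)
      refine (this.mono_B (le_mul_of_one_le_right hA0.le hq1)).mono_Y ?_
      have hn := FF_num hA hB hT h0 h1 hBT hr1 hd.2
      rw [hY, mul_assoc (C * _)]
      have hFn := FF_nonneg (A := B / dr d ^ 2) (B := A * q) (by positivity) (by positivity)
      gcongr
    · have : SF (B / dr d ^ 2) = ∅ := Finset.eq_empty_of_forall_notMem fun S hS => hX ((Nm_PS_ge S).trans (mem_SF.1 hS))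
      intro l'
      rw [this]; simp
  have hF0 : F 0 ≤ N := by
    have e : ∑ S ∈ SF A, l S * X χ S 0 = l ∅ := by
      rw [Finset.sum_eq_single ∅]
      · rw [X_empty, mul_one]
      · intro S _ hS
        rw [X_zero hχ (Finset.nonempty_iff_ne_empty.2 hS), mul_zero]
      · intro hn
        exfalso; apply hn
        rw [mem_SF, PS_empty, Nm_one]; exact hA
    simp only [hF, e]
    refine Finset.single_le_sum (f := fun S => ‖l S‖ ^ 2) (fun _ _ => sq_nonneg _) ?_
    rw [mem_SF, PS_empty, Nm_one]; exact hA
  have hFe : ∑ b ∈ (Ball B).erase 0, F b ≤ 2 * Y * N * (D * B ^ (2 * (ε * η / 3))) := by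
    refine (sum_le_image _ _ dmap F (fun _ => sq_nonneg _) dcover).trans ?_
    rw [Finset.sum_sigma]
    refine le_trans ?_ (mul_le_mul_of_nonneg_left (hDs B hB) (by positivity))
    rw [Finset.mul_sum]
    refine Finset.sum_le_sum fun d hd => ?_
    rw [Finset.sum_product_right]
    have hr0 : 0 ≤ (dr d)⁻¹ := inv_nonneg.2 (mul_nonneg (Nm_nonneg _) (Nm_nonneg _))
    have b1 := (block_bound hχ (by positivity) (hLSd d hd) l (d.1 * d.2.2 ^ 3 * PS d.2.1 ^ 2)).1
    have b2 := (block_bound hχ (by positivity) (hLSd d hd) l (d.1 * d.2.2 ^ 3 * PS d.2.1)).2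
    rw [Fintype.sum_bool]
    simp only [dmap, hF, if_true, Bool.false_eq_true, if_false]
    linarith
  have hz : (0 : Eis) ∈ Ball B := mem_Ball.2 (by rw [Nm_zero]; exact hB0.le)
  change ∑ b ∈ Ball B, F b ≤ _
  rw [← Finset.add_sum_erase _ _ hz]
  refine (add_le_add hF0 hFe).trans ?_
  have hE : (B * (A * q)) ^ (ε * η / 3) * B ^ (2 * (ε * η / 3)) ≤ (A * B * T) ^ ε := by
    have e1 : (B * (A * q)) ^ (ε * η / 3) = (A * B) ^ (ε * η / 3) * T ^ (ε / 3) := by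
      rw [show B * (A * q) = (A * B) * q by ring, Real.mul_rpow (by positivity) hq0.le, hq, ← Real.rpow_mul hT0.le]
      congr 2; field_simp
    have e2 : B ^ (2 * (ε * η / 3)) ≤ (A * B) ^ (2 * (ε * η / 3)) := by
      refine Real.rpow_le_rpow hB0.le (by nlinarith) (by positivity)
    have hAB1 : 1 ≤ A * B := by nlinarith
    rw [e1, Real.mul_rpow (by positivity) hT0.le]
    calc (A * B) ^ (ε * η / 3) * T ^ (ε / 3) * B ^ (2 * (ε * η / 3)) ≤ (A * B) ^ (ε * η / 3) * T ^ (ε / 3) * (A * B) ^ (2 * (ε * η / 3)) := by gcongr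
      _ = (A * B) ^ (ε * η) * T ^ (ε / 3) := by
          rw [show ε * η = ε * η / 3 + 2 * (ε * η / 3) by ring, Real.rpow_add (by positivity)]; ring_nf
      _ ≤ _ := by
          have := Real.rpow_le_rpow_of_exponent_le hAB1 (show ε * η ≤ ε by nlinarith)
          have := Real.rpow_le_rpow_of_exponent_le hT (show ε / 3 ≤ ε by linarith)
          gcongr
  have hE1 : 1 ≤ (A * B * T) ^ ε := Real.one_le_rpow (by nlinarith [mul_nonneg hA0.le hB0.le, one_le_mul_of_one_le_of_one_le hA hB]) hε.le
  calc N + 2 * Y * N * (D * B ^ (2 * (ε * η / 3)))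
      = N + 4 * C * D * ((B * (A * q)) ^ (ε * η / 3) * B ^ (2 * (ε * η / 3))) * (Tc * FF A B) * N := by rw [hY]; ring
    _ ≤ (A * B * T) ^ ε * Tc * FF A B * N + 4 * C * D * (A * B * T) ^ ε * (Tc * FF A B) * N := by
        have : 1 ≤ (A * B * T) ^ ε * Tc * FF A B := one_le_mul_of_one_le_of_one_le (one_le_mul_of_one_le_of_one_le hE1 hTc1) hF1
        refine add_le_add (le_mul_of_one_le_left hN0 this) ?_
        gcongr
    _ = _ := by ring

end

section
variable {χ : Eis → Eis → Eis}

lemma card_SF {A : ℝ} (hA : 1 ≤ A) : ((SF A).card : ℝ) ≤ 16 * A := by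
  classical
  refine le_trans ?_ (card_Ball hA)
  rw [← Finset.card_image_of_injOn (s := SF A) (f := PS) fun S _ T _ h => PS_inj h]
  exact_mod_cast Finset.card_le_card fun b hb => by
    obtain ⟨S, hS, rfl⟩ := Finset.mem_image.1 hb
    exact mem_Ball.2 (mem_SF.1 hS)

lemma RR_zero : RR 0 := by
  refine ⟨1, zero_le_one, fun ε hε => ⟨256, by norm_num, ?_⟩⟩
  intro χ hχ A B T hA hB hT hBT l
  rw [Real.rpow_zero, mul_one] at hBT
  have hA0 : 0 < A := by linarith
  have hB0 : 0 < B := by linarith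
  have hT0 : 0 < T := by linarith
  set N := ∑ S ∈ SF A, ‖l S‖ ^ 2 with hN
  have hN0 : 0 ≤ N := Finset.sum_nonneg fun _ _ => sq_nonneg _
  have h1 : ∀ b ∈ Ball B, ‖∑ S ∈ SF A, l S * X χ S b‖ ^ 2 ≤ 16 * A * N := by
    intro b _
    calc ‖∑ S ∈ SF A, l S * X χ S b‖ ^ 2 ≤ (∑ S ∈ SF A, ‖l S‖) ^ 2 := by
          refine pow_le_pow_left₀ (norm_nonneg _) ((norm_sum_le _ _).trans (Finset.sum_le_sum fun S _ => ?_)) 2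
          rw [norm_mul]; exact mul_le_of_le_one_right (norm_nonneg _) (X_norm_le hχ _ _)
      _ ≤ (SF A).card * N := sq_sum_le_card_mul_sum_sq
      _ ≤ _ := mul_le_mul_of_nonneg_right (card_SF hA) hN0
  refine (Finset.sum_le_card_nsmul _ _ _ h1).trans ?_
  rw [nsmul_eq_mul, Real.rpow_one]
  have hE1 : 1 ≤ (A * B * T) ^ ε := Real.one_le_rpow (one_le_mul_of_one_le_of_one_le (one_le_mul_of_one_le_of_one_le hA hB) hT) hε.le
  have hF : A ≤ FF A B := by
    have : 1 ≤ B ^ ((1:ℝ)/3) := Real.one_le_rpow hB (by norm_num)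
    have : 0 ≤ (A * B) ^ ((2:ℝ)/3) := by positivity
    unfold FF; nlinarith
  calc ((Ball B).card : ℝ) * (16 * A * N) ≤ (16 * B) * (16 * A * N) := mul_le_mul_of_nonneg_right (card_Ball hB) (by positivity)
    _ = 256 * 1 * B * A * N := by ring
    _ ≤ 256 * (A * B * T) ^ ε * T * FF A B * N := by gcongr

lemma RR_step (k : ℕ) : RR ((k:ℝ) / (k + 1)) ∧ QQ ((k + 1 : ℝ) / (k + 2)) := by
  have key : ∀ k : ℕ, RR ((k:ℝ) / (k + 1)) → QQ ((k + 1 : ℝ) / (k + 2)) := by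
    intro k hk
    have := R_to_Q (by positivity) (by rw [div_le_one (by positivity)]; linarith) hk
    convert this using 1
    have : (k:ℝ) + 1 ≠ 0 := by positivity
    have h2 : (2 - (k:ℝ) / (k + 1)) = (k + 2) / (k + 1) := by field_simp; ring
    rw [h2, one_div_div]
  have hR : RR ((k:ℝ) / (k + 1)) := by
    induction k with
    | zero => simpa using RR_zero
    | succ k ih =>
      have := Q_to_R (by positivity) (by rw [div_le_one (by positivity)]; linarith) (key k ih)
      convert this using 1
      push_cast; ring
  exact ⟨hR, key k hR⟩

lemma QQ_one : QQ 1 := by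
  intro ε hε
  obtain ⟨k, hk⟩ := exists_nat_gt (2 / ε)
  set a : ℝ := k + 1 with ha
  have ha1 : 1 ≤ a := by rw [ha]; linarith [(Nat.cast_nonneg k : (0:ℝ) ≤ k)]
  have ha0 : 0 < a := by linarith
  have hae : 1 / a ≤ ε / 2 := by
    rw [div_le_div_iff₀ ha0 (by norm_num)]
    rw [div_lt_iff₀ hε] at hk
    rw [ha]; nlinarith
  obtain ⟨C, hC, h⟩ := (RR_step k).2 (ε / 4) (by positivity)
  refine ⟨C, hC, ?_⟩
  intro χ hχ A B hA hB hAB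
  rw [Real.rpow_one] at hAB
  have hA0 : 0 < A := by linarith
  have hB0 : 0 < B := by linarith
  set T := A ^ (1 / a) with hT
  have hT1 : 1 ≤ T := Real.one_le_rpow hA (by positivity)
  have hT0 : 0 < T := by linarith
  have hTA : T ≤ A := rpow_le_of_one_le hA (by rw [div_le_one ha0]; exact ha1)
  have hAB1 : 1 ≤ A * B := one_le_mul_of_one_le_of_one_le hA hB
  have h2 : A ≤ (T * B) ^ ((k + 1 : ℝ) / (k + 2)) := by
    have e : (k:ℝ) + 2 = a + 1 := by rw [ha]; ring
    rw [e]
    calc A = (A ^ (1 / a) * A) ^ (a / (a + 1)) := by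
          nth_rewrite 3 [← Real.rpow_one A]
          rw [← Real.rpow_add hA0, ← Real.rpow_mul hA0.le]
          have : (1 / a + 1) * (a / (a + 1)) = 1 := by field_simp; ring
          rw [this, Real.rpow_one]
      _ ≤ _ := by
          refine Real.rpow_le_rpow (by positivity) ?_ (by positivity)
          gcongr
  have h3 := h hχ A (T * B) hA (one_le_mul_of_one_le_of_one_le hT1 hB) h2
  refine (h3.mono_B (le_mul_of_one_le_left hB0.le hT1)).mono_Y ?_
  have e1 : (A * (T * B)) ^ (ε / 4) ≤ (A * B) ^ (ε / 2) := by
    calc (A * (T * B)) ^ (ε / 4) ≤ ((A * B) ^ (2:ℝ)) ^ (ε / 4) := by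
          refine Real.rpow_le_rpow (by positivity) ?_ (by positivity)
          rw [Real.rpow_two]
          have : T ≤ A * B := hTA.trans (le_mul_of_one_le_right hA0.le hB)
          calc A * (T * B) = (A * B) * T := by ring
            _ ≤ (A * B) * (A * B) := by gcongr
            _ = _ := by ring
      _ = _ := by rw [← Real.rpow_mul (by positivity)]; ring_nf
  have e2 : T ≤ (A * B) ^ (ε / 2) := by
    calc T ≤ A ^ (ε / 2) := Real.rpow_le_rpow_of_exponent_le hA hae
      _ ≤ _ := Real.rpow_le_rpow hA0.le (le_mul_of_one_le_right hA0.le hB) (by positivity)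
  have hF := FF_pos hA0.le hB0
  calc C * (A * (T * B)) ^ (ε / 4) * FF A (T * B) ≤ C * (A * B) ^ (ε / 2) * ((A * B) ^ (ε / 2) * FF A B) := by
        have := (FF_T hA0.le hB0.le hT1).trans (mul_le_mul_of_nonneg_right e2 hF.le)
        have := FF_nonneg hA0.le (mul_pos hT0 hB0).le
        gcongr
    _ = C * ((A * B) ^ (ε / 2) * (A * B) ^ (ε / 2)) * FF A B := by ring
    _ = _ := by rw [← Real.rpow_add (by positivity)]; ring_nf

lemma full_LS {ε : ℝ} (hε : 0 < ε) : ∃ C : ℝ, 0 ≤ C ∧ ∀ {χ : Eis → Eis → Eis} (_ : IsCubicSymbol χ) (A B : ℝ),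
    1 ≤ A → 1 ≤ B → LS χ A B (C * (A * B) ^ ε * FF A B) := by
  obtain ⟨C1, hC1, h1⟩ := QQ_one ε hε
  obtain ⟨c, hc, h⟩ := Q_to_R (by norm_num) le_rfl QQ_one
  obtain ⟨C2, hC2, h2⟩ := h ε hε
  refine ⟨C1 + C2, by positivity, ?_⟩
  intro χ hχ A B hA hB
  have hA0 : 0 < A := by linarith
  have hB0 : 0 < B := by linarith
  have hF := FF_pos hA0.le hB0
  rcases le_total A B with hle | hle
  · refine (h1 hχ A B hA hB (by rwa [Real.rpow_one])).mono_Y ?_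
    gcongr; linarith
  · have := h2 hχ A B 1 hA hB le_rfl (by rwa [Real.rpow_one, one_mul])
    rw [Real.one_rpow, mul_one, mul_one] at this
    refine this.mono_Y ?_
    gcongr; linarith

lemma chi_PS (hχ : IsCubicSymbol χ) (S : Finset PP) (b : Eis) : ((χ (PS S) b : Eis) : ℂ) = X χ S b := by
  classical
  induction S using Finset.induction_on with
  | empty => rw [PS_empty, hχ.one_bot, X_empty]; rfl
  | insert p S hp ih =>
    rw [PS_insert hp, hχ.mul_bot _ _ _ p.2.2 (PS_primary S), Subring.coe_mul, ih]
    unfold X; rw [Finset.prod_insert hp]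

lemma mu_PS {μ : Eis → ℤ} (hμ : IsMoebius μ) (S : Finset PP) : (μ (PS S)) ^ 2 = 1 := by
  classical
  induction S using Finset.induction_on with
  | empty => rw [PS_empty, hμ.isUnit 1 isUnit_one]; norm_num
  | insert p S hp ih =>
    rw [PS_insert hp, hμ.prime_mul _ _ p.2.1 (fun h => hp (dvd_PS_iff.1 h)), neg_sq, ih]

end

/-- Proposition 3.7, cubic large sieve without squarefreeness in the
inner variable: for arbitrary complex coefficients `λ_b`, `b ∈ ℤ[ω]`,
`∑_{a ≡ 1 (3), N(a) ≤ A} μ(a)² |∑_{N(b) ≤ B} λ_b χ_a(b)|²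
  ≪_ε (AB)^ε (A B^{1/3} + B + (AB)^{2/3}) ∑_{N(b) ≤ B} |λ_b|²`. -/
theorem cubic_large_sieve_dual
    (ε : ℝ) (hε : 0 < ε) :
    ∃ C : ℝ, ∀ (χ : Eis → Eis → Eis), IsCubicSymbol χ →
      ∀ (μ : Eis → ℤ), IsMoebius μ →
      ∀ A B : ℝ, 1/2 ≤ A → 1/2 ≤ B →
      ∀ lb : Eis → ℂ,
        (∑ᶠ a ∈ {a : Eis | (3 : Eis) ∣ (a - 1) ∧ Nm a ≤ A},
            ((μ a : ℝ)) ^ 2 * ‖∑ᶠ b ∈ {b : Eis | Nm b ≤ B}, lb b * ((χ a b : Eis) : ℂ)‖ ^ 2)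
          ≤ C * (A * B) ^ ε * (A * B ^ ((1:ℝ)/3) + B + (A * B) ^ ((2:ℝ)/3)) *
              ∑ᶠ b ∈ {b : Eis | Nm b ≤ B}, ‖lb b‖ ^ 2 := by
  classical
  obtain ⟨C, hC, h⟩ := full_LS hε
  refine ⟨C * 4 ^ ε * 4, ?_⟩
  intro χ hχ μ hμ A B hA hB lb
  have hA0 : 0 < A := by linarith
  have hB0 : 0 < B := by linarith
  have hBall : ∀ {M : Type} [AddCommMonoid M] (f : Eis → M), ∑ᶠ b ∈ {b : Eis | Nm b ≤ B}, f b = ∑ b ∈ Ball B, f b := by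
    intro M _ f
    have hset : {b : Eis | Nm b ≤ B} = ↑(Ball B) := by ext b; simp [mem_Ball]
    rw [hset, finsum_mem_coe_finset]
  rw [hBall]
  simp_rw [hBall]
  have hfin : {a : Eis | (3 : Eis) ∣ (a - 1) ∧ Nm a ≤ A}.Finite := (ball_finite A).subset fun a ha => ha.2
  rw [finsum_mem_eq_finite_toFinset_sum _ hfin]
  have hLS : LS χ A B (C * 4 ^ ε * 4 * (A * B) ^ ε * FF A B) := by
    refine (((h hχ (2 * A) (2 * B) (by linarith) (by linarith)).mono_A (by linarith)).mono_B (by linarith)).mono_Y ?_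
    have e1 : (2 * A * (2 * B)) ^ ε = 4 ^ ε * (A * B) ^ ε := by
      rw [← Real.mul_rpow (by norm_num) (by positivity)]; ring_nf
    have e2 : FF (2 * A) (2 * B) ≤ 4 * FF A B := by
      refine (FF_T (by positivity) hB0.le (by norm_num)).trans ?_
      have : FF (2 * A) B ≤ 2 * FF A B := by
        unfold FF
        have h1 : (2 * A * B) ^ ((2:ℝ)/3) ≤ 2 * (A * B) ^ ((2:ℝ)/3) := by
          rw [mul_assoc, Real.mul_rpow (by norm_num) (by positivity)]
          have := rpow_le_of_one_le (show (1:ℝ) ≤ 2 by norm_num) (show (2:ℝ)/3 ≤ 1 by norm_num)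
          gcongr
        nlinarith
      linarith
    rw [e1]
    calc C * (4 ^ ε * (A * B) ^ ε) * FF (2 * A) (2 * B) ≤ C * (4 ^ ε * (A * B) ^ ε) * (4 * FF A B) := by gcongr
      _ = _ := by ring
  have hdual := dual_fin (SF A) (Ball B) (fun S b => X χ S b) (by have := FF_pos hA0.le hB0; positivity) hLS lb
  refine le_trans ?_ hdual
  set G : Eis → ℝ := fun a => (μ a : ℝ) ^ 2 * ‖∑ b ∈ Ball B, lb b * ((χ a b : Eis) : ℂ)‖ ^ 2 with hG
  have hGS : ∀ S, G (PS S) = ‖∑ b ∈ Ball B, lb b * X χ S b‖ ^ 2 := by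
    intro S
    have : ((μ (PS S) : ℤ) : ℝ) ^ 2 = 1 := by exact_mod_cast mu_PS hμ S
    simp only [hG]
    rw [this, one_mul]
    simp_rw [chi_PS hχ]
  simp_rw [← hGS]
  calc ∑ a ∈ hfin.toFinset, G a = ∑ a ∈ hfin.toFinset.filter Squarefree, G a := by
        symm
        refine Finset.sum_filter_of_ne fun a _ hne => ?_
        by_contra hn
        apply hne
        simp only [hG]
        rw [hμ.eq_zero a hn]; simp
    _ ≤ _ := by
        refine sum_le_image _ _ PS G (fun _ => by simp only [hG]; positivity) ?_
        intro a ha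
        rw [Finset.mem_filter, Set.Finite.mem_toFinset] at ha
        obtain ⟨S, hS⟩ := exists_PS ha.1.1 ha.2
        exact ⟨S, mem_SF.2 (by rw [← hS]; exact ha.1.2), hS.symm⟩

end CubicPaper
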